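/- arXiv:1803.01420 — 6 statements merged into one kernel-verified Lean document; each statement's English description precedes it below -/
import Mathlib

section
/- There exist numerical constants C, C' > 0 such that the following holds. Let k ≥ 2 and let {μ_1,…,μ_k} be a BCD(ρ) family on a finite sample space Ω ⊆ {−1,1}^k centered around μ_0, let n ≥ 1 be an integer with ρ ≤ (n·ln k)^{−1/2}/C', and assume condition (corr) holds for (μ_0,…,μ_k; n, ρ). Let T be a finite set, and for each x ∈ Ω^n let P_{Π|X=x} be a probability distribution on T (a channel); let (X,Π) be jointly distributed with X ∼ μ_0^n and Π drawn from P_{Π|X}. Then ∑_{i=1}^k H²(P_{Π|X∼μ_0^n}, P_{Π|X∼μ_i^n}) ≤ C·n·ρ²·log(k²/(n·ρ²))·(I(Π;X) + 1), where P_{Π|X∼ν} denotes the distribution of the channel output when its input is drawn from ν. -/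
open Finset

noncomputable section

/-- `p` is a probability distribution on the finite set `Ω`. -/
def IsDist {Ω : Type*} [Fintype Ω] (p : Ω → ℝ) : Prop :=
  (∀ x, 0 ≤ p x) ∧ ∑ x, p x = 1

/-- The distribution of `n` i.i.d. samples from `p`. -/
def prodDist {Ω : Type*} [Fintype Ω] (p : Ω → ℝ) (n : ℕ) : (Fin n → Ω) → ℝ :=
  fun x => ∏ j, p (x j)

/-- Squared Hellinger distance between two distributions on a finite set. -/
def hellSq {Ω : Type*} [Fintype Ω] (p q : Ω → ℝ) : ℝ :=
  (1/2) * ∑ x, (Real.sqrt (p x) - Real.sqrt (q x))^2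

/-- Base-2 Shannon entropy of a distribution on a finite set. -/
def ent {Ω : Type*} [Fintype Ω] (p : Ω → ℝ) : ℝ :=
  -∑ x, p x * Real.logb 2 (p x)

/-- Mutual information `I(A;B) = H(A) + H(B) − H(A,B)` computed from a joint
distribution `J` on `A × B`. -/
def mutInfo {A B : Type*} [Fintype A] [Fintype B] (J : A × B → ℝ) : ℝ :=
  ent (fun a => ∑ b, J (a, b)) + ent (fun b => ∑ a, J (a, b)) - ent J


lemma sum_pi_prod {α : Type*} [Fintype α] (n : ℕ) (f : Fin n → α → ℝ) :
    ∑ x : Fin n → α, ∏ j, f j (x j) = ∏ j, ∑ a, f j a := by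
  rw [Finset.prod_univ_sum, Fintype.piFinset_univ]

/-- Transposition of a relation given by its rows. -/
def transp (k n : ℕ) : (Fin k → Finset (Fin n)) ≃ (Fin n → Finset (Fin k)) where
  toFun A j := Finset.univ.filter (fun i => j ∈ A i)
  invFun S i := Finset.univ.filter (fun j => i ∈ S j)
  left_inv A := by ext i j; simp
  right_inv S := by ext i j; simp

lemma fourier_bound {α : Type*} [Fintype α] {k n : ℕ} (m : α → ℝ) (v : α → Fin k → ℝ) (r : ℝ)
    (c : Fin k → Finset (Fin n) → ℝ) (b : Fin k → ℝ)
    (hc : ∀ i A, |c i A| ≤ b i * r ^ A.card) :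
    ∑ x : Fin n → α, (∏ j, m (x j)) * ∏ i, ∑ A, c i A * ∏ j ∈ A, v (x j) i
      ≤ (∏ i, b i) * (∑ S, r ^ S.card * |∑ a, m a * ∏ i ∈ S, v a i|) ^ n := by
  have hcomm : ∀ (A : Fin k → Finset (Fin n)) (g : Fin k → Fin n → ℝ),
      ∏ i, ∏ j ∈ A i, g i j = ∏ j, ∏ i ∈ transp k n A j, g i j := by
    intro A g
    apply Finset.prod_comm'
    intro i j
    simp [transp]
  have h1 : ∀ x : Fin n → α, (∏ j, m (x j)) * ∏ i, ∑ A, c i A * ∏ j ∈ A, v (x j) i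
      = ∑ A : Fin k → Finset (Fin n), (∏ i, c i (A i)) *
          ∏ j, (m (x j) * ∏ i ∈ transp k n A j, v (x j) i) := by
    intro x
    rw [← sum_pi_prod k (fun i A => c i A * ∏ j ∈ A, v (x j) i), Finset.mul_sum]
    refine Finset.sum_congr rfl fun A _ => ?_
    rw [Finset.prod_mul_distrib, Finset.prod_mul_distrib, hcomm A (fun i j => v (x j) i)]
    ring
  simp_rw [h1]
  rw [Finset.sum_comm]
  simp_rw [← Finset.mul_sum]
  have h2 : ∀ A : Fin k → Finset (Fin n),
      (∏ i, c i (A i)) * ∑ x : Fin n → α, ∏ j, (m (x j) * ∏ i ∈ transp k n A j, v (x j) i)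
      ≤ (∏ i, b i) * ∏ j, (r ^ (transp k n A j).card *
          |∑ a, m a * ∏ i ∈ transp k n A j, v a i|) := by
    intro A
    rw [sum_pi_prod n (fun j a => m a * ∏ i ∈ transp k n A j, v a i)]
    refine (le_abs_self _).trans ?_
    rw [abs_mul, Finset.abs_prod, Finset.abs_prod, Finset.prod_mul_distrib, ← mul_assoc]
    refine mul_le_mul_of_nonneg_right ?_ (Finset.prod_nonneg fun _ _ => abs_nonneg _)
    have h3 : ∏ j, r ^ (transp k n A j).card = ∏ i, r ^ (A i).card := by
      have := hcomm A (fun _ _ => r)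
      simpa using this.symm
    rw [h3, ← Finset.prod_mul_distrib]
    exact Finset.prod_le_prod (fun _ _ => abs_nonneg _) (fun i _ => hc i (A i))
  refine (Finset.sum_le_sum fun A _ => h2 A).trans ?_
  rw [← Finset.mul_sum]
  rw [Equiv.sum_comp (transp k n) (fun S => ∏ j, (r ^ (S j).card *
          |∑ a, m a * ∏ i ∈ S j, v a i|))]
  rw [sum_pi_prod n (fun _ S => r ^ S.card * |∑ a, m a * ∏ i ∈ S, v a i|)]
  simp

lemma dv {ι : Type*} [Fintype ι] (m Q h : ι → ℝ) (hm : ∀ x, 0 ≤ m x) (hQ : ∀ x, 0 ≤ Q x)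
    (hh : ∀ x, 0 < h x) :
    ∑ x, m x * Q x * Real.log (h x) ≤
      ∑ x, m x * Q x * (Real.log (Q x) - Real.log (∑ y, m y * Q y))
        + (∑ y, m y * Q y) * Real.log (∑ y, m y * h y) := by
  set p := ∑ y, m y * Q y with hp
  set Z := ∑ y, m y * h y with hZ
  have hp0 : 0 ≤ p := Finset.sum_nonneg fun x _ => mul_nonneg (hm x) (hQ x)
  rcases hp0.eq_or_lt with h0 | h0
  · have hz : ∀ x, m x * Q x = 0 := by
      intro x
      exact (Finset.sum_eq_zero_iff_of_nonneg
        (fun x _ => mul_nonneg (hm x) (hQ x))).1 h0.symm x (Finset.mem_univ x)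
    simp [hz, ← h0]
  · have hZ0 : 0 < Z := by
      have hZn : 0 ≤ Z := Finset.sum_nonneg fun x _ => mul_nonneg (hm x) (hh x).le
      rcases hZn.eq_or_lt with h1 | h1
      · exfalso
        have hz : ∀ x, m x * h x = 0 := by
          intro x
          exact (Finset.sum_eq_zero_iff_of_nonneg
            (fun x _ => mul_nonneg (hm x) (hh x).le)).1 h1.symm x (Finset.mem_univ x)
        have hz2 : ∀ x, m x = 0 := fun x => by
          rcases mul_eq_zero.1 (hz x) with h | h
          · exact h
          · exact absurd h (hh x).ne'
        simp [hp, hz2] at h0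
      · exact h1
    have key : ∀ x, m x * Q x - p / Z * (m x * h x) ≤
        m x * Q x * (Real.log (Q x) - Real.log p) + m x * Q x * Real.log Z
          - m x * Q x * Real.log (h x) := by
      intro x
      rcases (hQ x).eq_or_lt with h1 | h1
      · rw [← h1]
        have : 0 ≤ p / Z * (m x * h x) := by
          have := hm x; have := hh x; positivity
        simp; exact this
      · have hl := Real.one_sub_inv_le_log_of_pos (x := Q x * Z / (p * h x))
          (by have := hh x; positivity)
        rw [Real.log_div (by positivity) (by have := (hh x).ne'; positivity),
          Real.log_mul h1.ne' hZ0.ne', Real.log_mul h0.ne' (hh x).ne'] at hl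
        have hl2 := mul_le_mul_of_nonneg_left hl (mul_nonneg (hm x) (hQ x))
        have he : m x * Q x * (1 - (Q x * Z / (p * h x))⁻¹)
            = m x * Q x - p / Z * (m x * h x) := by
          have := (hh x).ne'
          field_simp
        rw [he] at hl2
        linarith
    have hs := Finset.sum_le_sum fun x (_ : x ∈ Finset.univ) => key x
    rw [Finset.sum_sub_distrib, Finset.sum_sub_distrib, Finset.sum_add_distrib,
      ← Finset.mul_sum, ← Finset.sum_mul, ← hp, ← hZ, div_mul_cancel₀ _ hZ0.ne'] at hs
    linarith

lemma mutInfo_eq {T X : Type*} [Fintype T] [Fintype X] (m : X → ℝ) (P : X → T → ℝ)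
    (hm : ∀ x, 0 ≤ m x) (hP : ∀ x, (∀ t, 0 ≤ P x t) ∧ ∑ t, P x t = 1) :
    mutInfo (fun q : T × X => m q.2 * P q.2 q.1) * Real.log 2
      = ∑ t, ∑ x, m x * P x t * (Real.log (P x t) - Real.log (∑ y, m y * P y t)) := by
  have hl2 : Real.log 2 ≠ 0 := (Real.log_pos (by norm_num)).ne'
  have hent : ∀ {Y : Type _} [Fintype Y] (p : Y → ℝ),
      ent p * Real.log 2 = -∑ y, p y * Real.log (p y) := by
    intro Y _ p
    unfold ent
    rw [neg_mul, Finset.sum_mul]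
    congr 1
    refine Finset.sum_congr rfl fun y _ => ?_
    rw [Real.logb]; field_simp
  have hent2 : ∀ {Y : Type _} [Fintype Y] (p : Y → ℝ),
      ent p * Real.log 2 = -∑ y, p y * Real.log (p y) := by
    intro Y _ p
    unfold ent
    rw [neg_mul, Finset.sum_mul]
    congr 1
    refine Finset.sum_congr rfl fun y _ => ?_
    rw [Real.logb]; field_simp
  have hent3 : ∀ {Y : Type _} [Fintype Y] (p : Y → ℝ),
      ent p * Real.log 2 = -∑ y, p y * Real.log (p y) := by
    intro Y _ p
    unfold ent
    rw [neg_mul, Finset.sum_mul]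
    congr 1
    refine Finset.sum_congr rfl fun y _ => ?_
    rw [Real.logb]; field_simp
  unfold mutInfo
  rw [sub_mul, add_mul, hent, hent2, hent3]
  have e1 : ∀ x, ∑ t, m x * P x t = m x := fun x => by
    rw [← Finset.mul_sum, (hP x).2, mul_one]
  simp only [e1]
  rw [Fintype.sum_prod_type]
  have e2 : ∑ x, m x * Real.log (m x) = ∑ t, ∑ x, m x * P x t * Real.log (m x) := by
    rw [Finset.sum_comm]
    refine Finset.sum_congr rfl fun x _ => ?_
    rw [← Finset.sum_mul, e1]
  have e3 : ∑ t, (∑ x, m x * P x t) * Real.log (∑ x, m x * P x t)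
      = ∑ t, ∑ x, m x * P x t * Real.log (∑ x, m x * P x t) := by
    refine Finset.sum_congr rfl fun t _ => ?_
    rw [Finset.sum_mul]
  rw [e2, e3, ← Finset.sum_neg_distrib, ← Finset.sum_neg_distrib, ← Finset.sum_neg_distrib,
    ← Finset.sum_add_distrib, ← Finset.sum_sub_distrib]
  refine Finset.sum_congr rfl fun t _ => ?_
  rw [← Finset.sum_neg_distrib, ← Finset.sum_neg_distrib, ← Finset.sum_neg_distrib,
    ← Finset.sum_add_distrib, ← Finset.sum_sub_distrib]
  refine Finset.sum_congr rfl fun x _ => ?_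
  rcases (hm x).eq_or_lt with h | h
  · simp [← h]
  rcases ((hP x).1 t).eq_or_lt with hPt | hPt
  · simp [← hPt]
  rw [Real.log_mul h.ne' hPt.ne']
  ring

lemma log_lower (u : ℝ) (hu : |u| ≤ 1/2) : 2 * u - 4 * u^2 ≤ Real.log ((1+u)^2) := by
  obtain ⟨h1, h2⟩ := abs_le.1 hu
  rw [Real.log_pow]
  have := Real.one_sub_inv_le_log_of_pos (x := 1+u) (by linarith)
  have h3 : u - 2 * u^2 ≤ 1 - (1+u)⁻¹ := by
    have hp : 0 < 1 + u := by linarith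
    rw [show 1 - (1+u)⁻¹ = u / (1+u) by field_simp; ring, le_div_iff₀ hp]
    nlinarith [mul_nonneg (sq_nonneg u) (by linarith : 0 ≤ 1/2+u)]
  push_cast
  linarith

lemma pointwise {ι : Type*} [Fintype ι] {k : ℕ} (m Q : ι → ℝ) (L : Fin k → ι → ℝ)
    (G : ι → Prop) [DecidablePred G] (d dl τ : ℝ)
    (hm : ∀ x, 0 ≤ m x) (hm1 : ∑ x, m x = 1) (hQ : ∀ x, 0 ≤ Q x)
    (hd : 0 < d) (hdl : d ≤ dl) (hτ0 : 0 ≤ τ) (hτ : τ^2 ≤ 36 * dl)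
    (hG : ∀ i x, G x → |L i x - 1| ≤ τ)
    (hmgf : ∀ s : Fin k → ℝ, (∀ i, |s i| * τ ≤ 36/100) →
      ∑ x, m x * ∏ i, (1 + s i * (L i x - 1))^2 ≤ Real.exp (1 + 2 * d * ∑ i, s i ^2))
    (p : ℝ) (hp : p = ∑ x, m x * Q x) (hp0 : 0 < p) (a : Fin k → ℝ)
    (ha : ∀ i, a i * p = ∑ x, m x * Q x * (if G x then L i x - 1 else 0)) :
    p * ∑ i, a i ^ 2 ≤ 200 * dl *
      (∑ x, m x * Q x * (Real.log (Q x) - Real.log p) + 2 * p) := by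
  have hdl0 : 0 < dl := lt_of_lt_of_le hd hdl
  have hmQ : ∀ x, 0 ≤ m x * Q x := fun x => mul_nonneg (hm x) (hQ x)
  have haτ : ∀ i, |a i| ≤ τ := by
    intro i
    have : |a i| * p ≤ τ * p := by
      rw [← abs_of_pos hp0, ← abs_mul, abs_of_pos hp0, ha i, hp, Finset.mul_sum]
      refine (Finset.abs_sum_le_sum_abs _ _).trans (Finset.sum_le_sum fun x _ => ?_)
      rw [abs_mul, abs_of_nonneg (hmQ x), mul_comm]
      refine mul_le_mul_of_nonneg_right ?_ (hmQ x)
      split_ifs with hx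
      · exact hG i x hx
      · simpa using hτ0
    exact le_of_mul_le_mul_right this hp0
  set s : Fin k → ℝ := fun i => a i / (100 * dl) with hs
  have hsτ : ∀ i, |s i| * τ ≤ 36/100 := by
    intro i
    simp only [hs]
    rw [abs_div, abs_of_pos (by positivity : 0 < 100 * dl), div_mul_eq_mul_div,
      div_le_iff₀ (by positivity)]
    nlinarith [haτ i, mul_le_mul_of_nonneg_right (haτ i) hτ0]
  set h : ι → ℝ := fun x => if G x then ∏ i, (1 + s i * (L i x - 1))^2 else 1 with hh
  have hu : ∀ i x, G x → |s i * (L i x - 1)| ≤ 36/100 := by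
    intro i x hx
    rw [abs_mul]
    exact (mul_le_mul_of_nonneg_left (hG i x hx) (abs_nonneg _)).trans (hsτ i)
  have hupos : ∀ i x, G x → 0 < 1 + s i * (L i x - 1) := by
    intro i x hx
    have := (abs_le.1 (hu i x hx)).1
    linarith
  have hpos : ∀ x, 0 < h x := by
    intro x
    simp only [hh]
    split_ifs with hx
    · exact Finset.prod_pos fun i _ => pow_pos (hupos i x hx) 2
    · exact one_pos
  have hDV := dv m Q h hm hQ hpos
  rw [← hp] at hDV
  set Ss := ∑ i, s i ^ 2 with hSs
  have hS0 : 0 ≤ Ss := Finset.sum_nonneg fun i _ => sq_nonneg _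
  have hZ : Real.log (∑ y, m y * h y) ≤ 2 + 2 * d * Ss := by
    have h1 : ∑ y, m y * h y ≤ Real.exp (2 + 2 * d * Ss) := by
      have h2 : ∑ y, m y * h y ≤ ∑ x, (m x * ∏ i, (1 + s i * (L i x - 1))^2 + m x) := by
        refine Finset.sum_le_sum fun x _ => ?_
        have hpr : 0 ≤ ∏ i, (1 + s i * (L i x - 1))^2 :=
          Finset.prod_nonneg fun i _ => sq_nonneg _
        have := mul_nonneg (hm x) hpr
        have := hm x
        simp only [hh]
        split_ifs <;> linarith
      rw [Finset.sum_add_distrib, hm1] at h2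
      have h3 := hmgf s hsτ
      have h4 : (1:ℝ) ≤ Real.exp (1 + 2 * d * Ss) := by
        apply Real.one_le_exp; positivity
      have h5 : Real.exp (2 + 2 * d * Ss) = Real.exp 1 * Real.exp (1 + 2 * d * Ss) := by
        rw [← Real.exp_add]; ring_nf
      have h6 : (2:ℝ) ≤ Real.exp 1 := by
        have := Real.add_one_le_exp (1:ℝ); linarith
      rw [h5]
      nlinarith
    have hZpos : 0 < ∑ y, m y * h y ∨ ∑ y, m y * h y = 0 := by
      have : 0 ≤ ∑ y, m y * h y := Finset.sum_nonneg fun x _ => mul_nonneg (hm x) (hpos x).le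
      rcases this.eq_or_lt with h | h
      · right; exact h.symm
      · left; exact h
    rcases hZpos with h2 | h2
    · exact (Real.log_le_iff_le_exp h2).2 h1
    · rw [h2, Real.log_zero]; positivity
  have hlow : p * (2 * ∑ i, s i * a i - 4 * τ^2 * Ss) ≤ ∑ x, m x * Q x * Real.log (h x) := by
    have h1 : ∀ x, m x * Q x * (∑ i, (2 * s i * (if G x then L i x - 1 else 0)
        - 4 * τ^2 * s i ^ 2)) ≤ m x * Q x * Real.log (h x) := by
      intro x
      refine mul_le_mul_of_nonneg_left ?_ (hmQ x)
      simp only [hh]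
      split_ifs with hx
      · rw [Real.log_prod (fun i _ => (pow_pos (hupos i x hx) 2).ne')]
        refine Finset.sum_le_sum fun i _ => ?_
        refine le_trans ?_ (log_lower (s i * (L i x - 1)) ((hu i x hx).trans (by norm_num)))
        have : (L i x - 1)^2 ≤ τ^2 := by
          rw [← sq_abs]; exact pow_le_pow_left₀ (abs_nonneg _) (hG i x hx) 2
        nlinarith [mul_le_mul_of_nonneg_left this (sq_nonneg (s i))]
      · rw [Real.log_one]
        refine Finset.sum_nonpos fun i _ => ?_
        have : 0 ≤ 4 * τ^2 * s i ^ 2 := by positivity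
        linarith
    refine le_trans (le_of_eq ?_) (Finset.sum_le_sum fun x _ => h1 x)
    simp_rw [Finset.sum_sub_distrib, ← Finset.mul_sum, mul_sub]
    rw [Finset.sum_sub_distrib, ← Finset.sum_mul, ← hp, ← hSs]
    congr 1
    simp_rw [Finset.mul_sum]
    rw [Finset.sum_comm]
    refine Finset.sum_congr rfl fun i _ => ?_
    calc p * (2 * (s i * a i)) = 2 * s i * (a i * p) := by ring
      _ = _ := by
        rw [ha i, Finset.mul_sum]
        refine Finset.sum_congr rfl fun x _ => ?_
        ring
  set A := ∑ i, a i ^ 2 with hA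
  have hA0 : 0 ≤ A := Finset.sum_nonneg fun i _ => sq_nonneg _
  have hsa : ∑ i, s i * a i = A / (100 * dl) := by
    rw [hA, Finset.sum_div]
    refine Finset.sum_congr rfl fun i _ => ?_
    simp only [hs]; ring
  have hss : Ss = A / (100 * dl)^2 := by
    rw [hSs, hA, Finset.sum_div]
    refine Finset.sum_congr rfl fun i _ => ?_
    simp only [hs]; rw [div_pow]
  set K := ∑ x, m x * Q x * (Real.log (Q x) - Real.log p)
  have hfin : p * (2 * ∑ i, s i * a i - 4 * τ^2 * Ss) ≤ K + p * (2 + 2 * d * Ss) := by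
    have := mul_le_mul_of_nonneg_left hZ hp0.le
    linarith
  have hc1 : 4 * τ^2 * Ss ≤ 144 * dl * Ss := by nlinarith
  have hc2 : 2 * d * Ss ≤ 2 * dl * Ss := by nlinarith
  have hdS : dl * Ss = A / (10000 * dl) := by
    rw [hss]; field_simp; norm_num
  have hx : p * (A / (100 * dl)) ≤ 2 * (K + 2 * p) := by
    have e : A / (10000 * dl) = (A / (100 * dl)) / 100 := by field_simp; norm_num
    have h7 : 2 * (A / (100 * dl)) - 146/100 * (A / (100 * dl)) - 2 ≤
        (2 * ∑ i, s i * a i - 4 * τ^2 * Ss) - (2 + 2 * d * Ss) := by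
      rw [hsa]; linarith
    have h8 : 0 ≤ A / (100 * dl) := by positivity
    have h9 := mul_le_mul_of_nonneg_left h7 hp0.le
    nlinarith [mul_nonneg hp0.le h8]
  calc p * A = 100 * dl * (p * (A / (100 * dl))) := by field_simp
    _ ≤ 100 * dl * (2 * (K + 2 * p)) := mul_le_mul_of_nonneg_left hx (by positivity)
    _ = _ := by ring

lemma prod_expand {n : ℕ} (γ : ℝ) (y : Fin n → ℝ) :
    ∏ j, (1 + γ * y j) = ∑ A : Finset (Fin n), γ ^ A.card * ∏ j ∈ A, y j := by
  rw [Finset.prod_one_add, Finset.powerset_univ]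
  refine Finset.sum_congr rfl fun A _ => ?_
  rw [Finset.prod_mul_distrib, Finset.prod_const]

/-- Fourier coefficients of the squared test function. -/
def coef (n : ℕ) (ρ s : ℝ) (A : Finset (Fin n)) : ℝ :=
  (if A = ∅ then (1 - s)^2 else 0) + 2 * s * (1 - s) * ρ ^ A.card
    + s^2 * (1 + ρ^2)^n * (2 * ρ / (1 + ρ^2)) ^ A.card

lemma coef_expand {n : ℕ} (ρ s : ℝ) (y : Fin n → ℝ) (hy : ∀ j, y j ^ 2 = 1) :
    (1 + s * (∏ j, (1 + ρ * y j) - 1))^2 = ∑ A, coef n ρ s A * ∏ j ∈ A, y j := by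
  have h1 : (∏ j, (1 + ρ * y j))^2 = (1 + ρ^2)^n * ∏ j, (1 + (2 * ρ / (1 + ρ^2)) * y j) := by
    rw [← Finset.prod_pow]
    have : (1 + ρ^2)^n = ∏ _j : Fin n, (1 + ρ^2) := by simp
    rw [this, ← Finset.prod_mul_distrib]
    refine Finset.prod_congr rfl fun j _ => ?_
    have h0 : 1 + ρ^2 ≠ 0 := by positivity
    field_simp
    linear_combination ρ^2 * hy j
  have h2 : (1 + s * (∏ j, (1 + ρ * y j) - 1))^2
      = (1 - s)^2 + 2 * s * (1 - s) * ∏ j, (1 + ρ * y j) + s^2 * (∏ j, (1 + ρ * y j))^2 := by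
    ring
  rw [h2, h1, prod_expand, prod_expand]
  simp only [coef, add_mul, Finset.sum_add_distrib, ite_mul, zero_mul]
  rw [Finset.sum_ite_eq' Finset.univ ∅]
  simp only [Finset.mem_univ, if_true, Finset.prod_empty, mul_one, Finset.mul_sum]
  simp only [mul_assoc]

lemma coef_bound {n : ℕ} (hn : 1 ≤ n) (ρ s δ r : ℝ) (hρ : 0 < ρ) (hr : 0 < r)
    (hδ : ρ = δ * r) (hδ0 : 0 < δ) (hd : (n:ℝ) * ρ^2 = δ^2) (hδ1 : δ ≤ 1/10)
    (hs : |s| * δ ≤ 6/100) (A : Finset (Fin n)) :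
    |coef n ρ s A| ≤ (1 + 2 * δ^2 * s^2) * r ^ A.card := by
  have hE1 : 1 + ρ^2 ≤ (1 + ρ^2)^n := by
    exact le_self_pow₀ (by nlinarith [sq_nonneg ρ]) (by omega)
  have hE2 : (1 + ρ^2)^n ≤ 1 + 2 * δ^2 := by
    have h1 : (1 + ρ^2)^n ≤ Real.exp (δ^2) := by
      rw [← hd, Real.exp_nat_mul]
      refine pow_le_pow_left₀ (by positivity) ?_ n
      have := Real.add_one_le_exp (ρ^2); linarith
    have h2 := Real.abs_exp_sub_one_le (x := δ^2) (by rw [abs_of_nonneg (sq_nonneg δ)]; nlinarith)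
    rw [abs_of_nonneg (sq_nonneg δ)] at h2
    have := (abs_le.1 h2).2
    linarith
  set E := (1 + ρ^2)^n with hE
  have hE0 : 0 < E := by positivity
  have hb1 : 1 ≤ 1 + 2 * δ^2 * s^2 := by nlinarith [mul_nonneg (sq_nonneg δ) (sq_nonneg s)]
  have hsδ2 : s^2 * δ^2 ≤ 36/10000 := by
    have : (|s| * δ)^2 ≤ (6/100)^2 := pow_le_pow_left₀ (by positivity) hs 2
    rw [mul_pow, sq_abs] at this; linarith
  rcases Nat.lt_or_ge A.card 2 with hA | hA
  · rcases Nat.lt_or_ge A.card 1 with hA1 | hA1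
    · have h0 : A.card = 0 := by omega
      have hA0 : A = ∅ := Finset.card_eq_zero.1 h0
      rw [coef, if_pos hA0, h0, ← hE]
      simp only [pow_zero, mul_one]
      have e : (1 - s)^2 + 2 * s * (1 - s) + s^2 * E = 1 + s^2 * (E - 1) := by ring
      rw [e, abs_of_nonneg]
      · nlinarith [mul_le_mul_of_nonneg_left hE2 (sq_nonneg s)]
      · have : 0 ≤ E - 1 := by nlinarith [sq_nonneg ρ]
        positivity
    · have h1 : A.card = 1 := by omega
      have hA0 : A ≠ ∅ := by rintro rfl; simp at h1
      rw [coef, if_neg hA0, h1, ← hE]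
      simp only [pow_one, zero_add]
      have e : 2 * s * (1 - s) * ρ + s^2 * E * (2 * ρ / (1 + ρ^2))
          = r * (2 * (s * δ) + 2 * (s^2 * δ) * (E / (1 + ρ^2) - 1)) := by
        rw [show r * (2 * (s * δ) + 2 * (s^2 * δ) * (E / (1 + ρ^2) - 1))
          = (δ * r) * (2 * s + 2 * s^2 * (E / (1 + ρ^2) - 1)) by ring, ← hδ]
        field_simp; ring
      rw [e, abs_mul, abs_of_pos hr, mul_comm]
      refine mul_le_mul_of_nonneg_right (le_trans ?_ hb1) hr.le
      have hF1 : 1 ≤ E / (1 + ρ^2) := by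
        rw [le_div_iff₀ (by positivity)]; linarith
      have hF2 : E / (1 + ρ^2) ≤ 1 + 2 * δ^2 := by
        refine le_trans (div_le_self hE0.le (by nlinarith [sq_nonneg ρ])) hE2
      refine (abs_add_le _ _).trans ?_
      have hF0 : 0 ≤ E / (1 + ρ^2) - 1 := by linarith
      have q1 : |2 * (s * δ)| = 2 * (|s| * δ) := by
        rw [abs_mul, abs_mul, abs_of_pos hδ0, abs_of_nonneg (by norm_num : (0:ℝ) ≤ 2)]
      have q2 : |2 * (s^2 * δ) * (E / (1 + ρ^2) - 1)| = 2 * (s^2 * δ) * (E / (1 + ρ^2) - 1) :=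
        abs_of_nonneg (by positivity)
      rw [q1, q2]
      have h3 : 2 * (s^2 * δ) * (E / (1 + ρ^2) - 1) ≤ 2 * (s^2 * δ) * (2 * δ^2) :=
        mul_le_mul_of_nonneg_left (by linarith) (by positivity)
      have h4 : 2 * (s^2 * δ) * (2 * δ^2) = 4 * (s^2 * δ^2) * δ := by ring
      nlinarith
  · have hA0 : A ≠ ∅ := by rintro rfl; simp at hA
    rw [coef, if_neg hA0, ← hE, zero_add]
    set a := A.card
    have hp1 : ρ^a ≤ r^a * δ^2 := by
      rw [hδ, mul_pow, mul_comm]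
      exact mul_le_mul_of_nonneg_left (pow_le_pow_of_le_one hδ0.le (by linarith) hA) (by positivity)
    have hp2 : (2 * ρ / (1 + ρ^2))^a ≤ r^a * (4 * δ^2) := by
      have h5 : 2 * ρ / (1 + ρ^2) ≤ r * (2 * δ) := by
        rw [show r * (2 * δ) = 2 * (δ * r) by ring, ← hδ]
        exact div_le_self (by positivity) (by nlinarith [sq_nonneg ρ])
      refine (pow_le_pow_left₀ (by positivity) h5 a).trans ?_
      rw [mul_pow]
      refine mul_le_mul_of_nonneg_left ?_ (by positivity)
      refine (pow_le_pow_of_le_one (by positivity) (by linarith) hA).trans ?_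
      nlinarith
    have hra : 0 < r^a := by positivity
    refine (abs_add_le _ _).trans ?_
    rw [abs_mul (2 * s * (1 - s)), abs_of_pos (by positivity : 0 < ρ^a),
      abs_of_nonneg (by positivity : 0 ≤ s^2 * E * (2 * ρ / (1 + ρ^2))^a)]
    have h6 : |2 * s * (1 - s)| ≤ 2 * |s| + 2 * s^2 := by
      rw [show 2 * s * (1 - s) = 2 * s - 2 * s^2 by ring]
      refine (abs_sub _ _).trans ?_
      rw [abs_mul, abs_of_nonneg (by norm_num : (0:ℝ) ≤ 2),
        abs_of_nonneg (by positivity : 0 ≤ 2 * s^2)]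
    have h7 : |2 * s * (1 - s)| * ρ^a ≤ (2 * |s| + 2 * s^2) * (r^a * δ^2) :=
      mul_le_mul h6 hp1 (by positivity) (by positivity)
    have h8 : s^2 * E * (2 * ρ / (1 + ρ^2))^a ≤ s^2 * 3 * (r^a * (4 * δ^2)) := by
      refine mul_le_mul ?_ hp2 (by positivity) (by positivity)
      exact mul_le_mul_of_nonneg_left (by nlinarith) (sq_nonneg s)
    have h9 : (2 * |s| + 2 * s^2) * (r^a * δ^2) + s^2 * 3 * (r^a * (4 * δ^2))
        = (2 * (|s| * δ) * δ + 14 * (s^2 * δ^2)) * r^a := by ring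
    refine (add_le_add h7 h8).trans ?_
    rw [h9]
    refine mul_le_mul_of_nonneg_right (le_trans ?_ hb1) hra.le
    nlinarith [mul_le_mul_of_nonneg_right hs hδ0.le]

lemma mgf {α : Type*} [Fintype α] {k n : ℕ} (hn : 1 ≤ n) (m : α → ℝ) (v : α → Fin k → ℝ)
    (hv : ∀ a i, v a i ^ 2 = 1)
    (ρ δ r : ℝ) (hρ : 0 < ρ) (hr : 0 < r)
    (hδ : ρ = δ * r) (hδ0 : 0 < δ) (hd : (n:ℝ) * ρ^2 = δ^2) (hδ1 : δ ≤ 1/10)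
    (hcorr : ∑ S, r ^ S.card * |∑ a, m a * ∏ i ∈ S, v a i| ≤ 1 + 1 / (n:ℝ))
    (s : Fin k → ℝ) (hs : ∀ i, |s i| * δ ≤ 6/100) :
    ∑ x : Fin n → α, (∏ j, m (x j)) * ∏ i, (1 + s i * (∏ j, (1 + ρ * v (x j) i) - 1))^2
      ≤ Real.exp (1 + 2 * δ^2 * ∑ i, s i ^ 2) := by
  have h1 := fourier_bound m v r (fun i A => coef n ρ (s i) A)
    (fun i => 1 + 2 * δ^2 * s i ^ 2)
    (fun i A => coef_bound hn ρ (s i) δ r hρ hr hδ hδ0 hd hδ1 (hs i) A)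
  have h2 : ∀ x : Fin n → α, ∏ i, (1 + s i * (∏ j, (1 + ρ * v (x j) i) - 1))^2
      = ∏ i, ∑ A, coef n ρ (s i) A * ∏ j ∈ A, v (x j) i := fun x =>
    Finset.prod_congr rfl fun i _ => coef_expand ρ (s i) (fun j => v (x j) i) fun j => hv _ _
  simp_rw [h2]
  refine h1.trans ?_
  rw [add_comm, Real.exp_add]
  have h0 : 0 ≤ ∑ S, r ^ S.card * |∑ a, m a * ∏ i ∈ S, v a i| :=
    Finset.sum_nonneg fun S _ => by positivity
  refine mul_le_mul ?_ ?_ (pow_nonneg h0 n) (Real.exp_pos _).le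
  · rw [Finset.mul_sum, Real.exp_sum]
    refine Finset.prod_le_prod (fun i _ => by positivity) fun i _ => ?_
    have := Real.add_one_le_exp (2 * δ^2 * s i ^ 2); linarith
  · refine (pow_le_pow_left₀ h0 hcorr n).trans ?_
    have hn0 : (n:ℝ) ≠ 0 := by positivity
    have : Real.exp 1 = Real.exp (1 / (n:ℝ)) ^ n := by
      rw [← Real.exp_nat_mul]; congr 1; field_simp
    rw [this]
    refine pow_le_pow_left₀ (by positivity) ?_ n
    have := Real.add_one_le_exp (1 / (n:ℝ)); linarith

lemma L_bound {n : ℕ} (ρ t : ℝ) (y : Fin n → ℝ) (hy : ∀ j, y j ^ 2 = 1) (hρ : 0 < ρ)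
    (hρ1 : ρ ≤ 1/2) (ht : ρ * |∑ j, y j| ≤ t) (ht1 : t ≤ 1) (hd : (n:ℝ) * ρ^2 ≤ t) :
    |∏ j, (1 + ρ * y j) - 1| ≤ 3 * t := by
  have hyb : ∀ j, |y j| ≤ 1 := fun j => by
    rw [← sq_le_one_iff_abs_le_one, hy j]
  have hyρ : ∀ j, |ρ * y j| ≤ 1/2 := fun j => by
    rw [abs_mul, abs_of_pos hρ]; nlinarith [hyb j, abs_nonneg (y j)]
  have hpos : ∀ j, 0 < 1 + ρ * y j := fun j => by
    have := (abs_le.1 (hyρ j)).1; linarith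
  have hS : |ρ * ∑ j, y j| ≤ t := by rwa [abs_mul, abs_of_pos hρ]
  obtain ⟨hS1, hS2⟩ := abs_le.1 hS
  have ht0 : 0 ≤ t := (abs_nonneg _).trans hS
  rw [abs_le]
  constructor
  · have h1 : Real.exp (∑ j, (ρ * y j - 2 * ρ^2)) ≤ ∏ j, (1 + ρ * y j) := by
      rw [Real.exp_sum]
      refine Finset.prod_le_prod (fun j _ => (Real.exp_pos _).le) fun j _ => ?_
      rw [← Real.le_log_iff_exp_le (hpos j)]
      have h2 := log_lower (ρ * y j) (hyρ j)
      rw [Real.log_pow] at h2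
      push_cast at h2
      have : (ρ * y j)^2 = ρ^2 := by rw [mul_pow, hy j, mul_one]
      rw [this] at h2
      linarith
    have h3 : ∑ j, (ρ * y j - 2 * ρ^2) = ρ * ∑ j, y j - 2 * (n * ρ^2) := by
      rw [Finset.sum_sub_distrib, ← Finset.mul_sum]
      simp; ring
    rw [h3] at h1
    have h4 := Real.add_one_le_exp (ρ * ∑ j, y j - 2 * (n * ρ^2))
    linarith
  · have h1 : ∏ j, (1 + ρ * y j) ≤ Real.exp (ρ * ∑ j, y j) := by
      rw [Finset.mul_sum, Real.exp_sum]
      refine Finset.prod_le_prod (fun j _ => (hpos j).le) fun j _ => ?_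
      have := Real.add_one_le_exp (ρ * y j); linarith
    have h2 : Real.exp (ρ * ∑ j, y j) ≤ Real.exp t := Real.exp_le_exp.2 hS2
    have h3 := Real.abs_exp_sub_one_le (x := t) (by rw [abs_of_nonneg ht0]; exact ht1)
    rw [abs_of_nonneg ht0] at h3
    have := (abs_le.1 h3).2
    linarith

lemma sum_two {α : Type*} [Fintype α] (m y : α → ℝ) (hm1 : ∑ a, m a = 1)
    (hy : ∀ a, y a = 1 ∨ y a = -1) (hmean : ∑ a, m a * y a = 0) (f : ℝ → ℝ) :
    ∑ a, m a * f (y a) = (f 1 + f (-1)) / 2 := by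
  have : ∀ a, m a * f (y a) = (f 1 + f (-1)) / 2 * m a + (f 1 - f (-1)) / 2 * (m a * y a) := by
    intro a
    rcases hy a with h | h <;> rw [h] <;> ring
  simp_rw [this]
  rw [Finset.sum_add_distrib, ← Finset.mul_sum, ← Finset.mul_sum, hm1, hmean]
  ring

lemma tail {α : Type*} [Fintype α] {k n : ℕ} (hn : 1 ≤ n) (m : α → ℝ) (v : α → Fin k → ℝ)
    (hm : ∀ a, 0 ≤ m a) (hm1 : ∑ a, m a = 1)
    (hv : ∀ a i, v a i = 1 ∨ v a i = -1) (hmean : ∀ i, ∑ a, m a * v a i = 0)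
    (w : ℝ) (hw : 0 ≤ w) (G : (Fin n → α) → Prop) [DecidablePred G]
    (hG : ∀ x, ¬ G x → ∃ i, Real.sqrt n * w ≤ |∑ j, v (x j) i|) :
    ∑ x : Fin n → α, (∏ j, m (x j)) * (if G x then 0 else 1)
      ≤ 2 * k * Real.exp (-(w^2/2)) := by
  have hn0 : (0:ℝ) < n := by exact_mod_cast hn
  have hsn : 0 < Real.sqrt n := Real.sqrt_pos.2 hn0
  set θ := w / Real.sqrt n with hθ
  have hθ0 : 0 ≤ θ := by positivity
  have hθn : θ * (Real.sqrt n * w) = w^2 := by rw [hθ]; field_simp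
  have hθ2 : (n:ℝ) * (θ^2/2) = w^2/2 := by
    rw [hθ, div_pow, Real.sq_sqrt hn0.le]; field_simp
  have hexp : ∀ (θ' : ℝ) (i : Fin k), θ'^2 = θ^2 →
      ∑ x : Fin n → α, (∏ j, m (x j)) * Real.exp (θ' * ∑ j, v (x j) i) ≤ Real.exp (w^2/2) := by
    intro θ' i h
    have e : ∀ x : Fin n → α, (∏ j, m (x j)) * Real.exp (θ' * ∑ j, v (x j) i)
        = ∏ j, (m (x j) * Real.exp (θ' * v (x j) i)) := by
      intro x
      rw [Finset.mul_sum, Real.exp_sum, Finset.prod_mul_distrib]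
    simp_rw [e]
    rw [sum_pi_prod n (fun _ a => m a * Real.exp (θ' * v a i))]
    have e2 := sum_two m (fun a => v a i) hm1 (fun a => hv a i) (hmean i)
      (fun u => Real.exp (θ' * u))
    rw [e2, Finset.prod_const, Finset.card_univ, Fintype.card_fin, ← hθ2, Real.exp_nat_mul]
    refine pow_le_pow_left₀ (by positivity) ?_ n
    have := Real.cosh_le_exp_half_sq θ'
    rw [Real.cosh_eq, h] at this
    simpa using this
  have hpt : ∀ x : Fin n → α, (∏ j, m (x j)) * (if G x then 0 else 1) ≤
      ∑ i, Real.exp (-(w^2)) * ((∏ j, m (x j)) * Real.exp (θ * ∑ j, v (x j) i)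
        + (∏ j, m (x j)) * Real.exp (-θ * ∑ j, v (x j) i)) := by
    intro x
    have hM : 0 ≤ ∏ j, m (x j) := Finset.prod_nonneg fun j _ => hm _
    split_ifs with hx
    · rw [mul_zero]
      exact Finset.sum_nonneg fun i _ => by positivity
    · obtain ⟨i, hi⟩ := hG x hx
      refine le_trans ?_ (Finset.single_le_sum (f := fun i => Real.exp (-(w^2)) *
        ((∏ j, m (x j)) * Real.exp (θ * ∑ j, v (x j) i)
        + (∏ j, m (x j)) * Real.exp (-θ * ∑ j, v (x j) i)))
        (fun i _ => by positivity) (Finset.mem_univ i))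
      rw [← mul_add, mul_left_comm, mul_add]
      refine mul_le_mul_of_nonneg_left ?_ hM
      rw [← Real.exp_add, ← Real.exp_add]
      have h1 := mul_le_mul_of_nonneg_left hi hθ0
      rw [hθn] at h1
      rcases le_abs.1 (le_refl |∑ j, v (x j) i|) with h | h
      · have h2 := mul_le_mul_of_nonneg_left h hθ0
        have : 1 ≤ Real.exp (-(w^2) + θ * ∑ j, v (x j) i) := Real.one_le_exp (by linarith)
        have := Real.exp_pos (-(w^2) + -θ * ∑ j, v (x j) i)
        linarith
      · have h2 := mul_le_mul_of_nonneg_left h hθ0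
        have : 1 ≤ Real.exp (-(w^2) + -θ * ∑ j, v (x j) i) := Real.one_le_exp (by linarith)
        have := Real.exp_pos (-(w^2) + θ * ∑ j, v (x j) i)
        linarith
  refine (Finset.sum_le_sum fun x _ => hpt x).trans ?_
  rw [Finset.sum_comm]
  have hi : ∀ i : Fin k, ∑ x : Fin n → α, Real.exp (-(w^2)) *
        ((∏ j, m (x j)) * Real.exp (θ * ∑ j, v (x j) i)
        + (∏ j, m (x j)) * Real.exp (-θ * ∑ j, v (x j) i)) ≤ 2 * Real.exp (-(w^2/2)) := by
    intro i
    rw [← Finset.mul_sum, Finset.sum_add_distrib]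
    have h1 := hexp θ i rfl
    have h2 := hexp (-θ) i (by ring)
    calc _ ≤ Real.exp (-(w^2)) * (Real.exp (w^2/2) + Real.exp (w^2/2)) :=
          mul_le_mul_of_nonneg_left (add_le_add h1 h2) (Real.exp_pos _).le
      _ = 2 * (Real.exp (-(w^2)) * Real.exp (w^2/2)) := by ring
      _ = _ := by rw [← Real.exp_add]; ring_nf
  refine (Finset.sum_le_sum fun i _ => hi i).trans ?_
  simp
  linarith

lemma hell_pt (p q a : ℝ) (hp : 0 ≤ p) (hq : 0 ≤ q) (ha : 0 ≤ p * (1 + a)) :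
    (Real.sqrt p - Real.sqrt q)^2 ≤ 2 * (p * a^2) + 2 * |p * (1 + a) - q| := by
  have hsub : ∀ x y : ℝ, 0 ≤ x → 0 ≤ y → (Real.sqrt x - Real.sqrt y)^2 ≤ |x - y| := by
    intro x y hx hy
    have h1 : x - y = (Real.sqrt x - Real.sqrt y) * (Real.sqrt x + Real.sqrt y) := by
      nlinarith [Real.sq_sqrt hx, Real.sq_sqrt hy]
    rw [h1, abs_mul, ← sq_abs, sq]
    refine mul_le_mul_of_nonneg_left ?_ (abs_nonneg _)
    rw [abs_of_nonneg (by positivity : 0 ≤ Real.sqrt x + Real.sqrt y)]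
    rw [abs_le]
    constructor <;> linarith [Real.sqrt_nonneg x, Real.sqrt_nonneg y]
  have h2 := hsub _ _ ha hq
  have h3 : (Real.sqrt p - Real.sqrt (p * (1 + a)))^2 ≤ p * a^2 := by
    rcases hp.eq_or_lt with h | h
    · simp [← h]
    · have ha1 : 0 ≤ 1 + a := by
        by_contra hc
        have := mul_neg_of_pos_of_neg h (not_le.1 hc); linarith
      rw [Real.sqrt_mul hp]
      have e : (Real.sqrt p - Real.sqrt p * Real.sqrt (1+a))^2
          = p * (1 - Real.sqrt (1+a))^2 := by
        rw [show (Real.sqrt p - Real.sqrt p * Real.sqrt (1+a))^2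
          = Real.sqrt p ^ 2 * (1 - Real.sqrt (1+a))^2 by ring, Real.sq_sqrt hp]
      rw [e]
      refine mul_le_mul_of_nonneg_left ?_ hp
      have h5 : a = (Real.sqrt (1+a) - 1) * (Real.sqrt (1+a) + 1) := by
        nlinarith [Real.sq_sqrt ha1]
      have h6 := Real.sqrt_nonneg (1+a)
      conv_rhs => rw [h5]
      rw [mul_pow]
      nlinarith [mul_nonneg (sq_nonneg (Real.sqrt (1+a) - 1)) (by positivity : 0 ≤ Real.sqrt (1+a)^2 + 2 * Real.sqrt (1+a))]
  nlinarith [sq_nonneg ((Real.sqrt p - Real.sqrt (p * (1 + a))) - (Real.sqrt (p * (1+a)) - Real.sqrt q))]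

set_option maxHeartbeats 2000000 in
lemma core {α : Type*} [Fintype α] {k n : ℕ} (hk : 2 ≤ k) (hn : 1 ≤ n)
    (m : α → ℝ) (v : α → Fin k → ℝ)
    (hm : ∀ a, 0 ≤ m a) (hm1 : ∑ a, m a = 1)
    (hv : ∀ a i, v a i = 1 ∨ v a i = -1) (hmean : ∀ i, ∑ a, m a * v a i = 0)
    (ρ d ℓ : ℝ) (hρ : 0 < ρ) (hd : d = (n:ℝ) * ρ^2) (hd1 : d ≤ 1/100)
    (hℓ : ℓ = Real.log ((k:ℝ)^2 / d)) (hℓ1 : 1 ≤ ℓ) (hdℓ : 4 * (d * ℓ) ≤ 1)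
    (hcorr : ∑ S : Finset (Fin k), (1 / Real.sqrt n) ^ S.card * |∑ a, m a * ∏ i ∈ S, v a i|
      ≤ 1 + 1 / (n:ℝ))
    (T : Type*) [Fintype T] (P : (Fin n → α) → T → ℝ)
    (hP : ∀ x, (∀ t, 0 ≤ P x t) ∧ ∑ t, P x t = 1) :
    ∑ i : Fin k, hellSq (fun t => ∑ x : Fin n → α, (∏ j, m (x j)) * P x t)
        (fun t => ∑ x : Fin n → α, (∏ j, m (x j)) * (∏ j, (1 + ρ * v (x j) i)) * P x t)
      ≤ 405 * (d * ℓ) * (mutInfo (fun q : T × (Fin n → α) => (∏ j, m (q.2 j)) * P q.2 q.1) + 1) := by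
  classical
  have hn0 : (0:ℝ) < n := by exact_mod_cast hn
  have hn1 : (1:ℝ) ≤ n := by exact_mod_cast hn
  have hk0 : (2:ℝ) ≤ k := by exact_mod_cast hk
  have hsn : 0 < Real.sqrt n := Real.sqrt_pos.2 hn0
  have hd0 : 0 < d := by rw [hd]; positivity
  set M : (Fin n → α) → ℝ := fun x => ∏ j, m (x j) with hM
  set L : Fin k → (Fin n → α) → ℝ := fun i x => ∏ j, (1 + ρ * v (x j) i) with hL
  set δ := Real.sqrt n * ρ with hδ
  have hδ0 : 0 < δ := by positivity
  have hδ2 : δ^2 = d := by rw [hδ, mul_pow, Real.sq_sqrt hn0.le, hd]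
  have hδ1 : δ ≤ 1/10 := by
    refine le_of_sq_le_sq ?_ (by norm_num)
    rw [hδ2]; linarith
  have hρδ : ρ ≤ δ := by
    have : 1 ≤ Real.sqrt n := by rw [Real.one_le_sqrt]; exact hn1
    rw [hδ]; nlinarith
  set sl := Real.sqrt ℓ with hsl
  have hsl2 : sl^2 = ℓ := Real.sq_sqrt (by linarith)
  have hsl1 : 1 ≤ sl := by rw [hsl, Real.one_le_sqrt]; exact hℓ1
  set w := 2 * sl with hw
  have hw0 : 0 ≤ w := by positivity
  have hδw : δ * w ≤ 1 := by
    refine le_of_sq_le_sq ?_ (by norm_num)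
    have : (δ * w)^2 = 4 * (d * ℓ) := by rw [← hδ2, ← hsl2, hw]; ring
    rw [this]; linarith
  clear_value δ sl w
  have hMnn : ∀ x, 0 ≤ M x := fun x => Finset.prod_nonneg fun j _ => hm _
  have hMsum : ∑ x, M x = 1 := by
    simp only [hM]
    rw [sum_pi_prod n (fun _ a => m a)]
    simp [hm1]
  have hv2 : ∀ a i, v a i ^ 2 = 1 := fun a i => by rcases hv a i with h | h <;> rw [h] <;> norm_num
  have hLnn : ∀ i x, 0 ≤ L i x := fun i x => Finset.prod_nonneg fun j _ => by
    rcases hv (x j) i with h | h <;> rw [h] <;> linarith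
  let G : (Fin n → α) → Prop := fun x => ∀ i, |∑ j, v (x j) i| < Real.sqrt n * w
  have hGτ : ∀ i x, G x → |L i x - 1| ≤ 3 * (δ * w) := by
    intro i x hx
    refine L_bound ρ (δ * w) (fun j => v (x j) i) (fun j => hv2 _ _) hρ (by linarith) ?_ hδw ?_
    · have := mul_le_mul_of_nonneg_left (hx i).le hρ.le
      refine this.trans (le_of_eq ?_)
      rw [hδ]; ring
    · rw [← hd, ← hδ2]; nlinarith
  have htail0 : ∑ x, M x * (if G x then 0 else 1) ≤ 2 * k * Real.exp (-(w^2/2)) := by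
    refine tail hn m v hm hm1 hv hmean w hw0 G ?_
    intro x hx
    by_contra hc
    push Not at hc
    exact hx hc
  set B := ∑ x, M x * (if G x then (0:ℝ) else 1) with hB
  have hexpw : Real.exp (-(w^2/2)) = (d / (k:ℝ)^2)^2 := by
    have h1 : w^2/2 = 2 * ℓ := by rw [hw, mul_pow, hsl2]; ring
    rw [h1, show -(2 * ℓ) = ((2:ℕ):ℝ) * (-ℓ) by push_cast; ring, Real.exp_nat_mul, hℓ,
      ← Real.log_inv, Real.exp_log (by positivity), inv_div]
  rw [hexpw] at htail0
  have hB0 : 0 ≤ B := Finset.sum_nonneg fun x _ => mul_nonneg (hMnn x) (by split_ifs <;> norm_num)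
  have hBb : B ≤ (d / k)^2 := by
    refine htail0.trans ?_
    rw [div_pow, div_pow, ← mul_div_assoc, div_le_div_iff₀ (by positivity) (by positivity)]
    have : 2 * (k:ℝ) * k^2 ≤ (k^2)^2 := by
      nlinarith [mul_nonneg (by positivity : 0 ≤ (k:ℝ)^3) (by linarith : 0 ≤ (k:ℝ) - 2)]
    nlinarith [mul_le_mul_of_nonneg_left this (sq_nonneg d)]
  have hdk : 0 < d / k := by positivity
  have hB1 : B ≤ d / k := by
    have : d / k ≤ 1 := by rw [div_le_one (by positivity)]; linarith
    nlinarith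
  have hL2 : ∀ i, ∑ x, M x * L i x ^ 2 ≤ 3 := by
    intro i
    have e : ∀ x, M x * L i x ^ 2 = ∏ j, (m (x j) * (1 + ρ * v (x j) i)^2) := by
      intro x
      simp only [hM, hL]
      rw [← Finset.prod_pow, Finset.prod_mul_distrib]
    simp_rw [e]
    rw [sum_pi_prod n (fun _ a => m a * (1 + ρ * v a i)^2)]
    have e2 := sum_two m (fun a => v a i) hm1 (fun a => hv a i) (hmean i)
      (fun u => (1 + ρ * u)^2)
    rw [e2, Finset.prod_const, Finset.card_univ, Fintype.card_fin]
    have h1 : ((1 + ρ * 1)^2 + (1 + ρ * -1)^2) / 2 ≤ Real.exp (ρ^2) := by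
      have := Real.add_one_le_exp (ρ^2)
      nlinarith
    refine (pow_le_pow_left₀ (by positivity) h1 n).trans ?_
    rw [← Real.exp_nat_mul, ← hd]
    have h2 := Real.abs_exp_sub_one_le (x := d) (by rw [abs_of_pos hd0]; linarith)
    rw [abs_of_pos hd0] at h2
    have := (abs_le.1 h2).2
    linarith
  have hBi : ∀ i, ∑ x, M x * L i x * (if G x then (0:ℝ) else 1) ≤ 2 * (d / k) := by
    intro i
    have h1 := Finset.sum_sq_le_sum_mul_sum_of_sq_le_mul Finset.univ
      (r := fun x => M x * L i x * (if G x then (0:ℝ) else 1))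
      (f := fun x => M x * L i x ^ 2) (g := fun x => M x * (if G x then (0:ℝ) else 1))
      (fun x _ => mul_nonneg (hMnn x) (sq_nonneg _))
      (fun x _ => mul_nonneg (hMnn x) (by split_ifs <;> norm_num))
      (fun x _ => le_of_eq (by split_ifs <;> ring))
    refine le_of_sq_le_sq (h1.trans ?_) (by positivity)
    rw [← hB]
    nlinarith [hL2 i, mul_le_mul_of_nonneg_right (hL2 i) hB0]
  clear_value B
  set I := mutInfo (fun q : T × (Fin n → α) => M q.2 * P q.2 q.1) with hI
  have hIeq := mutInfo_eq M P hMnn hP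
  rw [← hI] at hIeq
  set p : T → ℝ := fun t => ∑ x, M x * P x t with hp
  set K : T → ℝ := fun t => ∑ x, M x * P x t * (Real.log (P x t) - Real.log (p t)) with hK
  have hIK : I * Real.log 2 = ∑ t, K t := hIeq
  have hmp : ∀ x t, 0 ≤ M x * P x t := fun x t => mul_nonneg (hMnn x) ((hP x).1 t)
  have hp0 : ∀ t, 0 ≤ p t := fun t => Finset.sum_nonneg fun x _ => hmp x t
  have hpsum : ∑ t, p t = 1 := by
    simp only [hp]
    rw [Finset.sum_comm]
    simp_rw [← Finset.mul_sum, (hP _).2, mul_one]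
    exact hMsum
  have hKnn : ∀ t, 0 ≤ K t := by
    intro t
    have := dv M (fun x => P x t) (fun _ => 1) hMnn (fun x => (hP x).1 t) (fun _ => one_pos)
    simp only [Real.log_one, mul_zero, mul_one, Finset.sum_const_zero, hMsum, add_zero] at this
    exact this
  have hlog2 : 0 < Real.log 2 := Real.log_pos (by norm_num)
  have hI0 : 0 ≤ I := by
    have : 0 ≤ I * Real.log 2 := by rw [hIK]; exact Finset.sum_nonneg fun t _ => hKnn t
    exact nonneg_of_mul_nonneg_left this hlog2
  set a : Fin k → T → ℝ := fun i t =>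
    (∑ x, M x * P x t * (if G x then L i x - 1 else 0)) / p t with ha
  have hpz : ∀ t, p t = 0 → ∀ x, M x * P x t = 0 := by
    intro t ht x
    exact (Finset.sum_eq_zero_iff_of_nonneg (fun x _ => hmp x t)).1 ht x (Finset.mem_univ x)
  have hap : ∀ i t, a i t * p t = ∑ x, M x * P x t * (if G x then L i x - 1 else 0) := by
    intro i t
    by_cases h : p t = 0
    · simp [h, hpz t h]
    · simp only [ha]; rw [div_mul_cancel₀ _ h]
  have hpt : ∀ t, p t * ∑ i, a i t ^ 2 ≤ 200 * (d * ℓ) * (K t + 2 * p t) := by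
    intro t
    rcases (hp0 t).eq_or_lt with h | h
    · rw [← h]
      have := hKnn t
      have : 0 ≤ d * ℓ := by positivity
      rw [zero_mul]; have := hKnn t; positivity
    · refine pointwise M (fun x => P x t) L G d (d * ℓ) (3 * (δ * w)) hMnn hMsum
        (fun x => (hP x).1 t) hd0 (by nlinarith) (by positivity) ?_ hGτ ?_ (p t) rfl h
        (fun i => a i t) (fun i => hap i t)
      · have : (3 * (δ * w))^2 = 36 * (d * ℓ) := by rw [← hδ2, ← hsl2, hw]; ring
        exact this.le
      · intro s hs
        have := mgf hn m v hv2 ρ δ (1 / Real.sqrt n) hρ (by positivity)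
          (by rw [hδ]; field_simp) hδ0 (by rw [hδ2, hd]) hδ1 hcorr s ?_
        · rw [hδ2] at this
          exact this
        · intro i
          have h1 := hs i
          have h2 : |s i| * δ ≤ |s i| * (δ * sl) :=
            mul_le_mul_of_nonneg_left (by nlinarith) (abs_nonneg _)
          rw [hw] at h1
          nlinarith
  have hhell : ∀ i t, (Real.sqrt (p t) - Real.sqrt (∑ x, M x * L i x * P x t))^2
      ≤ 2 * (p t * a i t ^ 2) + 2 * (∑ x, M x * (if G x then 0 else 1) * P x t
        + ∑ x, M x * L i x * (if G x then 0 else 1) * P x t) := by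
    intro i t
    have e1 : p t * (1 + a i t) = ∑ x, M x * P x t * (if G x then L i x else 1) := by
      rw [mul_add, mul_one, mul_comm (p t) (a i t), hap, hp, ← Finset.sum_add_distrib]
      refine Finset.sum_congr rfl fun x _ => ?_
      split_ifs <;> ring
    have h1 := hell_pt (p t) (∑ x, M x * L i x * P x t) (a i t) (hp0 t)
      (Finset.sum_nonneg fun x _ => mul_nonneg (mul_nonneg (hMnn x) (hLnn i x)) ((hP x).1 t))
      (by
        rw [e1]
        refine Finset.sum_nonneg fun x _ => mul_nonneg (hmp x t) ?_
        split_ifs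
        · exact hLnn i x
        · exact zero_le_one)
    refine h1.trans ?_
    have h2 : |p t * (1 + a i t) - ∑ x, M x * L i x * P x t| ≤
        ∑ x, M x * (if G x then 0 else 1) * P x t
        + ∑ x, M x * L i x * (if G x then 0 else 1) * P x t := by
      rw [e1, ← Finset.sum_sub_distrib, ← Finset.sum_add_distrib]
      refine (Finset.abs_sum_le_sum_abs _ _).trans (Finset.sum_le_sum fun x _ => ?_)
      have hx1 := hmp x t
      have hx2 := mul_nonneg hx1 (hLnn i x)
      split_ifs
      · rw [show M x * P x t * L i x - M x * L i x * P x t = 0 by ring]; simp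
      · rw [abs_le]; constructor <;> nlinarith
    linarith
  have hPB : ∀ f : (Fin n → α) → ℝ, ∑ t, ∑ x, f x * P x t = ∑ x, f x := by
    intro f
    rw [Finset.sum_comm]
    simp_rw [← Finset.mul_sum, (hP _).2, mul_one]
  have hHi : ∀ i, hellSq p (fun t => ∑ x, M x * L i x * P x t)
      ≤ ∑ t, p t * a i t ^ 2 + 3 * (d / k) := by
    intro i
    unfold hellSq
    have h1 := Finset.sum_le_sum fun t (_ : t ∈ Finset.univ) => hhell i t
    rw [Finset.sum_add_distrib, ← Finset.mul_sum, ← Finset.mul_sum, Finset.sum_add_distrib,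
      hPB (fun x => M x * (if G x then 0 else 1)),
      hPB (fun x => M x * L i x * (if G x then 0 else 1)), ← hB] at h1
    have h2 := hBi i
    linarith
  have htot := Finset.sum_le_sum fun i (_ : i ∈ Finset.univ) => hHi i
  refine htot.trans ?_
  rw [Finset.sum_add_distrib, Finset.sum_comm]
  have h5 : ∑ _i : Fin k, 3 * (d / k) = 3 * d := by
    simp; field_simp
  rw [h5]
  simp_rw [← Finset.mul_sum]
  have h6 := Finset.sum_le_sum fun t (_ : t ∈ Finset.univ) => hpt t
  rw [← Finset.mul_sum, Finset.sum_add_distrib, ← Finset.mul_sum, hpsum, ← hIK] at h6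
  refine (add_le_add_left h6 _).trans ?_
  have h7 : I * Real.log 2 ≤ I := by
    have : Real.log 2 ≤ 1 := by
      have := Real.log_two_lt_d9; linarith
    nlinarith
  have hdl : d ≤ d * ℓ := by nlinarith
  have hdl0 : 0 < d * ℓ := by positivity
  have h8 := mul_le_mul_of_nonneg_left h7 hdl0.le
  nlinarith [mul_nonneg hdl0.le hI0]

/-- there are constants `C, C' > 0` such that for any BCD(ρ) family
`{μ_1,…,μ_k}` centered around `μ₀` with `ρ ≤ (n ln k)^{−1/2}/C'` satisfying condition
(corr), and any channel `P` from `Ω^n` to a finite set `T`,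
`∑_i H²(P_{Π|X∼μ₀^n}, P_{Π|X∼μ_i^n}) ≤ C·n·ρ²·log(k²/(nρ²))·(I(Π;X) + 1)`,
where `(X,Π)` is the joint input-output pair with `X ∼ μ₀^n`. -/
theorem statement0 :
    ∃ C C' : ℝ, 0 < C ∧ 0 < C' ∧
      ∀ (k : ℕ), 2 ≤ k →
      ∀ (Ω : Finset (Fin k → ℝ)), (∀ x ∈ Ω, ∀ i, x i = 1 ∨ x i = -1) →
      ∀ (μ₀ : ↥Ω → ℝ) (μ : Fin k → ↥Ω → ℝ) (ρ : ℝ) (n : ℕ),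
        IsDist μ₀ →
        (∀ i : Fin k, ∑ x : ↥Ω, (if x.1 i = 1 then μ₀ x else 0) = 1/2) →
        (∀ i x, μ i x = (1 + ρ * x.1 i) * μ₀ x) →
        0 < ρ → ρ < 1 → 1 ≤ n →
        ρ ≤ ((n : ℝ) * Real.log (k : ℝ)) ^ (-(1:ℝ)/2) / C' →
        (∑ S ∈ Finset.univ.filter (fun S : Finset (Fin k) => 2 ≤ S.card),
            (n : ℝ) ^ (-(S.card : ℝ) / 2) * ρ ^ (-(S.card : ℝ)) *
              |∑ x : ↥Ω, μ₀ x * ∏ i ∈ S, (μ i x / μ₀ x - 1)|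
          ≤ 1 / (n : ℝ)) →
        ∀ (T : Type) [Fintype T], ∀ P : (Fin n → ↥Ω) → T → ℝ,
          (∀ x, (∀ t, 0 ≤ P x t) ∧ ∑ t, P x t = 1) →
          (∑ i : Fin k,
              hellSq (fun t => ∑ x : Fin n → ↥Ω, prodDist μ₀ n x * P x t)
                     (fun t => ∑ x : Fin n → ↥Ω, prodDist (μ i) n x * P x t))
            ≤ C * n * ρ^2 * Real.logb 2 ((k : ℝ)^2 / ((n : ℝ) * ρ^2)) *
                (mutInfo (fun q : T × (Fin n → ↥Ω) =>
                    prodDist μ₀ n q.2 * P q.2 q.1) + 1) := by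
  refine ⟨405, 100, by norm_num, by norm_num, ?_⟩
  intro k hk Ω hΩ μ₀ μ ρ n hμ₀ hhalf hμ hρ hρ1 hn hρC hcorr T _ P hP
  have hn0 : (0:ℝ) < n := by exact_mod_cast hn
  have hk0 : (2:ℝ) ≤ k := by exact_mod_cast hk
  obtain ⟨hm, hm1⟩ := hμ₀
  have hv : ∀ (a : ↥Ω) i, a.1 i = 1 ∨ a.1 i = -1 := fun a i => hΩ a.1 a.2 i
  have hmean : ∀ i, ∑ a : ↥Ω, μ₀ a * a.1 i = 0 := by
    intro i
    have e : ∀ a : ↥Ω, μ₀ a * a.1 i = 2 * (if a.1 i = 1 then μ₀ a else 0) - μ₀ a := by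
      intro a
      rcases hv a i with h | h <;> rw [h]
      · simp; ring
      · norm_num
    simp_rw [e]
    rw [Finset.sum_sub_distrib, ← Finset.mul_sum, hhalf i, hm1]; norm_num
  -- numerical facts
  have hlk : 69/100 ≤ Real.log k := by
    have h1 := Real.log_two_gt_d9
    have h2 := Real.log_le_log (by norm_num : (0:ℝ) < 2) hk0
    linarith
  have hd0 : 0 < (n:ℝ) * ρ^2 := by positivity
  have hdk : (n:ℝ) * ρ^2 * Real.log k ≤ 1/10000 := by
    have hX : 0 < (n:ℝ) * Real.log k := by positivity
    have h1 : ρ^2 ≤ (((n:ℝ) * Real.log k) ^ (-(1:ℝ)/2) / 100)^2 :=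
      pow_le_pow_left₀ hρ.le hρC 2
    have h2 : (((n:ℝ) * Real.log k) ^ (-(1:ℝ)/2))^2 = ((n:ℝ) * Real.log k)⁻¹ := by
      rw [← Real.rpow_natCast, ← Real.rpow_mul hX.le]
      norm_num
      rw [Real.rpow_neg_one, mul_inv, mul_comm]
    rw [div_pow, h2] at h1
    have h3 := mul_le_mul_of_nonneg_left h1 hX.le
    rw [← mul_div_assoc, mul_inv_cancel₀ hX.ne'] at h3
    calc (n:ℝ) * ρ^2 * Real.log k = (n:ℝ) * Real.log k * ρ^2 := by ring
      _ ≤ _ := h3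
      _ = _ := by norm_num
  set d := (n:ℝ) * ρ^2 with hd
  have hd2 : d ≤ 2/10000 := by nlinarith
  set ℓ := Real.log ((k:ℝ)^2 / d) with hℓ
  have hℓe : ℓ = 2 * Real.log k + Real.log (1 / d) := by
    rw [hℓ, Real.log_div (by positivity) hd0.ne', Real.log_pow, one_div, Real.log_inv]
    push_cast; ring
  have hld : 0 ≤ Real.log (1/d) := by
    apply Real.log_nonneg
    rw [le_div_iff₀ hd0]; linarith
  have hℓ1 : 1 ≤ ℓ := by rw [hℓe]; linarith
  have hdℓ : 4 * (d * ℓ) ≤ 1 := by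
    have hs0 : 0 < Real.sqrt d := Real.sqrt_pos.2 hd0
    have hs2 : Real.sqrt d ^ 2 = d := Real.sq_sqrt hd0.le
    have hs1 : Real.sqrt d ≤ 1/50 := by
      refine le_of_sq_le_sq ?_ (by norm_num)
      rw [hs2]; linarith
    have h1 : Real.log (1/d) = 2 * Real.log (1 / Real.sqrt d) := by
      rw [← hs2, one_div, one_div, ← inv_pow, Real.log_pow, hs2]; push_cast; ring
    have h2 : Real.log (1 / Real.sqrt d) ≤ 1 / Real.sqrt d := by
      have := Real.log_le_sub_one_of_pos (by positivity : 0 < 1 / Real.sqrt d); linarith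
    have h3 : d * Real.log (1/d) ≤ 2 * Real.sqrt d := by
      rw [h1]
      have h4 := mul_le_mul_of_nonneg_left h2 hd0.le
      have h5 : d * (1 / Real.sqrt d) = Real.sqrt d := by
        nth_rewrite 1 [← hs2]; field_simp
      linarith
    rw [hℓe]
    nlinarith
  have hcorr' : ∑ S : Finset (Fin k), (1 / Real.sqrt n) ^ S.card *
      |∑ a : ↥Ω, μ₀ a * ∏ i ∈ S, a.1 i| ≤ 1 + 1 / (n:ℝ) := by
    have hterm : ∀ S : Finset (Fin k), (n : ℝ) ^ (-(S.card : ℝ) / 2) * ρ ^ (-(S.card : ℝ)) *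
              |∑ x : ↥Ω, μ₀ x * ∏ i ∈ S, (μ i x / μ₀ x - 1)|
        = (1 / Real.sqrt n) ^ S.card * |∑ a : ↥Ω, μ₀ a * ∏ i ∈ S, a.1 i| := by
      intro S
      have e1 : ∀ x : ↥Ω, μ₀ x * ∏ i ∈ S, (μ i x / μ₀ x - 1)
          = ρ ^ S.card * (μ₀ x * ∏ i ∈ S, x.1 i) := by
        intro x
        by_cases h0 : μ₀ x = 0
        · simp [h0]
        · have : ∀ i, μ i x / μ₀ x - 1 = ρ * x.1 i := by
            intro i
            rw [hμ i x]; field_simp; ring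
          simp_rw [this]
          rw [Finset.prod_mul_distrib, Finset.prod_const]; ring
      simp_rw [e1]
      rw [← Finset.mul_sum, abs_mul, abs_of_pos (by positivity : 0 < ρ ^ S.card),
        Real.rpow_neg hρ.le, Real.rpow_natCast]
      have e2 : (n : ℝ) ^ (-(S.card : ℝ) / 2) = (1 / Real.sqrt n) ^ S.card := by
        rw [Real.sqrt_eq_rpow, one_div, ← Real.rpow_neg hn0.le, ← Real.rpow_natCast,
          ← Real.rpow_mul hn0.le]
        congr 1; ring
      rw [e2]
      have : ρ ^ S.card ≠ 0 := by positivity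
      field_simp
    simp_rw [hterm] at hcorr
    rw [← Finset.sum_filter_add_sum_filter_not Finset.univ
      (fun S : Finset (Fin k) => 2 ≤ S.card), add_comm]
    refine add_le_add ?_ hcorr
    have hz : ∀ S ∈ Finset.univ.filter (fun S : Finset (Fin k) => ¬ 2 ≤ S.card),
        (1 / Real.sqrt n) ^ S.card * |∑ a : ↥Ω, μ₀ a * ∏ i ∈ S, a.1 i|
          = if S = ∅ then 1 else 0 := by
      intro S hS
      rw [Finset.mem_filter] at hS
      have hS2 : S.card = 0 ∨ S.card = 1 := by omega
      rcases hS2 with h | h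
      · have := Finset.card_eq_zero.1 h
        subst this
        simp only [Finset.card_empty, pow_zero, Finset.prod_empty, mul_one, hm1, abs_one, if_true]
      · obtain ⟨i, rfl⟩ := Finset.card_eq_one.1 h
        simp only [Finset.prod_singleton, hmean i, abs_zero, mul_zero, Finset.singleton_ne_empty,
          if_false]
    rw [Finset.sum_congr rfl hz, Finset.sum_ite_eq']
    split_ifs <;> norm_num
  have hmain := core hk hn μ₀ (fun a i => a.1 i) hm hm1 hv hmean ρ d ℓ hρ hd (by linarith)
    hℓ hℓ1 hdℓ hcorr' T P hP
  have hprod : ∀ (i : Fin k) (x : Fin n → ↥Ω), prodDist (μ i) n x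
      = (∏ j, μ₀ (x j)) * ∏ j, (1 + ρ * (x j).1 i) := by
    intro i x
    unfold prodDist
    rw [← Finset.prod_mul_distrib]
    refine Finset.prod_congr rfl fun j _ => ?_
    rw [hμ]; ring
  simp_rw [hprod]
  refine hmain.trans ?_
  have hI0 : 0 ≤ mutInfo (fun q : T × (Fin n → ↥Ω) => (∏ j, μ₀ (q.2 j)) * P q.2 q.1) := by
    have hMnn : ∀ x : Fin n → ↥Ω, 0 ≤ ∏ j, μ₀ (x j) :=
      fun x => Finset.prod_nonneg fun j _ => hm _
    have hMsum : ∑ x : Fin n → ↥Ω, ∏ j, μ₀ (x j) = 1 := by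
      rw [sum_pi_prod n (fun _ a => μ₀ a), hm1, Finset.prod_const_one]
    have hIK := mutInfo_eq (fun x : Fin n → ↥Ω => ∏ j, μ₀ (x j)) P hMnn hP
    have hlog2 : 0 < Real.log 2 := Real.log_pos (by norm_num)
    refine nonneg_of_mul_nonneg_left (b := Real.log 2) ?_ hlog2
    rw [hIK]
    refine Finset.sum_nonneg fun t _ => ?_
    have := dv (fun x : Fin n → ↥Ω => ∏ j, μ₀ (x j)) (fun x => P x t) (fun _ => 1) hMnn
      (fun x => (hP x).1 t) (fun _ => one_pos)
    simp only [Real.log_one, mul_zero, mul_one, Finset.sum_const_zero, hMsum, add_zero] at this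
    exact this
  have hlogb : ℓ ≤ Real.logb 2 ((k : ℝ)^2 / d) := by
    rw [Real.logb, ← hℓ, le_div_iff₀ (Real.log_pos (by norm_num))]
    have := Real.log_two_lt_d9
    nlinarith
  have h1 : 405 * (d * ℓ) ≤ 405 * n * ρ^2 * Real.logb 2 ((k : ℝ)^2 / d) := by
    calc 405 * (d * ℓ) = 405 * d * ℓ := by ring
      _ ≤ 405 * d * Real.logb 2 ((k : ℝ)^2 / d) :=
        mul_le_mul_of_nonneg_left hlogb (by positivity)
      _ = _ := by rw [hd]; ring
  exact mul_le_mul_of_nonneg_right h1 (by linarith)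
end
end

section
/- Let k ≥ 2, let {μ_1,…,μ_k} be a BCD(ρ) family on a finite sample space Ω ⊆ {−1,1}^k centered around μ_0 with μ_0(x) > 0 for all x ∈ Ω, let n ≥ 1, assume ρ ≤ 1/(2√n·(2√(2·ln(8k²)) + 3)), let α be the unique number with 0 < α ≤ 1/2 satisfying α = (2√(2·ln(2k²/α²)) + 3)·ρ·√n, and let 𝒯 = {x ∈ Ω^n : |μ_i^n(x)/μ_0^n(x) − 1| ≤ α for all i ∈ [k]}. Define jointly distributed random variables X ∈ Ω^n and Y, Z ∈ {−1,1}^k as follows: X ∼ μ_0^n; conditioned on X, the coordinates Y_1,…,Y_k are independent with Pr[Y_i = y_i | X] = 1/2 + (y_i/4)·ψ((μ_i^n(X)/μ_0^n(X) − 1)/α), where ψ(s) = max(−1, min(1, s)); conditioned on Y, the coordinates Z_1,…,Z_k are independent with Z_i = Y_i with probability (1+2α)/2 and Z_i = −Y_i otherwise. Then: (a) for every x ∈ 𝒯 and every i ∈ [k], Pr[X = x and Z_i = 1] = μ_i^n(x)/2; (b) for every i ∈ [k], |Pr[Z_i = 1] − 1/2| ≤ α²/k; (c) for every i ∈ [k],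 |Pr[Y_i = 1] − 1/2| = |Pr[Z_i = 1] − 1/2|/(2α) ≤ α/(2k). -/
open Finset

noncomputable section

/-- The two-point set `{−1, 1} ⊆ ℝ`. -/
def Sgn : Finset ℝ := {-1, 1}

/-- The clipping function `ψ(s) = max(−1, min(1, s))`. -/
def psi (s : ℝ) : ℝ := max (-1) (min 1 s)

/-- The joint probability mass of `(X, Y, Z)`: `X ∼ μ₀^n`; given `X`, the coordinates of
`Y` are independent with `Pr[Y_i = y_i | X] = 1/2 + (y_i/4)·ψ((μ_i^n(X)/μ_0^n(X) − 1)/α)`;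
given `Y`, each `Z_i` equals `Y_i` with probability `(1+2α)/2` and `−Y_i` otherwise. -/
noncomputable def jointXYZ {k : ℕ} (Ω : Finset (Fin k → ℝ)) (μ₀ : ↥Ω → ℝ)
    (μ : Fin k → ↥Ω → ℝ) (n : ℕ) (α : ℝ)
    (x : Fin n → ↥Ω) (y z : Fin k → ↥Sgn) : ℝ :=
  prodDist μ₀ n x
    * (∏ i, (1/2 + ((y i).1 / 4) *
        psi ((prodDist (μ i) n x / prodDist μ₀ n x - 1) / α)))
    * ∏ i, (if (z i).1 = (y i).1 then (1 + 2*α)/2 else (1 - 2*α)/2)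

lemma sum_Sgn (h : ℝ → ℝ) : ∑ s : ↥Sgn, h s.1 = h (-1) + h 1 := by
  rw [Finset.sum_coe_sort Sgn h]
  unfold Sgn
  rw [Finset.sum_pair (by norm_num)]

lemma marg {k : ℕ} (φ : ℝ → ℝ) (f : Fin k → ℝ → ℝ) (hf : ∀ j, f j (-1) + f j 1 = 1)
    (i : Fin k) :
    ∑ y : Fin k → ↥Sgn, φ (y i).1 * ∏ j, f j (y j).1 = φ (-1) * f i (-1) + φ 1 * f i 1 := by
  have h1 : ∀ y : Fin k → ↥Sgn, φ (y i).1 * ∏ j, f j (y j).1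
      = ∏ j, ((if j = i then φ (y j).1 else 1) * f j (y j).1) := by
    intro y
    rw [Finset.prod_mul_distrib]
    simp
  simp_rw [h1]
  rw [← Fintype.prod_sum (fun j (s : ↥Sgn) => (if j = i then φ s.1 else 1) * f j s.1)]
  rw [Finset.prod_eq_single i]
  · rw [sum_Sgn (fun s => (if i = i then φ s else 1) * f i s)]
    simp
  · intro j _ hj
    rw [sum_Sgn (fun s => (if j = i then φ s else 1) * f j s)]
    simp [hj, hf]
  · simp

lemma margZ {k : ℕ} (Ω : Finset (Fin k → ℝ)) (μ₀ : ↥Ω → ℝ)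
    (μ : Fin k → ↥Ω → ℝ) (n : ℕ) (α : ℝ) (x : Fin n → ↥Ω) (i : Fin k) :
    (∑ y : Fin k → ↥Sgn, ∑ z : Fin k → ↥Sgn,
            if (z i).1 = 1 then jointXYZ Ω μ₀ μ n α x y z else 0)
      = prodDist μ₀ n x * (1/2 + α / 2 *
        psi ((prodDist (μ i) n x / prodDist μ₀ n x - 1) / α)) := by
  have hz : ∀ y : Fin k → ↥Sgn, (∑ z : Fin k → ↥Sgn,
            if (z i).1 = 1 then jointXYZ Ω μ₀ μ n α x y z else 0)
      = prodDist μ₀ n x * ((fun t : ℝ => if 1 = t then (1 + 2*α)/2 else (1 - 2*α)/2) (y i).1 *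
        ∏ j, (fun (j : Fin k) (t : ℝ) => 1/2 + (t / 4) *
        psi ((prodDist (μ j) n x / prodDist μ₀ n x - 1) / α)) j (y j).1) := by
    intro y
    have := marg (fun t => if t = 1 then 1 else 0)
      (fun j t => if t = (y j).1 then (1 + 2*α)/2 else (1 - 2*α)/2) (by
        intro j
        have := (y j).2
        simp only [Sgn, Finset.mem_insert, Finset.mem_singleton] at this
        rcases this with h | h <;> rw [h] <;> norm_num <;> ring) i
    have e : (∑ z : Fin k → ↥Sgn, if (z i).1 = 1 then jointXYZ Ω μ₀ μ n α x y z else 0)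
      = prodDist μ₀ n x * (∏ i, (1/2 + ((y i).1 / 4) *
        psi ((prodDist (μ i) n x / prodDist μ₀ n x - 1) / α))) *
        ∑ z : Fin k → ↥Sgn, (if (z i).1 = 1 then 1 else 0) *
          ∏ j, (if (z j).1 = (y j).1 then (1 + 2*α)/2 else (1 - 2*α)/2) := by
      rw [Finset.mul_sum]
      refine Finset.sum_congr rfl fun z _ => ?_
      unfold jointXYZ
      split_ifs <;> ring
    rw [e, this]
    beta_reduce
    rw [if_neg (by norm_num : ¬ ((-1:ℝ) = 1)), if_pos rfl]
    ring
  simp_rw [hz]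
  rw [← Finset.mul_sum, marg (fun t : ℝ => if 1 = t then (1 + 2*α)/2 else (1 - 2*α)/2)
    (fun (j : Fin k) (t : ℝ) => 1/2 + (t / 4) *
        psi ((prodDist (μ j) n x / prodDist μ₀ n x - 1) / α))]
  · beta_reduce
    rw [if_neg (by norm_num : ¬ ((1:ℝ) = -1)), if_pos rfl]
    ring
  · intro j
    ring

lemma margY {k : ℕ} (Ω : Finset (Fin k → ℝ)) (μ₀ : ↥Ω → ℝ)
    (μ : Fin k → ↥Ω → ℝ) (n : ℕ) (α : ℝ) (x : Fin n → ↥Ω) (i : Fin k) :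
    (∑ y : Fin k → ↥Sgn, ∑ z : Fin k → ↥Sgn,
            if (y i).1 = 1 then jointXYZ Ω μ₀ μ n α x y z else 0)
      = prodDist μ₀ n x * (1/2 + 1 / 4 *
        psi ((prodDist (μ i) n x / prodDist μ₀ n x - 1) / α)) := by
  have hz : ∀ y : Fin k → ↥Sgn, (∑ z : Fin k → ↥Sgn,
            if (y i).1 = 1 then jointXYZ Ω μ₀ μ n α x y z else 0)
      = prodDist μ₀ n x * ((fun t : ℝ => if t = 1 then 1 else 0) (y i).1 *
        ∏ j, (fun (j : Fin k) (t : ℝ) => 1/2 + (t / 4) *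
        psi ((prodDist (μ j) n x / prodDist μ₀ n x - 1) / α)) j (y j).1) := by
    intro y
    have := marg (fun t => 1)
      (fun j t => if t = (y j).1 then (1 + 2*α)/2 else (1 - 2*α)/2) (by
        intro j
        have := (y j).2
        simp only [Sgn, Finset.mem_insert, Finset.mem_singleton] at this
        rcases this with h | h <;> rw [h] <;> norm_num <;> ring) i
    have e : (∑ z : Fin k → ↥Sgn, if (y i).1 = 1 then jointXYZ Ω μ₀ μ n α x y z else 0)
      = prodDist μ₀ n x * ((if (y i).1 = 1 then 1 else 0) * ∏ i, (1/2 + ((y i).1 / 4) *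
        psi ((prodDist (μ i) n x / prodDist μ₀ n x - 1) / α))) *
        ∑ z : Fin k → ↥Sgn, 1 *
          ∏ j, (if (z j).1 = (y j).1 then (1 + 2*α)/2 else (1 - 2*α)/2) := by
      rw [Finset.mul_sum]
      refine Finset.sum_congr rfl fun z _ => ?_
      unfold jointXYZ
      split_ifs <;> ring
    rw [e, this]
    have := (y i).2
    simp only [Sgn, Finset.mem_insert, Finset.mem_singleton] at this
    rcases this with h | h <;> rw [h] <;> norm_num
    · rw [show (1 - 2*α)/2 + (1 + 2*α)/2 = 1 by ring, mul_one]
  simp_rw [hz]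
  rw [← Finset.mul_sum, marg (fun t : ℝ => if t = 1 then 1 else 0)
    (fun (j : Fin k) (t : ℝ) => 1/2 + (t / 4) *
        psi ((prodDist (μ j) n x / prodDist μ₀ n x - 1) / α))]
  · norm_num
  · intro j
    ring

lemma exp_upper {v : ℝ} (hv : |v| ≤ 1) : Real.exp v ≤ 1 + v + v^2 := by
  have := Real.abs_exp_sub_one_sub_id_le hv
  linarith [(abs_le.1 this).2]

/-- pointwise bound on the clipping error -/
lemma clip_bound {α L S s θ ρ e : ℝ} (hα0 : 0 < α) (hα2 : α ≤ 1/2) (hL : 0 ≤ L)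
    (hρ : 0 < ρ) (hs : ρ * s = 2/3 * α) (hθ : ρ ≤ θ) (he : e ≤ α / 3)
    (hU : L ≤ Real.exp (ρ * S)) (hD : Real.exp (ρ * S - e) ≤ L) :
    |(L - 1) - α * psi ((L - 1) / α)|
      ≤ Real.exp (-(θ - ρ) * s) * Real.exp (θ * S) + Real.exp (-θ * s) * Real.exp (-θ * S) := by
  rw [← Real.exp_add, ← Real.exp_add]
  unfold psi
  rcases lt_or_ge α (L - 1) with h | h
  · have h1 : 1 ≤ (L - 1) / α := by rw [le_div_iff₀ hα0]; linarith
    rw [min_eq_left h1, max_eq_right (by norm_num), abs_of_nonneg (by linarith)]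
    have h2 : Real.exp (ρ * s) < Real.exp (ρ * S) := by
      have := exp_upper (v := ρ * s) (by rw [hs, abs_of_nonneg (by positivity)]; linarith)
      rw [hs] at this ⊢
      nlinarith
    have h3 : s < S := by
      rw [Real.exp_lt_exp] at h2
      exact lt_of_mul_lt_mul_left h2 hρ.le
    have h4 : Real.exp (ρ * S) ≤ Real.exp (-(θ - ρ) * s + θ * S) := by
      rw [Real.exp_le_exp]; nlinarith
    have := Real.exp_pos (-θ * s + -θ * S)
    linarith
  · rcases lt_or_ge (L - 1) (-α) with h' | h'
    · have h1 : (L - 1) / α ≤ -1 := by rw [div_le_iff₀ hα0]; linarith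
      rw [min_eq_right (by linarith), max_eq_left h1, abs_of_nonpos (by linarith)]
      have h2 : Real.exp (ρ * S - e) < Real.exp (-α) := by
        have := Real.add_one_le_exp (-α)
        linarith
      rw [Real.exp_lt_exp] at h2
      have h3 : S < -s := by
        refine lt_of_mul_lt_mul_left (a := ρ) ?_ hρ.le
        linarith
      have h4 : Real.exp 0 ≤ Real.exp (-θ * s + -θ * S) := by
        rw [Real.exp_le_exp]; nlinarith
      rw [Real.exp_zero] at h4
      have := Real.exp_pos (-(θ - ρ) * s + θ * S)
      linarith
    · have h1 : (L - 1) / α ≤ 1 := by rw [div_le_iff₀ hα0]; linarith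
      have h2 : -1 ≤ (L - 1) / α := by rw [le_div_iff₀ hα0]; linarith
      rw [min_eq_right h1, max_eq_right h2, mul_div_cancel₀ _ hα0.ne', sub_self, abs_zero]
      positivity

lemma exp_lower {u : ℝ} (h : |u| ≤ 1/6) : Real.exp (u - 2 * u^2) ≤ 1 + u := by
  obtain ⟨h1, h2⟩ := abs_le.1 h
  have := exp_upper (v := u - 2*u^2) (by rw [abs_le]; constructor <;> nlinarith)
  have h3 : (1 - 2*u)^2 ≤ 2 := by nlinarith
  nlinarith [mul_le_mul_of_nonneg_left h3 (sq_nonneg u)]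

set_option maxHeartbeats 2000000 in
lemma bias_bound (k : ℕ) (hk : 2 ≤ k)
    (Ω : Finset (Fin k → ℝ)) (hΩ : ∀ x ∈ Ω, ∀ i, x i = 1 ∨ x i = -1)
    (μ₀ : ↥Ω → ℝ) (μ : Fin k → ↥Ω → ℝ) (ρ : ℝ)
    (hdist : IsDist μ₀) (hpos : ∀ x, 0 < μ₀ x)
    (hhalf : ∀ i : Fin k, ∑ x : ↥Ω, (if x.1 i = 1 then μ₀ x else 0) = 1/2)
    (hμ : ∀ i x, μ i x = (1 + ρ * x.1 i) * μ₀ x)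
    (hρ0 : 0 < ρ) (n : ℕ) (hn : 1 ≤ n)
    (α : ℝ) (hα0 : 0 < α) (hα2 : α ≤ 1/2)
    (hαeq : α = (2 * Real.sqrt (2 * Real.log (2 * (k : ℝ)^2 / α^2)) + 3) * ρ * Real.sqrt n)
    (i : Fin k) :
    |∑ x : Fin n → ↥Ω, prodDist μ₀ n x *
      (α * psi ((prodDist (μ i) n x / prodDist μ₀ n x - 1) / α))| ≤ α^2 / (k:ℝ)^2 := by
  set t := Real.sqrt (2 * Real.log (2 * (k : ℝ)^2 / α^2)) with ht
  set w := Real.sqrt n with hw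
  have hk' : (2:ℝ) ≤ k := by exact_mod_cast hk
  have hn' : (1:ℝ) ≤ n := by exact_mod_cast hn
  have hw1 : 1 ≤ w := Real.one_le_sqrt.2 hn'
  have hw2 : w^2 = n := Real.sq_sqrt (by linarith)
  have ht0 : 0 ≤ t := Real.sqrt_nonneg _
  have hk0 : (0:ℝ) < k := by linarith
  have hexp : Real.exp (-(t^2/2)) = α^2 / (2 * (k:ℝ)^2) := by
    have hge : 1 ≤ 2 * (k:ℝ)^2/α^2 := by
      rw [le_div_iff₀ (by positivity)]; nlinarith
    rw [ht, Real.sq_sqrt (by have := Real.log_nonneg hge; linarith)]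
    rw [mul_div_cancel_left₀ _ (by norm_num), Real.exp_neg, Real.exp_log (by positivity), inv_div]
  set A := 2 * t + 3 with hA
  have hA3 : 3 ≤ A := by linarith
  have hρw : 3 * (ρ * w) ≤ α := by
    have : 0 ≤ ρ * w := by positivity
    nlinarith
  have hρ6 : ρ ≤ 1/6 := by nlinarith
  set s := 2/3 * A * w with hs
  set θ := 2/3 * A / w with hθ
  have hρs : ρ * s = 2/3 * α := by rw [hs]; linarith
  have hθρ : ρ ≤ θ := by
    rw [hθ, le_div_iff₀ (by linarith)]; linarith
  have hθs : θ * s = (2/3*A)^2 := by rw [hθ, hs]; field_simp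
  have hnθ : (n:ℝ) * θ^2 = (2/3*A)^2 := by rw [hθ, ← hw2]; field_simp
  -- the likelihood ratio
  have hP : ∀ x : Fin n → ↥Ω, 0 < prodDist μ₀ n x := fun x => Finset.prod_pos fun j _ => hpos _
  have hLe : ∀ x : Fin n → ↥Ω, prodDist (μ i) n x
      = prodDist μ₀ n x * ∏ j, (1 + ρ * (x j).1 i) := by
    intro x
    unfold prodDist
    rw [← Finset.prod_mul_distrib]
    exact Finset.prod_congr rfl fun j _ => by rw [hμ]; ring
  have hL : ∀ x : Fin n → ↥Ω, prodDist (μ i) n x / prodDist μ₀ n x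
      = ∏ j, (1 + ρ * (x j).1 i) := fun x => by
    rw [hLe, mul_div_cancel_left₀ _ (hP x).ne']
  have hc : ∀ x : ↥Ω, |x.1 i| = 1 ∧ (x.1 i)^2 = 1 := fun x => by
    rcases hΩ x.1 x.2 i with h | h <;> rw [h] <;> norm_num
  have hsum1 : ∑ x, μ₀ x = 1 := hdist.2
  have hmean : ∑ x : ↥Ω, μ₀ x * x.1 i = 0 := by
    have : ∀ x : ↥Ω, μ₀ x * x.1 i = 2 * (if x.1 i = 1 then μ₀ x else 0) - μ₀ x := fun x => by
      rcases hΩ x.1 x.2 i with h | h <;> rw [h] <;> norm_num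
      ring
    simp_rw [this]
    rw [Finset.sum_sub_distrib, ← Finset.mul_sum, hhalf, hsum1]; norm_num
  have hE : ∀ f : ↥Ω → ℝ, ∑ x : Fin n → ↥Ω, prodDist μ₀ n x * ∏ j, f (x j)
      = (∑ a, μ₀ a * f a)^n := fun f => by
    rw [Fintype.sum_pow]
    refine Finset.sum_congr rfl fun x _ => ?_
    unfold prodDist
    rw [Finset.prod_mul_distrib]
  have hEL : ∑ x : Fin n → ↥Ω, prodDist μ₀ n x * (∏ j, (1 + ρ * (x j).1 i) - 1) = 0 := by
    simp_rw [mul_sub]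
    rw [Finset.sum_sub_distrib, hE (fun a => 1 + ρ * a.1 i)]
    have h1 := hE (fun _ => 1)
    simp only [Finset.prod_const_one, mul_one] at h1
    simp only [mul_one]
    rw [h1, hsum1]
    have : ∑ a, μ₀ a * (1 + ρ * a.1 i) = 1 := by
      have : ∀ a : ↥Ω, μ₀ a * (1 + ρ * a.1 i) = μ₀ a + ρ * (μ₀ a * a.1 i) := fun a => by ring
      simp_rw [this]
      rw [Finset.sum_add_distrib, ← Finset.mul_sum, hmean, hsum1]; ring
    rw [this]; simp
  have hMGF : ∀ η : ℝ, ∑ x : Fin n → ↥Ω, prodDist μ₀ n x * Real.exp (η * ∑ j, (x j).1 i)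
      ≤ Real.exp (n * η^2 / 2) := fun η => by
    have h1 : ∀ x : Fin n → ↥Ω, Real.exp (η * ∑ j, (x j).1 i)
        = ∏ j, Real.exp (η * (x j).1 i) := fun x => by
      rw [Finset.mul_sum, Real.exp_sum]
    simp_rw [h1]
    rw [hE (fun a => Real.exp (η * a.1 i))]
    have h2 : ∑ a, μ₀ a * Real.exp (η * a.1 i) = Real.cosh η := by
      have : ∀ a : ↥Ω, μ₀ a * Real.exp (η * a.1 i)
          = Real.cosh η * μ₀ a + Real.sinh η * (μ₀ a * a.1 i) := fun a => by
        rcases hΩ a.1 a.2 i with h | h <;> rw [h]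
        · rw [mul_one, ← Real.cosh_add_sinh]; ring
        · rw [mul_neg, mul_one, ← Real.cosh_sub_sinh]; ring
      simp_rw [this]
      rw [Finset.sum_add_distrib, ← Finset.mul_sum, ← Finset.mul_sum, hmean, hsum1]; ring
    rw [h2]
    calc Real.cosh η ^ n ≤ (Real.exp (η^2/2))^n :=
          pow_le_pow_left₀ (Real.cosh_pos _).le (Real.cosh_le_exp_half_sq η) n
      _ = _ := by rw [← Real.exp_nat_mul]; congr 1; ring
  simp_rw [hL]
  have key : ∀ x : Fin n → ↥Ω, |(∏ j, (1 + ρ * (x j).1 i) - 1)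
      - α * psi ((∏ j, (1 + ρ * (x j).1 i) - 1) / α)|
      ≤ Real.exp (-(θ - ρ) * s) * Real.exp (θ * ∑ j, (x j).1 i)
        + Real.exp (-θ * s) * Real.exp (-θ * ∑ j, (x j).1 i) := fun x => by
    have hu : ∀ j, |ρ * (x j).1 i| ≤ 1/6 := fun j => by
      rw [abs_mul, (hc (x j)).1, abs_of_pos hρ0]; linarith
    have hp : ∀ j, 0 ≤ 1 + ρ * (x j).1 i := fun j => by
      have := (abs_le.1 (hu j)).1; linarith
    refine clip_bound (e := 2 * (n * ρ^2)) hα0 hα2 (Finset.prod_nonneg fun j _ => hp j) hρ0 hρs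
      hθρ ?_ ?_ ?_
    · have : n * ρ^2 = (ρ * w)^2 := by rw [← hw2]; ring
      rw [this]
      have : 0 ≤ ρ * w := by positivity
      nlinarith
    · rw [Finset.mul_sum, Real.exp_sum]
      refine Finset.prod_le_prod (fun j _ => hp j) fun j _ => ?_
      have := Real.add_one_le_exp (ρ * (x j).1 i)
      linarith
    · have : ρ * ∑ j, (x j).1 i - 2 * (n * ρ^2)
          = ∑ j, (ρ * (x j).1 i - 2 * (ρ * (x j).1 i)^2) := by
        simp_rw [mul_pow, (hc _).2]
        rw [Finset.sum_sub_distrib, ← Finset.mul_sum]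
        simp
        ring
      rw [this, Real.exp_sum]
      exact Finset.prod_le_prod (fun j _ => (Real.exp_pos _).le) fun j _ => exp_lower (hu j)
  have e1 : ∑ x : Fin n → ↥Ω, prodDist μ₀ n x *
      (α * psi ((∏ j, (1 + ρ * (x j).1 i) - 1) / α))
      = - ∑ x : Fin n → ↥Ω, prodDist μ₀ n x * ((∏ j, (1 + ρ * (x j).1 i) - 1)
      - α * psi ((∏ j, (1 + ρ * (x j).1 i) - 1) / α)) := by
    have := hEL
    simp_rw [mul_sub _ _ (α * _)]
    rw [Finset.sum_sub_distrib, hEL]; ring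
  rw [e1, abs_neg]
  have b1 : Real.exp (-(θ - ρ) * s) * Real.exp (n * θ^2/2) ≤ α^2 / (2 * (k:ℝ)^2) := by
    rw [← hexp, ← Real.exp_add, Real.exp_le_exp]
    have : -(θ - ρ) * s + n * θ^2/2 = ρ * s - θ * s + n * θ^2/2 := by ring
    rw [this, hnθ, hθs, hρs, hA]
    nlinarith
  have b2 : Real.exp (-θ * s) * Real.exp (n * (-θ)^2/2) ≤ α^2 / (2 * (k:ℝ)^2) := by
    rw [← hexp, ← Real.exp_add, Real.exp_le_exp]
    have : -θ * s + n * (-θ)^2/2 = - (θ * s) + n * θ^2/2 := by ring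
    rw [this, hnθ, hθs, hA]
    nlinarith
  calc _ ≤ ∑ x : Fin n → ↥Ω, |prodDist μ₀ n x * ((∏ j, (1 + ρ * (x j).1 i) - 1)
      - α * psi ((∏ j, (1 + ρ * (x j).1 i) - 1) / α))| := Finset.abs_sum_le_sum_abs _ _
    _ ≤ ∑ x : Fin n → ↥Ω, prodDist μ₀ n x *
        (Real.exp (-(θ - ρ) * s) * Real.exp (θ * ∑ j, (x j).1 i)
        + Real.exp (-θ * s) * Real.exp (-θ * ∑ j, (x j).1 i)) := by
      refine Finset.sum_le_sum fun x _ => ?_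
      rw [abs_mul, abs_of_pos (hP x)]
      exact mul_le_mul_of_nonneg_left (key x) (hP x).le
    _ = Real.exp (-(θ - ρ) * s) * (∑ x : Fin n → ↥Ω, prodDist μ₀ n x *
          Real.exp (θ * ∑ j, (x j).1 i))
        + Real.exp (-θ * s) * (∑ x : Fin n → ↥Ω, prodDist μ₀ n x *
          Real.exp (-θ * ∑ j, (x j).1 i)) := by
      rw [Finset.mul_sum, Finset.mul_sum, ← Finset.sum_add_distrib]
      exact Finset.sum_congr rfl fun x _ => by ring
    _ ≤ Real.exp (-(θ - ρ) * s) * Real.exp (n * θ^2/2)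
        + Real.exp (-θ * s) * Real.exp (n * (-θ)^2/2) := by
      exact add_le_add (mul_le_mul_of_nonneg_left (hMGF θ) (Real.exp_pos _).le)
        (mul_le_mul_of_nonneg_left (hMGF (-θ)) (Real.exp_pos _).le)
    _ ≤ α^2 / (2 * (k:ℝ)^2) + α^2 / (2 * (k:ℝ)^2) := add_le_add b1 b2
    _ = _ := by field_simp; norm_num

/-- properties of the Markov chain `X → Y → Z`:
(a) `Pr[X = x ∧ Z_i = 1] = μ_i^n(x)/2` for `x ∈ 𝒯`;
(b) `|Pr[Z_i = 1] − 1/2| ≤ α²/k`;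
(c) `|Pr[Y_i = 1] − 1/2| = |Pr[Z_i = 1] − 1/2|/(2α) ≤ α/(2k)`. -/
theorem statement6 (k : ℕ) (hk : 2 ≤ k)
    (Ω : Finset (Fin k → ℝ)) (hΩ : ∀ x ∈ Ω, ∀ i, x i = 1 ∨ x i = -1)
    (μ₀ : ↥Ω → ℝ) (μ : Fin k → ↥Ω → ℝ) (ρ : ℝ)
    (hdist : IsDist μ₀) (hpos : ∀ x, 0 < μ₀ x)
    (hhalf : ∀ i : Fin k, ∑ x : ↥Ω, (if x.1 i = 1 then μ₀ x else 0) = 1/2)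
    (hμ : ∀ i x, μ i x = (1 + ρ * x.1 i) * μ₀ x)
    (hρ0 : 0 < ρ) (hρ1 : ρ < 1)
    (n : ℕ) (hn : 1 ≤ n)
    (hρle : ρ ≤ 1 / (2 * Real.sqrt n *
      (2 * Real.sqrt (2 * Real.log (8 * (k : ℝ)^2)) + 3)))
    (α : ℝ) (hα0 : 0 < α) (hα2 : α ≤ 1/2)
    (hαeq : α = (2 * Real.sqrt (2 * Real.log (2 * (k : ℝ)^2 / α^2)) + 3) * ρ * Real.sqrt n) :
    (∀ x : Fin n → ↥Ω,
      (∀ i : Fin k, |prodDist (μ i) n x / prodDist μ₀ n x - 1| ≤ α) →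
      ∀ i : Fin k,
        (∑ y : Fin k → ↥Sgn, ∑ z : Fin k → ↥Sgn,
            if (z i).1 = 1 then jointXYZ Ω μ₀ μ n α x y z else 0)
          = prodDist (μ i) n x / 2) ∧
    (∀ i : Fin k,
      |(∑ x : Fin n → ↥Ω, ∑ y : Fin k → ↥Sgn, ∑ z : Fin k → ↥Sgn,
          if (z i).1 = 1 then jointXYZ Ω μ₀ μ n α x y z else 0) - 1/2|
        ≤ α^2 / k) ∧
    (∀ i : Fin k,
      |(∑ x : Fin n → ↥Ω, ∑ y : Fin k → ↥Sgn, ∑ z : Fin k → ↥Sgn,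
          if (y i).1 = 1 then jointXYZ Ω μ₀ μ n α x y z else 0) - 1/2|
        = |(∑ x : Fin n → ↥Ω, ∑ y : Fin k → ↥Sgn, ∑ z : Fin k → ↥Sgn,
            if (z i).1 = 1 then jointXYZ Ω μ₀ μ n α x y z else 0) - 1/2| / (2*α) ∧
      |(∑ x : Fin n → ↥Ω, ∑ y : Fin k → ↥Sgn, ∑ z : Fin k → ↥Sgn,
          if (y i).1 = 1 then jointXYZ Ω μ₀ μ n α x y z else 0) - 1/2|
        ≤ α / (2*k)) := by
  have hk' : (2:ℝ) ≤ k := by exact_mod_cast hk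
  have hk0 : (0:ℝ) < k := by linarith
  have hP : ∀ x : Fin n → ↥Ω, 0 < prodDist μ₀ n x := fun x => Finset.prod_pos fun j _ => hpos _
  have hP1 : ∑ x : Fin n → ↥Ω, prodDist μ₀ n x = 1 := by
    have := Fintype.sum_pow μ₀ n
    rw [hdist.2, one_pow] at this
    exact this.symm
  have hZ : ∀ i : Fin k, (∑ x : Fin n → ↥Ω, ∑ y : Fin k → ↥Sgn, ∑ z : Fin k → ↥Sgn,
          if (z i).1 = 1 then jointXYZ Ω μ₀ μ n α x y z else 0) - 1/2
      = 1/2 * ∑ x : Fin n → ↥Ω, prodDist μ₀ n x *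
      (α * psi ((prodDist (μ i) n x / prodDist μ₀ n x - 1) / α)) := fun i => by
    simp_rw [margZ, mul_add]
    rw [Finset.sum_add_distrib, ← Finset.sum_mul, hP1, Finset.mul_sum, one_mul,
      add_sub_cancel_left]
    exact Finset.sum_congr rfl fun x _ => by ring
  have hY : ∀ i : Fin k, (∑ x : Fin n → ↥Ω, ∑ y : Fin k → ↥Sgn, ∑ z : Fin k → ↥Sgn,
          if (y i).1 = 1 then jointXYZ Ω μ₀ μ n α x y z else 0) - 1/2
      = (1/2 * ∑ x : Fin n → ↥Ω, prodDist μ₀ n x *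
      (α * psi ((prodDist (μ i) n x / prodDist μ₀ n x - 1) / α))) / (2 * α) := fun i => by
    simp_rw [margY, mul_add]
    rw [Finset.sum_add_distrib, ← Finset.sum_mul, hP1, Finset.mul_sum, Finset.sum_div, one_mul,
      add_sub_cancel_left]
    exact Finset.sum_congr rfl fun x _ => by field_simp; ring
  have hB : ∀ i : Fin k, |1/2 * ∑ x : Fin n → ↥Ω, prodDist μ₀ n x *
      (α * psi ((prodDist (μ i) n x / prodDist μ₀ n x - 1) / α))| ≤ α^2 / k := fun i => by
    have := bias_bound k hk Ω hΩ μ₀ μ ρ hdist hpos hhalf hμ hρ0 n hn α hα0 hα2 hαeq i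
    rw [abs_mul, abs_of_pos (by norm_num : (0:ℝ) < 1/2)]
    have h2 : α^2 / (k:ℝ)^2 ≤ α^2 / k := by
      apply div_le_div_of_nonneg_left (by positivity) hk0
      nlinarith
    have h3 : 0 ≤ α^2 / (k:ℝ) := by positivity
    linarith
  refine ⟨?_, ?_, ?_⟩
  · intro x hx i
    rw [margZ]
    obtain ⟨h1, h2⟩ := abs_le.1 (hx i)
    have h1' : (prodDist (μ i) n x / prodDist μ₀ n x - 1) / α ≤ 1 := by
      rw [div_le_iff₀ hα0]; linarith
    have h2' : -1 ≤ (prodDist (μ i) n x / prodDist μ₀ n x - 1) / α := by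
      rw [le_div_iff₀ hα0]; linarith
    unfold psi
    rw [min_eq_right h1', max_eq_right h2']
    have := (hP x).ne'
    field_simp
    ring
  · intro i
    rw [hZ]
    exact hB i
  · intro i
    rw [hZ, hY, abs_div, abs_of_pos (by positivity : 0 < 2 * α)]
    refine ⟨rfl, ?_⟩
    rw [div_le_iff₀ (by positivity)]
    refine (hB i).trans (le_of_eq ?_)
    field_simp
end
end

section
/- There exists a numerical constant C > 0 such that the following holds. Let k ≥ 2, let {μ_1,…,μ_k} be a BCD(ρ) family on a finite sample space Ω ⊆ {−1,1}^k centered around μ_0 with μ_0(x) > 0 for all x ∈ Ω, let n ≥ 1, assume ρ ≤ 1/(2√n·(2√(2·ln(8k²)) + 3)) and that condition (corr) holds for (μ_0,…,μ_k; n, ρ). Let α be the unique number with 0 < α ≤ 1/2 satisfying α = (2√(2·ln(2k²/α²)) + 3)·ρ·√n, and let Y ∈ {−1,1}^k be the random vector obtained by drawing X ∼ μ_0^n and then, conditioned on X, drawing Y_1,…,Y_k independently with Pr[Y_i = y_i | X] = 1/2 + (y_i/4)·ψ((μ_i^n(X)/μ_0^n(X) − 1)/α), where ψ(s) = max(−1,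 min(1, s)). Then H(Y) ≥ k − C, where H is the base-2 Shannon entropy. -/
open Finset

noncomputable section

section aux

variable {W : Type*} [Fintype W] {k : ℕ}

/-- No coordinate of the likelihood process started at `L` leaves `[1-α, 1+α]`. -/
def GoodPath (X : W → Fin k → ℝ) (ρ α : ℝ) : (n : ℕ) → (Fin k → ℝ) → (Fin n → W) → Prop
  | 0, L, _ => ∀ i, |L i - 1| ≤ α
  | n + 1, L, x => (∀ i, |L i - 1| ≤ α) ∧
      GoodPath X ρ α n (fun i => L i * (1 + ρ * X (x 0) i)) (Fin.tail x)

/-- The multiplicative process `z * ∏ u` reaches level `c`. -/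
def HitPath (u : W → ℝ) (c : ℝ) : (n : ℕ) → ℝ → (Fin n → W) → Prop
  | 0, z, _ => c ≤ z
  | n + 1, z, x => c ≤ z ∨ HitPath u c n (z * u (x 0)) (Fin.tail x)

lemma sum_cons_path (p : W → ℝ) (n : ℕ) (F : (Fin (n+1) → W) → ℝ) :
    ∑ x, prodDist p (n+1) x * F x =
      ∑ w, p w * ∑ x, prodDist p n x * F (Fin.cons w x) := by
  rw [← (Fin.consEquiv (fun _ => W)).sum_comp, Fintype.sum_prod_type]
  refine Finset.sum_congr rfl fun w _ => ?_
  rw [Finset.mul_sum]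
  refine Finset.sum_congr rfl fun x _ => ?_
  simp [prodDist, Fin.prod_univ_succ, Fin.consEquiv, mul_assoc]

lemma prodDist_nonneg (p : W → ℝ) (hp : ∀ w, 0 ≤ p w) (n : ℕ) (x) : 0 ≤ prodDist p n x :=
  Finset.prod_nonneg fun _ _ => hp _

lemma prodDist_sum (p : W → ℝ) (hp : ∑ w, p w = 1) (n : ℕ) : ∑ x, prodDist p n x = 1 := by
  induction n with
  | zero => simp [prodDist]
  | succ n ih =>
    have := sum_cons_path p n (fun _ => 1)
    simp only [mul_one, ih, hp] at this
    exact this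

open Classical in
lemma hit_bound (p : W → ℝ) (hp : ∀ w, 0 ≤ p w) (hs : ∑ w, p w = 1) (u : W → ℝ)
    (hu : ∀ w, 0 ≤ u w) (hpu : ∑ w, p w * u w ≤ 1) (c : ℝ) (hc : 0 < c) (n : ℕ) :
    ∀ z, 0 ≤ z → ∑ x, prodDist p n x * (if HitPath u c n z x then 1 else 0) ≤ z / c := by
  have triv : ∀ (n : ℕ) (z : ℝ), c ≤ z →
      ∑ x, prodDist p n x * (if HitPath u c n z x then 1 else 0) ≤ z / c := by
    intro n z h
    calc _ ≤ ∑ x, prodDist p n x := by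
          refine Finset.sum_le_sum fun x _ => ?_
          have := prodDist_nonneg p hp n x
          split_ifs <;> simp [this]
      _ = 1 := prodDist_sum p hs n
      _ ≤ z / c := by rwa [le_div_iff₀ hc, one_mul]
  induction n with
  | zero =>
    intro z hz
    by_cases h : c ≤ z
    · exact triv 0 z h
    · simp only [HitPath, h, if_false, mul_zero, Finset.sum_const_zero]; positivity
  | succ n ih =>
    intro z hz
    by_cases h : c ≤ z
    · exact triv _ z h
    · rw [sum_cons_path]
      simp only [HitPath, h, false_or, Fin.cons_zero, Fin.tail_cons]
      calc _ ≤ ∑ w, p w * (z * u w / c) :=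
            Finset.sum_le_sum fun w _ =>
              mul_le_mul_of_nonneg_left (ih _ (mul_nonneg hz (hu w))) (hp w)
        _ = (z / c) * ∑ w, p w * u w := by
            rw [Finset.mul_sum]; exact Finset.sum_congr rfl fun w _ => by ring
        _ ≤ (z / c) * 1 := by gcongr
        _ = z / c := mul_one _

lemma good_final (X : W → Fin k → ℝ) (ρ α : ℝ) (n : ℕ) :
    ∀ (L : Fin k → ℝ) (x : Fin n → W), GoodPath X ρ α n L x →
      ∀ i, |L i * ∏ j, (1 + ρ * X (x j) i) - 1| ≤ α := by
  induction n with
  | zero => intro L x h i; simpa using h i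
  | succ n ih =>
    intro L x h i
    have := ih _ _ h.2 i
    rw [Fin.prod_univ_succ, ← mul_assoc]
    exact this

lemma good_start (X : W → Fin k → ℝ) (ρ α : ℝ) (n : ℕ)
    (L : Fin k → ℝ) (x : Fin n → W) (h : GoodPath X ρ α n L x) (i) : |L i - 1| ≤ α := by
  cases n with
  | zero => exact h i
  | succ n => exact h.1 i

open Classical in
lemma good_bound (p : W → ℝ) (hp : ∀ w, 0 ≤ p w) (X : W → Fin k → ℝ)
    (hX : ∀ w i, |X w i| = 1) (ρ α r B : ℝ) (hρ : 0 < ρ) (hα : 0 < α) (hα2 : α ≤ 1/2)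
    (hr1 : r ≤ 1) (hr : ρ * (3/2) ≤ r * α) (hB : 0 ≤ B)
    (hrow : ∀ v : Fin k → ℝ, (∀ i, |v i| ≤ r) → ∑ w, p w * ∏ i, (1 + v i * X w i) ≤ B)
    (y : Fin k → ℝ) (hy : ∀ i, |y i| = 1) (n : ℕ) :
    ∀ L : Fin k → ℝ, (∀ i, 0 ≤ 1 + y i * (L i - 1) / (2 * α)) →
      ∑ x, prodDist p n x * (if GoodPath X ρ α n L x then
        ∏ i, (1 + y i * (L i * ∏ j, (1 + ρ * X (x j) i) - 1) / (2 * α)) else 0) ≤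
      B ^ n * ∏ i, (1 + y i * (L i - 1) / (2 * α)) := by
  induction n with
  | zero =>
    intro L hL
    have h0 : 0 ≤ ∏ i, (1 + y i * (L i - 1) / (2 * α)) := Finset.prod_nonneg fun i _ => hL i
    simp only [prodDist, Finset.univ_eq_empty, Finset.prod_empty, mul_one, one_mul, pow_zero,
      Fintype.sum_unique]
    split_ifs
    · exact le_rfl
    · exact h0
  | succ n ih =>
    intro L hL
    have h0 : 0 ≤ ∏ i, (1 + y i * (L i - 1) / (2 * α)) := Finset.prod_nonneg fun i _ => hL i
    by_cases hg : ∀ i, |L i - 1| ≤ α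
    swap
    · have : ∀ x, ¬ GoodPath X ρ α (n+1) L x := fun x h => hg h.1
      simp only [this, if_false, mul_zero, Finset.sum_const_zero]
      positivity
    have ha : ∀ i, 1/2 ≤ 1 + y i * (L i - 1) / (2 * α) := by
      intro i
      have h1 : |y i * (L i - 1)| ≤ α := by rw [abs_mul, hy, one_mul]; exact hg i
      have h2 : -α / (2*α) ≤ y i * (L i - 1) / (2 * α) := by
        gcongr; exact (abs_le.mp h1).1
      have h3 : -α / (2*α) = -(1/2) := by field_simp
      linarith
    set a : Fin k → ℝ := fun i => 1 + y i * (L i - 1) / (2 * α) with hadef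
    set v : Fin k → ℝ := fun i => y i * L i * ρ / (2 * α * a i) with hv
    have ha' : ∀ i, 0 < a i := fun i => by have := ha i; simp only [hadef]; linarith
    have hvr : ∀ i, |v i| ≤ r := by
      intro i
      have hLi := abs_le.mp (hg i)
      have hL0 : 0 ≤ L i := by linarith [hLi.1]
      have e : |v i| = L i * ρ / (2 * α * a i) := by
        simp only [hv]
        have := ha' i
        rw [abs_div, abs_mul, abs_mul, hy, one_mul, abs_of_nonneg hL0, abs_of_pos hρ,
          abs_of_pos (by positivity)]
      rw [e, div_le_iff₀ (by have := ha' i; positivity)]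
      have h1 : L i * ρ ≤ (3/2) * ρ := by gcongr; linarith [hLi.2]
      have h2 : (0:ℝ) ≤ r * α := by nlinarith
      have h3 : 1/2 ≤ a i := ha i
      nlinarith
    have key : ∀ w i, 1 + y i * (L i * (1 + ρ * X w i) - 1) / (2 * α) =
        a i * (1 + v i * X w i) := by
      intro w i
      have := (ha' i).ne'
      have e : a i * v i = y i * L i * ρ / (2 * α) := by
        simp only [hv]; field_simp
      rw [mul_add (a i), ← mul_assoc (a i), e]
      simp only [hadef]; ring
    have hnn : ∀ w i, 0 ≤ 1 + y i * (L i * (1 + ρ * X w i) - 1) / (2 * α) := by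
      intro w i
      rw [key]
      refine mul_nonneg (ha' i).le ?_
      have : |v i * X w i| ≤ 1 := by rw [abs_mul, hX, mul_one]; exact (hvr i).trans hr1
      linarith [(abs_le.mp this).1]
    rw [sum_cons_path]
    calc _ ≤ ∑ w, p w * (B ^ n * ∏ i, (1 + y i * (L i * (1 + ρ * X w i) - 1) / (2 * α))) := by
          refine Finset.sum_le_sum fun w _ => mul_le_mul_of_nonneg_left ?_ (hp w)
          refine le_trans (le_of_eq ?_) (ih (fun i => L i * (1 + ρ * X w i)) (hnn w))
          refine Finset.sum_congr rfl fun x _ => ?_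
          have : GoodPath X ρ α (n+1) L (Fin.cons w x : Fin (n+1) → W) ↔
              GoodPath X ρ α n (fun i => L i * (1 + ρ * X w i)) x := by
            simp only [GoodPath, Fin.cons_zero, Fin.tail_cons]
            exact ⟨fun h => h.2, fun h => ⟨hg, h⟩⟩
          simp only [this, Fin.prod_univ_succ, Fin.cons_zero, Fin.cons_succ, mul_assoc]
      _ = (B ^ n * ∏ i, a i) * ∑ w, p w * ∏ i, (1 + v i * X w i) := by
          rw [Finset.mul_sum]
          refine Finset.sum_congr rfl fun w _ => ?_
          simp only [key, Finset.prod_mul_distrib]; ring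
      _ ≤ (B ^ n * ∏ i, a i) * B := by
          have : 0 ≤ ∏ i, a i := h0
          exact mul_le_mul_of_nonneg_left (hrow v hvr) (by positivity)
      _ = _ := by rw [pow_succ]; ring

lemma exp_le_one_add (y : ℝ) (hy : -(1/2) ≤ y) (hy2 : y ≤ 1/2) :
    Real.exp (y - 2 * y^2) ≤ 1 + y := by
  have h1 := Real.add_one_le_exp (-(y - 2 * y^2))
  rw [Real.exp_neg] at h1
  have h2 : 0 < Real.exp (y - 2*y^2) := Real.exp_pos _
  have h3 : (-(y - 2 * y^2) + 1) * Real.exp (y - 2*y^2) ≤ 1 := by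
    calc _ ≤ (Real.exp (y - 2*y^2))⁻¹ * Real.exp (y - 2*y^2) := by gcongr
      _ = 1 := inv_mul_cancel₀ h2.ne'
  have h4 : 0 < -(y - 2 * y^2) + 1 := by nlinarith
  have h5 : 1 ≤ (1 + y) * (-(y - 2 * y^2) + 1) := by nlinarith [sq_nonneg y]
  by_contra hcon
  push Not at hcon
  nlinarith

lemma notgood_hit (X : W → Fin k → ℝ) (hX : ∀ w i, |X w i| = 1) (ρ α lam c : ℝ) (N : ℕ)
    (hρ : 0 < ρ) (hρ2 : ρ ≤ 1/2)
    (hup : ∀ (t : ℕ) (l s : ℝ), t ≤ N → 1 + α < l → l ≤ Real.exp (ρ * s) →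
      c ≤ Real.exp (lam * s - lam^2 * t / 2))
    (hdn : ∀ (t : ℕ) (l s : ℝ), t ≤ N → l < 1 - α → Real.exp (ρ * s - 2 * ρ^2 * t) ≤ l →
      c ≤ Real.exp (-lam * s - lam^2 * t / 2)) (n : ℕ) :
    ∀ (t : ℕ) (L s : Fin k → ℝ) (x : Fin n → W), t + n = N → (∀ i, L i ≤ Real.exp (ρ * s i)) →
      (∀ i, Real.exp (ρ * s i - 2 * ρ^2 * t) ≤ L i) → ¬ GoodPath X ρ α n L x →
      ∃ i, HitPath (fun w => Real.exp (lam * X w i - lam^2/2)) c n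
              (Real.exp (lam * s i - lam^2 * t / 2)) x ∨
           HitPath (fun w => Real.exp (-lam * X w i - lam^2/2)) c n
              (Real.exp (-lam * s i - lam^2 * t / 2)) x := by
  have now : ∀ (t : ℕ) (L s : Fin k → ℝ), t ≤ N → (∀ i, L i ≤ Real.exp (ρ * s i)) →
      (∀ i, Real.exp (ρ * s i - 2 * ρ^2 * t) ≤ L i) → ¬ (∀ i, |L i - 1| ≤ α) →
      ∃ i, c ≤ Real.exp (lam * s i - lam^2 * t / 2) ∨
        c ≤ Real.exp (-lam * s i - lam^2 * t / 2) := by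
    intro t L s ht h1 h2 h3
    push Not at h3
    obtain ⟨i, hi⟩ := h3
    refine ⟨i, ?_⟩
    rcases lt_abs.mp hi with h | h
    · exact Or.inl (hup t (L i) (s i) ht (by linarith) (h1 i))
    · exact Or.inr (hdn t (L i) (s i) ht (by linarith) (h2 i))
  induction n with
  | zero =>
    intro t L s x ht h1 h2 h3
    exact now t L s (by omega) h1 h2 h3
  | succ n ih =>
    intro t L s x ht h1 h2 h3
    by_cases hg : ∀ i, |L i - 1| ≤ α
    · have h4 : ¬ GoodPath X ρ α n (fun i => L i * (1 + ρ * X (x 0) i)) (Fin.tail x) :=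
        fun h => h3 ⟨hg, h⟩
      have hsq : ∀ i, (ρ * X (x 0) i)^2 = ρ^2 := fun i => by
        rw [mul_pow, ← sq_abs (X (x 0) i), hX]; ring
      have hb : ∀ i, |ρ * X (x 0) i| ≤ 1/2 := fun i => by
        rw [abs_mul, hX, mul_one, abs_of_pos hρ]; exact hρ2
      have hpos : ∀ i, 0 ≤ 1 + ρ * X (x 0) i := fun i => by linarith [(abs_le.mp (hb i)).1]
      have hA : ∀ i, L i * (1 + ρ * X (x 0) i) ≤ Real.exp (ρ * (s i + X (x 0) i)) := by
        intro i
        calc L i * (1 + ρ * X (x 0) i) ≤ Real.exp (ρ * s i) * Real.exp (ρ * X (x 0) i) := by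
              have := Real.add_one_le_exp (ρ * X (x 0) i)
              have := hpos i
              have := h1 i
              gcongr; linarith
          _ = _ := by rw [← Real.exp_add]; congr 1; ring
      have hB : ∀ i, Real.exp (ρ * (s i + X (x 0) i) - 2 * ρ^2 * ((t+1 : ℕ):ℝ)) ≤
          L i * (1 + ρ * X (x 0) i) := by
        intro i
        have e := exp_le_one_add (ρ * X (x 0) i) (by linarith [(abs_le.mp (hb i)).1])
          (abs_le.mp (hb i)).2
        calc _ = Real.exp (ρ * s i - 2 * ρ^2 * t) *
              Real.exp (ρ * X (x 0) i - 2 * (ρ * X (x 0) i)^2) := by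
              rw [← Real.exp_add, hsq]; push_cast; congr 1; ring
          _ ≤ _ := by
              have := h2 i
              have h0 : 0 ≤ L i := (Real.exp_pos _).le.trans this
              gcongr
      obtain ⟨i, hi⟩ := ih (t+1) _ (fun i => s i + X (x 0) i) (Fin.tail x) (by omega) hA hB h4
      · refine ⟨i, ?_⟩
        rcases hi with h | h
        · left; right
          convert h using 1
          rw [← Real.exp_add]; push_cast; congr 1; ring
        · right; right
          convert h using 1
          rw [← Real.exp_add]; push_cast; congr 1; ring
    · obtain ⟨i, hi⟩ := now t L s (by omega) h1 h2 hg
      exact ⟨i, hi.imp Or.inl Or.inl⟩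

open Classical in
lemma bad_bound (p : W → ℝ) (hp : ∀ w, 0 ≤ p w) (hs : ∑ w, p w = 1)
    (X : W → Fin k → ℝ) (hX : ∀ w i, |X w i| = 1)
    (hmean : ∀ i, ∑ w, p w * X w i = 0) (ρ α : ℝ) (N : ℕ) (hk : 2 ≤ k) (hN : 1 ≤ N)
    (hρ : 0 < ρ) (hα : 0 < α) (hα2 : α ≤ 1/2)
    (hαeq : α = (2 * Real.sqrt (2 * Real.log (2 * (k : ℝ)^2 / α^2)) + 3) * ρ * Real.sqrt N) :
    ∑ x, prodDist p N x * (if GoodPath X ρ α N (fun _ => 1) x then 0 else 1) ≤ 1 / (4 * k) := by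
  have hk' : (2:ℝ) ≤ k := by exact_mod_cast hk
  have hN' : (1:ℝ) ≤ N := by exact_mod_cast hN
  set ell := Real.log (2 * (k : ℝ)^2 / α^2) with hell
  have hcpos : 0 < 2 * (k : ℝ)^2 / α^2 := by positivity
  have hell0 : 0 ≤ ell := by
    apply Real.log_nonneg
    rw [le_div_iff₀ (by positivity)]
    nlinarith
  set q := Real.sqrt (2 * ell) with hq
  have hq0 : 0 ≤ q := Real.sqrt_nonneg _
  have hq2 : q^2 = 2 * ell := Real.sq_sqrt (by positivity)
  set m := Real.sqrt N with hm
  have hm2 : m^2 = N := Real.sq_sqrt (by positivity)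
  have hm1 : 1 ≤ m := by rw [hm]; exact Real.one_le_sqrt.mpr hN'
  have hρm : 3 * (ρ * m) ≤ α := by
    have : 0 ≤ q * (ρ * m) := by positivity
    nlinarith
  have hρ2 : ρ ≤ 1/6 := by nlinarith
  set lam := q / m with hlam
  have hlam0 : 0 ≤ lam := by positivity
  have hlamm : lam * m = q := by rw [hlam]; field_simp
  have hfin : ∀ (t : ℕ) (s : ℝ), t ≤ N → q * m ≤ s →
      2 * (k : ℝ)^2 / α^2 ≤ Real.exp (lam * s - lam^2 * t / 2) := by
    intro t s ht h
    rw [← Real.log_le_iff_le_exp hcpos]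
    have ht' : (t:ℝ) ≤ m^2 := by rw [hm2]; exact_mod_cast ht
    have h1 : lam * (q * m) ≤ lam * s := by gcongr
    have h2 : lam^2 * t ≤ lam^2 * m^2 := by gcongr
    have h3 : lam^2 * m^2 = q^2 := by rw [← mul_pow, hlamm]
    have h4 : lam * (q * m) = q^2 := by rw [← hlamm]; ring
    rw [← hell]
    linarith
  have hnot := notgood_hit X hX ρ α lam (2 * (k : ℝ)^2 / α^2) N hρ (by linarith)
    (by
      intro t l s ht h1 h2
      apply hfin t s ht
      have h3 : Real.log (1 + α) ≤ ρ * s := by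
        rw [Real.log_le_iff_le_exp (by linarith)]; linarith
      have h4 := Real.le_log_one_add_of_nonneg hα.le
      have h5 : α * (4/5) ≤ 2 * α / (α + 2) := by
        rw [le_div_iff₀ (by linarith)]; nlinarith
      have h6 : ρ * (q * m) ≤ ρ * s := by
        have : 0 ≤ ρ * m := by positivity
        have : 0 ≤ q * (ρ * m) := by positivity
        nlinarith
      exact le_of_mul_le_mul_left h6 hρ)
    (by
      intro t l s ht h1 h2
      have := hfin t (-s) ht ?_
      · convert this using 2; ring
      have h3 : ρ * s - 2 * ρ^2 * t < -α := by
        rw [← Real.exp_lt_exp]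
        have := Real.add_one_le_exp (-α)
        linarith
      have ht' : (t:ℝ) ≤ m^2 := by rw [hm2]; exact_mod_cast ht
      have h4 : 2 * ρ^2 * t ≤ 2 * ρ^2 * m^2 := by gcongr
      have h5 : 2 * ρ^2 * m^2 ≤ ρ * m := by
        have : 0 ≤ ρ * m := by positivity
        nlinarith
      have h6 : ρ * (q * m) ≤ ρ * (-s) := by
        have : 0 ≤ ρ * m := by positivity
        have : 0 ≤ q * (ρ * m) := by positivity
        nlinarith
      exact le_of_mul_le_mul_left h6 hρ) N
  have hmgf : ∀ (b : ℝ) (i : Fin k), b^2 = lam^2 →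
      ∑ w, p w * Real.exp (b * X w i - lam^2/2) ≤ 1 := by
    intro b i hb
    have e : ∀ w, Real.exp (b * X w i - lam^2/2) =
        Real.exp (-(lam^2/2)) * (Real.cosh b + X w i * Real.sinh b) := by
      intro w
      rw [sub_eq_add_neg, Real.exp_add, mul_comm]
      congr 1
      rcases eq_or_eq_neg_of_abs_eq (hX w i) with h | h
      · rw [h, mul_one, one_mul, Real.cosh_add_sinh]
      · rw [h, mul_neg_one, ← Real.cosh_sub_sinh]; ring
    calc _ = Real.exp (-(lam^2/2)) * (Real.cosh b * ∑ w, p w + Real.sinh b * ∑ w, p w * X w i) := by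
          rw [Finset.mul_sum, Finset.mul_sum, ← Finset.sum_add_distrib, Finset.mul_sum]
          refine Finset.sum_congr rfl fun w _ => ?_
          rw [e]; ring
      _ = Real.exp (-(lam^2/2)) * Real.cosh b := by rw [hs, hmean]; ring
      _ ≤ Real.exp (-(lam^2/2)) * Real.exp (b^2/2) := by
          gcongr; exact Real.cosh_le_exp_half_sq b
      _ = 1 := by rw [hb, ← Real.exp_add]; simp
  have hhit : ∀ (b : ℝ) (i : Fin k), b^2 = lam^2 → ∑ x, prodDist p N x *
      (if HitPath (fun w => Real.exp (b * X w i - lam^2/2)) (2 * (k : ℝ)^2 / α^2) N 1 x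
        then 1 else 0) ≤ α^2 / (2 * k^2) := by
    intro b i hb
    refine (hit_bound p hp hs _ (fun w => (Real.exp_pos _).le) (hmgf b i hb) _ hcpos N 1
      zero_le_one).trans (le_of_eq ?_)
    rw [one_div_div]
  calc _ ≤ ∑ x, ∑ i : Fin k, (prodDist p N x *
      (if HitPath (fun w => Real.exp (lam * X w i - lam^2/2)) (2 * (k : ℝ)^2 / α^2) N 1 x
        then 1 else 0) + prodDist p N x *
      (if HitPath (fun w => Real.exp (-lam * X w i - lam^2/2)) (2 * (k : ℝ)^2 / α^2) N 1 x
        then 1 else 0)) := by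
        refine Finset.sum_le_sum fun x _ => ?_
        have hpx := prodDist_nonneg p hp N x
        have hterm : ∀ i ∈ (Finset.univ : Finset (Fin k)), 0 ≤ (prodDist p N x *
          (if HitPath (fun w => Real.exp (lam * X w i - lam^2/2)) (2 * (k : ℝ)^2 / α^2) N 1 x
            then 1 else 0) + prodDist p N x *
          (if HitPath (fun w => Real.exp (-lam * X w i - lam^2/2)) (2 * (k : ℝ)^2 / α^2) N 1 x
            then (1:ℝ) else 0)) := by
          intro i _
          split_ifs <;> simp <;> linarith
        by_cases hg : GoodPath X ρ α N (fun _ => 1) x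
        · simp only [hg, if_true, mul_zero]
          exact Finset.sum_nonneg hterm
        · obtain ⟨i, hi⟩ := hnot 0 (fun _ => 1) (fun _ => 0) x (by omega) (by simp) (by simp) hg
          simp only [mul_zero, Nat.cast_zero, zero_div, sub_zero, Real.exp_zero] at hi
          refine le_trans ?_ (Finset.single_le_sum hterm (Finset.mem_univ i))
          simp only [hg, if_false, mul_one]
          rcases hi with h | h
          · rw [if_pos h]; split_ifs <;> linarith
          · rw [if_pos h]; split_ifs <;> linarith
    _ ≤ ∑ i : Fin k, (α^2 / (2 * k^2) + α^2 / (2 * k^2)) := by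
        rw [Finset.sum_comm]
        refine Finset.sum_le_sum fun i _ => ?_
        rw [Finset.sum_add_distrib]
        exact add_le_add (hhit lam i rfl) (hhit (-lam) i (by ring))
    _ = α^2 / k := by
        simp only [Finset.sum_const, Finset.card_univ, Fintype.card_fin, nsmul_eq_mul]
        field_simp; try ring
    _ ≤ (1/2)^2 / k := by gcongr
    _ = _ := by field_simp; norm_num

lemma row_bound (p : W → ℝ) (hs : ∑ w, p w = 1)
    (X : W → Fin k → ℝ) (hmean : ∀ i, ∑ w, p w * X w i = 0) (r b : ℝ)
    (hc : ∑ S ∈ Finset.univ.filter (fun S : Finset (Fin k) => 2 ≤ S.card),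
      r ^ S.card * |∑ w, p w * ∏ i ∈ S, X w i| ≤ b)
    (v : Fin k → ℝ) (hv : ∀ i, |v i| ≤ r) :
    ∑ w, p w * ∏ i, (1 + v i * X w i) ≤ 1 + b := by
  have e : ∑ w, p w * ∏ i, (1 + v i * X w i) =
      ∑ S : Finset (Fin k), (∏ i ∈ S, v i) * ∑ w, p w * ∏ i ∈ S, X w i := by
    simp only [Finset.prod_one_add, Finset.powerset_univ, Finset.mul_sum]
    rw [Finset.sum_comm]
    refine Finset.sum_congr rfl fun S _ => Finset.sum_congr rfl fun w _ => ?_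
    rw [Finset.prod_mul_distrib]; ring
  rw [e, ← Finset.sum_filter_add_sum_filter_not _ (fun S : Finset (Fin k) => 2 ≤ S.card),
    add_comm]
  refine add_le_add (le_of_eq ?_) (le_trans (Finset.sum_le_sum fun S _ => ?_) hc)
  · rw [Finset.sum_eq_single ∅]
    · simp [hs]
    · intro S hS hne
      have h1 : S.card = 1 := by
        have := (Finset.mem_filter.mp hS).2
        have := Finset.card_pos.mpr (Finset.nonempty_iff_ne_empty.mpr hne)
        omega
      obtain ⟨i, rfl⟩ := Finset.card_eq_one.mp h1
      simp [hmean]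
    · simp
  · refine (le_abs_self _).trans ?_
    rw [abs_mul]
    refine mul_le_mul_of_nonneg_right ?_ (abs_nonneg _)
    rw [Finset.abs_prod]
    refine (Finset.prod_le_prod (fun i _ => abs_nonneg _) (fun i _ => hv i)).trans ?_
    simp

lemma ent_bound {Z : Type*} [Fintype Z] (p pG pB : Z → ℝ) (hk : 2 ≤ k)
    (hsum : ∑ z, p z = 1) (hp : ∀ z, p z = pG z + pB z) (hG : ∀ z, 0 ≤ pG z)
    (hB : ∀ z, 0 ≤ pB z) (hGu : ∀ z, pG z ≤ Real.exp 1 * (1/2)^k)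
    (hBs : ∑ z, pB z ≤ 1 / (4 * k)) : (k:ℝ) - 2 / Real.log 2 ≤ ent p := by
  have hl : 0 < Real.log 2 := Real.log_pos (by norm_num)
  have hl1 : Real.log 2 ≤ 1 := by
    have := Real.log_two_lt_d9; linarith
  have hk' : (2:ℝ) ≤ k := by exact_mod_cast hk
  have hp0 : ∀ z, 0 ≤ p z := fun z => by rw [hp]; exact add_nonneg (hG z) (hB z)
  have hp1 : ∀ z, p z ≤ 1 := fun z => by
    rw [← hsum]; exact Finset.single_le_sum (fun z _ => hp0 z) (Finset.mem_univ z)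
  have hpt : ∀ z, p z * (Real.log (p z) + k * Real.log 2) ≤
      pG z + pB z * (1 + k * Real.log 2) := by
    intro z
    have hR : 0 ≤ pG z + pB z * (1 + k * Real.log 2) := by
      have := hG z; have := hB z; positivity
    rcases (hp0 z).eq_or_lt with h | h
    · rw [← h, zero_mul]; exact hR
    have hlog : Real.log (p z) ≤ 0 := Real.log_nonpos h.le (hp1 z)
    have h1 : Real.log (p z) + k * Real.log 2 ≤ 1 + pB z / (Real.exp 1 * (1/2)^k) := by
      have h2 : p z ≤ Real.exp 1 * (1/2)^k * (1 + pB z / (Real.exp 1 * (1/2)^k)) := by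
        have : Real.exp 1 * (1/2)^k * (1 + pB z / (Real.exp 1 * (1/2)^k)) =
          Real.exp 1 * (1/2)^k + pB z := by
            have : Real.exp 1 * (1/2)^k ≠ 0 := by positivity
            field_simp
        rw [this, hp]; linarith [hGu z]
      have h3 : 0 < 1 + pB z / (Real.exp 1 * (1/2)^k) := by have := hB z; positivity
      have h4 := Real.log_le_log h h2
      rw [Real.log_mul (by positivity) h3.ne', Real.log_mul (by positivity) (by positivity),
        Real.log_exp, Real.log_pow, Real.log_div one_ne_zero two_ne_zero, Real.log_one] at h4
      have h5 := Real.log_le_sub_one_of_pos h3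
      linarith
    have h6 : pG z * (pB z / (Real.exp 1 * (1/2)^k)) ≤ pB z := by
      calc _ ≤ (Real.exp 1 * (1/2)^k) * (pB z / (Real.exp 1 * (1/2)^k)) := by
            have := hB z
            have := hGu z
            gcongr
        _ = pB z := by
            have : Real.exp 1 * (1/2)^k ≠ 0 := by positivity
            field_simp
    have h7 := mul_le_mul_of_nonneg_left h1 (hG z)
    have h8 : pB z * (Real.log (p z) + k * Real.log 2) ≤ pB z * (k * Real.log 2) :=
      mul_le_mul_of_nonneg_left (by linarith) (hB z)
    have : p z * (Real.log (p z) + k * Real.log 2) =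
      pG z * (Real.log (p z) + k * Real.log 2) + pB z * (Real.log (p z) + k * Real.log 2) := by
      rw [← add_mul, ← hp]
    rw [this]
    nlinarith
  have htot : ∑ z, p z * (Real.log (p z) + k * Real.log 2) ≤ 2 := by
    have hGB : ∑ z, pG z + ∑ z, pB z = 1 := by
      rw [← Finset.sum_add_distrib, ← hsum]; exact Finset.sum_congr rfl fun z _ => (hp z).symm
    have hB0 : 0 ≤ ∑ z, pB z := Finset.sum_nonneg fun z _ => hB z
    calc _ ≤ ∑ z, (pG z + pB z * (1 + k * Real.log 2)) := Finset.sum_le_sum fun z _ => hpt z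
      _ = ∑ z, pG z + (∑ z, pB z) * (1 + k * Real.log 2) := by
          rw [Finset.sum_add_distrib, Finset.sum_mul]
      _ = 1 + (∑ z, pB z) * (k * Real.log 2) := by linear_combination hGB
      _ ≤ 1 + (1 / (4 * k)) * (k * 1) := by gcongr
      _ ≤ 2 := by
          have : (1 / (4 * (k:ℝ))) * (k * 1) = 1/4 := by field_simp
          rw [this]; norm_num
  have hent : ent p = k - (∑ z, p z * (Real.log (p z) + k * Real.log 2)) / Real.log 2 := by
    have : ∑ z, p z * (Real.log (p z) + k * Real.log 2) =
        ∑ z, p z * Real.log (p z) + k * Real.log 2 := by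
      simp only [mul_add, Finset.sum_add_distrib]
      rw [← Finset.sum_mul, hsum, one_mul]
    rw [this]
    simp only [ent, Real.logb, ← mul_div_assoc]
    rw [← Finset.sum_div]
    field_simp
    ring
  rw [hent]
  gcongr

end aux

/-- there is a numerical constant `C > 0` such that for any BCD(ρ) family
satisfying the stated conditions (including condition (corr)), the random vector `Y`
obtained from `X ∼ μ₀^n` by `Pr[Y_i = y_i | X] = 1/2 + (y_i/4)·ψ((μ_i^n(X)/μ_0^n(X)−1)/α)`
has entropy `H(Y) ≥ k − C`. -/
theorem statement7 :
    ∃ C : ℝ, 0 < C ∧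
      ∀ (k : ℕ), 2 ≤ k →
      ∀ (Ω : Finset (Fin k → ℝ)), (∀ x ∈ Ω, ∀ i, x i = 1 ∨ x i = -1) →
      ∀ (μ₀ : ↥Ω → ℝ) (μ : Fin k → ↥Ω → ℝ) (ρ : ℝ) (n : ℕ) (α : ℝ),
        IsDist μ₀ → (∀ x, 0 < μ₀ x) →
        (∀ i : Fin k, ∑ x : ↥Ω, (if x.1 i = 1 then μ₀ x else 0) = 1/2) →
        (∀ i x, μ i x = (1 + ρ * x.1 i) * μ₀ x) →
        0 < ρ → ρ < 1 → 1 ≤ n →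
        ρ ≤ 1 / (2 * Real.sqrt n *
          (2 * Real.sqrt (2 * Real.log (8 * (k : ℝ)^2)) + 3)) →
        (∑ S ∈ Finset.univ.filter (fun S : Finset (Fin k) => 2 ≤ S.card),
            (n : ℝ) ^ (-(S.card : ℝ) / 2) * ρ ^ (-(S.card : ℝ)) *
              |∑ x : ↥Ω, μ₀ x * ∏ i ∈ S, (μ i x / μ₀ x - 1)|
          ≤ 1 / (n : ℝ)) →
        0 < α → α ≤ 1/2 →
        α = (2 * Real.sqrt (2 * Real.log (2 * (k : ℝ)^2 / α^2)) + 3) * ρ * Real.sqrt n →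
        (k : ℝ) - C ≤
          ent (fun y : Fin k → ↥Sgn =>
            ∑ x : Fin n → ↥Ω, prodDist μ₀ n x *
              ∏ i, (1/2 + ((y i).1 / 4) *
                psi ((prodDist (μ i) n x / prodDist μ₀ n x - 1) / α))) := by
  classical
  refine ⟨2 / Real.log 2, div_pos two_pos (Real.log_pos (by norm_num)), ?_⟩
  intro k hk Ω hΩ μ₀ μ ρ n α hdist hpos hhalf hμ hρ hρ1 hn _ hcorr hα hα2 hαeq
  have hn' : (1:ℝ) ≤ n := by exact_mod_cast hn
  set X : ↥Ω → Fin k → ℝ := fun w i => w.1 i with hXdef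
  have hX : ∀ w i, |X w i| = 1 := by
    intro w i
    rcases hΩ w.1 w.2 i with h | h <;> simp [hXdef, h]
  have hmean : ∀ i, ∑ w, μ₀ w * X w i = 0 := by
    intro i
    have : ∀ w : ↥Ω, μ₀ w * X w i = 2 * (if w.1 i = 1 then μ₀ w else 0) - μ₀ w := by
      intro w
      rcases hΩ w.1 w.2 i with h | h
      · simp only [hXdef, h, if_true]; ring
      · have : ¬ ((-1:ℝ) = 1) := by norm_num
        simp only [hXdef, h, this, if_false]; ring
    simp only [this, Finset.sum_sub_distrib, ← Finset.mul_sum]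
    rw [hhalf, hdist.2]; norm_num
  have hm1 : 1 ≤ Real.sqrt n := Real.one_le_sqrt.mpr hn'
  have hratio : ∀ i w, μ i w / μ₀ w = 1 + ρ * X w i := by
    intro i w
    rw [hμ, mul_div_assoc, div_self (hpos w).ne', mul_one]
  have hcorr' : ∑ S ∈ Finset.univ.filter (fun S : Finset (Fin k) => 2 ≤ S.card),
      (1 / Real.sqrt n) ^ S.card * |∑ w, μ₀ w * ∏ i ∈ S, X w i| ≤ 1 / (n:ℝ) := by
    refine le_trans (le_of_eq (Finset.sum_congr rfl fun S _ => ?_)) hcorr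
    have h1 : ∑ w, μ₀ w * ∏ i ∈ S, (μ i w / μ₀ w - 1) =
        ρ ^ S.card * ∑ w, μ₀ w * ∏ i ∈ S, X w i := by
      rw [Finset.mul_sum]
      refine Finset.sum_congr rfl fun w _ => ?_
      simp only [hratio, add_sub_cancel_left, Finset.prod_mul_distrib, Finset.prod_const]
      ring
    have h2 : (n:ℝ) ^ (-(S.card:ℝ)/2) = (1 / Real.sqrt n) ^ S.card := by
      rw [Real.sqrt_eq_rpow, one_div, ← Real.rpow_neg (by positivity), ← Real.rpow_natCast,
        ← Real.rpow_mul (by positivity)]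
      congr 1; ring
    have h3 : ρ ^ (-(S.card:ℝ)) * ρ ^ S.card = 1 := by
      rw [Real.rpow_neg hρ.le, Real.rpow_natCast]
      exact inv_mul_cancel₀ (by positivity)
    rw [h1, h2, abs_mul, abs_of_pos (pow_pos hρ _)]
    linear_combination
      -((1 / Real.sqrt n) ^ S.card * |∑ w, μ₀ w * ∏ i ∈ S, X w i|) * h3
  have hrow := row_bound μ₀ hdist.2 X hmean (1 / Real.sqrt n) (1 / n) hcorr'
  have hbad := bad_bound μ₀ hdist.1 hdist.2 X hX hmean ρ α n hk hn hρ hα hα2 hαeq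
  have hr1 : 1 / Real.sqrt n ≤ 1 := by rw [div_le_one (by positivity)]; exact hm1
  have hr : ρ * (3/2) ≤ 1 / Real.sqrt n * α := by
    rw [one_div, inv_mul_eq_div, le_div_iff₀ (by positivity)]
    have h0 : 0 ≤ Real.sqrt (2 * Real.log (2 * (k : ℝ)^2 / α^2)) * (ρ * Real.sqrt n) := by
      positivity
    have h1 : 0 ≤ ρ * Real.sqrt n := by positivity
    nlinarith
  have hL : ∀ i (x : Fin n → ↥Ω), prodDist (μ i) n x / prodDist μ₀ n x =
      ∏ j, (1 + ρ * X (x j) i) := by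
    intro i x
    simp only [prodDist, ← Finset.prod_div_distrib, hratio]
  have hSgn : ∀ y : ↥Sgn, |y.1| = 1 := by
    rintro ⟨y, hy⟩
    simp only [Sgn, Finset.mem_insert, Finset.mem_singleton] at hy
    rcases hy with h | h <;> simp [h]
  have hSsum : ∀ c : ℝ, ∑ y : ↥Sgn, (1/2 + (y.1/4) * c) = 1 := by
    intro c
    rw [Finset.sum_coe_sort Sgn (fun y => 1/2 + (y/4) * c)]
    rw [Sgn, Finset.sum_pair (by norm_num)]; ring
  have hpsi : ∀ s, |psi s| ≤ 1 := by
    intro s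
    rw [abs_le, psi]
    exact ⟨le_max_left _ _, max_le (by norm_num) (min_le_left _ _)⟩
  set K : (Fin n → ↥Ω) → (Fin k → ↥Sgn) → ℝ := fun x y =>
    ∏ i, (1/2 + ((y i).1 / 4) *
      psi ((prodDist (μ i) n x / prodDist μ₀ n x - 1) / α)) with hK
  have hK0 : ∀ x y, 0 ≤ K x y := by
    intro x y
    refine Finset.prod_nonneg fun i _ => ?_
    have h : |(y i).1 * psi ((prodDist (μ i) n x / prodDist μ₀ n x - 1) / α)| ≤ 1 := by
      rw [abs_mul, hSgn, one_mul]; exact hpsi _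
    linarith [(abs_le.mp h).1]
  have hK1 : ∀ x, ∑ y, K x y = 1 := by
    intro x
    have := (Finset.prod_univ_sum (fun _ : Fin k => (Finset.univ : Finset ↥Sgn))
      (fun i y => 1/2 + (y.1 / 4) *
        psi ((prodDist (μ i) n x / prodDist μ₀ n x - 1) / α))).symm
    rw [Fintype.piFinset_univ] at this
    simp only [hK]
    rw [this]
    simp only [hSsum, Finset.prod_const_one]
  have hP0 := prodDist_nonneg μ₀ hdist.1 n
  refine ent_bound _
    (fun y => ∑ x, prodDist μ₀ n x * (if GoodPath X ρ α n (fun _ => 1) x then K x y else 0))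
    (fun y => ∑ x, prodDist μ₀ n x * (if GoodPath X ρ α n (fun _ => 1) x then 0 else K x y))
    hk ?_ ?_ ?_ ?_ ?_ ?_
  · rw [Finset.sum_comm]
    simp only [← Finset.mul_sum]
    refine Eq.trans (Finset.sum_congr rfl fun x _ => ?_) (prodDist_sum μ₀ hdist.2 n)
    have := hK1 x
    simp only [hK] at this
    rw [this, mul_one]
  · intro y
    rw [← Finset.sum_add_distrib]
    refine Finset.sum_congr rfl fun x _ => ?_
    split_ifs <;> simp [hK]
  · intro y
    refine Finset.sum_nonneg fun x _ => mul_nonneg (hP0 x) ?_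
    split_ifs
    · exact hK0 x y
    · exact le_rfl
  · intro y
    refine Finset.sum_nonneg fun x _ => mul_nonneg (hP0 x) ?_
    split_ifs
    · exact le_rfl
    · exact hK0 x y
  · intro y
    have hg := good_bound μ₀ hdist.1 X hX ρ α (1 / Real.sqrt n) (1 + 1 / n) hρ hα hα2 hr1 hr
      (by positivity) hrow (fun i => (y i).1) (fun i => hSgn _) n (fun _ => 1) (by simp)
    simp only [sub_self, mul_zero, zero_div, add_zero, Finset.prod_const_one, mul_one,
      one_mul] at hg
    have hexp : (1 + 1 / (n:ℝ)) ^ n ≤ Real.exp 1 := by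
      calc (1 + 1 / (n:ℝ)) ^ n ≤ (Real.exp (1 / n)) ^ n := by
            gcongr
            linarith [Real.add_one_le_exp (1 / (n:ℝ))]
        _ = Real.exp 1 := by
            rw [← Real.exp_nat_mul]; congr 1; field_simp
    calc _ = (∑ x, prodDist μ₀ n x * (if GoodPath X ρ α n (fun _ => 1) x then
          ∏ i, (1 + (y i).1 * (∏ j, (1 + ρ * X (x j) i) - 1) / (2 * α)) else 0)) * (1/2)^k := by
          rw [Finset.sum_mul]
          refine Finset.sum_congr rfl fun x _ => ?_
          split_ifs with hgood
          · rw [mul_assoc]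
            congr 1
            have hc : ((1:ℝ)/2)^k = ∏ _i : Fin k, (1/2 : ℝ) := by simp
            rw [hc, ← Finset.prod_mul_distrib]
            simp only [hK]
            refine Finset.prod_congr rfl fun i _ => ?_
            have hf := good_final X ρ α n _ x hgood i
            rw [one_mul] at hf
            rw [hL]
            have hps : ∀ s : ℝ, |s| ≤ α → psi (s / α) = s / α := by
              intro s hs
              have := abs_le.mp hs
              rw [psi, min_eq_right, max_eq_right]
              · rw [le_div_iff₀ hα]; linarith
              · rw [div_le_one hα]; linarith
            rw [hps _ hf]
            field_simp
            ring
          · simp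
      _ ≤ (1 + 1 / (n:ℝ)) ^ n * (1/2)^k := by gcongr
      _ ≤ Real.exp 1 * (1/2)^k := by gcongr
  · rw [Finset.sum_comm]
    refine le_trans (le_of_eq (Finset.sum_congr rfl fun x _ => ?_)) hbad
    rw [← Finset.mul_sum]
    split_ifs
    · simp
    · rw [hK1]
end
end

section
/- Let A be a random variable taking values in {−1,1} with 0 < Pr[A = 1] < 1, and let B be a random variable taking values in a finite set, jointly distributed with A. Then H²(P_{B|A=−1}, P_{B|A=1}) ≤ I(A;B) / (2·min(Pr[A=−1], Pr[A=1])), where P_{B|A=a} denotes the conditional distribution of B given A = a. -/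
open Finset

noncomputable section

attribute [local instance] Classical.propDecidable

lemma aux_M (a : ℝ) (ha : 0 < a) (ha1 : a ≤ 1) :
    (a^2+1) * Real.log (a^2+1) ≤ 2 * a * Real.log 2 + 2 * a^2 * Real.log a := by
  let M : ℝ → ℝ := fun a => - (a + a⁻¹) * Real.log (a^2+1) + 2 * a * Real.log a
  have hd : ∀ x : ℝ, 0 < x → HasDerivAt M (((x^2)⁻¹ - 1) * Real.log (x^2+1) + 2 * Real.log x) x := by
    intro x hx
    have hx0 : x ≠ 0 := hx.ne'
    have hx2 : x^2+1 ≠ 0 := by positivity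
    have e1 : HasDerivAt (fun a : ℝ => -(a + a⁻¹)) (-(1 + -(x^2)⁻¹)) x :=
      ((hasDerivAt_id x).add (hasDerivAt_inv hx0)).neg
    have e2 : HasDerivAt (fun a : ℝ => Real.log (a^2+1)) ((2 * x) / (x^2+1)) x := by
      have : HasDerivAt (fun a : ℝ => a^2+1) (2 * x) x := by
        simpa using (hasDerivAt_pow 2 x).add_const 1
      exact this.log hx2
    have e3 : HasDerivAt (fun a : ℝ => 2 * a * Real.log a) (2 * Real.log x + 2 * x * x⁻¹) x := by
      have : HasDerivAt (fun a : ℝ => 2 * a) 2 x := by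
        simpa using (hasDerivAt_id x).const_mul 2
      exact this.mul (Real.hasDerivAt_log hx0)
    refine HasDerivAt.congr_deriv (f := M) ((e1.mul e2).add e3) ?_
    field_simp
    ring
  have hanti : AntitoneOn M (Set.Icc a 1) := by
    apply antitoneOn_of_deriv_nonpos (convex_Icc a 1)
    · intro x hx
      exact (hd x (lt_of_lt_of_le ha hx.1)).continuousAt.continuousWithinAt
    · intro x hx
      rw [interior_Icc] at hx
      exact (hd x (lt_trans ha hx.1)).differentiableAt.differentiableWithinAt
    · intro x hx
      rw [interior_Icc] at hx
      have hx0 : 0 < x := lt_trans ha hx.1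
      rw [(hd x hx0).deriv]
      have l1 : Real.log (x^2+1) ≤ x^2 := by
        have := Real.log_le_sub_one_of_pos (show 0 < x^2+1 by positivity)
        linarith
      have l2 : 2 * Real.log x ≤ x^2 - 1 := by
        have := Real.log_le_sub_one_of_pos (show 0 < x^2 by positivity)
        rw [Real.log_pow] at this
        exact_mod_cast this
      have l3 : 0 ≤ (x^2)⁻¹ - 1 := by
        have : 1 ≤ (x^2)⁻¹ := (one_le_inv₀ (by positivity)).2 (by nlinarith [hx.2])
        linarith
      have l4 := mul_le_mul_of_nonneg_left l1 l3
      have l5 : ((x^2)⁻¹ - 1) * x^2 = 1 - x^2 := by field_simp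
      linarith
  have h := hanti (Set.left_mem_Icc.2 ha1) (Set.right_mem_Icc.2 ha1) ha1
  simp only [M] at h
  norm_num at h
  have h2 := mul_le_mul_of_nonneg_left h ha.le
  have h3 : a * (a + a⁻¹) = a^2 + 1 := by field_simp
  have h4 : a * ((-a⁻¹ + -a) * Real.log (a^2+1) + 2 * a * Real.log a)
    = - ((a^2+1) * Real.log (a^2+1)) + 2 * a^2 * Real.log a := by
    rw [← h3]; ring
  linarith

lemma aux_key_le (x y : ℝ) (hx : 0 < x) (hxy : x ≤ y) :
    (x+y) * Real.log (x+y) ≤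
      2 * (√x * √y) * Real.log 2 + x * Real.log x + y * Real.log y := by
  have hy : 0 < y := hx.trans_le hxy
  have hsx : 0 < √x := Real.sqrt_pos.2 hx
  have hsy : 0 < √y := Real.sqrt_pos.2 hy
  have h := aux_M (√x/√y) (by positivity)
    ((div_le_one hsy).2 (Real.sqrt_le_sqrt hxy))
  have e : (√x/√y)^2 = x / y := by rw [div_pow, Real.sq_sqrt hx.le, Real.sq_sqrt hy.le]
  have e1 : x / y + 1 = (x+y)/y := by field_simp
  rw [e, e1, Real.log_div (by positivity) hy.ne', Real.log_div hsx.ne' hsy.ne',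
    Real.log_sqrt hx.le, Real.log_sqrt hy.le] at h
  have h2 := mul_le_mul_of_nonneg_left h hy.le
  have e2 : y * (√x/√y) = √x * √y := by
    nth_rewrite 1 [← Real.mul_self_sqrt hy.le]
    field_simp
  have e3 : y * ((x + y) / y * (Real.log (x + y) - Real.log y))
     = (x+y) * (Real.log (x + y) - Real.log y) := by field_simp
  have e4 : y * (2 * (√x/√y) * Real.log 2 + 2 * (x / y) * (Real.log x / 2 - Real.log y / 2))
    = 2 * (y * (√x/√y)) * Real.log 2 + x * (Real.log x - Real.log y) := by field_simp
  rw [e3, e4, e2] at h2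
  linarith

lemma aux_key (x y : ℝ) (hx : 0 ≤ x) (hy : 0 ≤ y) :
    (x+y) * Real.log (x+y) ≤
      2 * (√x * √y) * Real.log 2 + x * Real.log x + y * Real.log y := by
  rcases hx.eq_or_lt with rfl | hx
  · simp
  rcases hy.eq_or_lt with rfl | hy
  · simp
  rcases le_total x y with h | h
  · exact aux_key_le x y hx h
  · have := aux_key_le y x hy h
    rw [add_comm x y, mul_comm (√x)]
    linarith

lemma aux_half (α x y : ℝ) (hα : 0 ≤ α) (hα2 : α ≤ 1/2) (hx : 0 ≤ x) (hy : 0 ≤ y) :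
    α * Real.log 2 * (√x - √y)^2 ≤ α * (x * Real.log x) + (1-α) * (y * Real.log y)
      - (α * x + (1-α) * y) * Real.log (α * x + (1-α) * y) := by
  have h := Real.convexOn_mul_log.2 (Set.mem_Ici.2 (show 0 ≤ (x+y)/2 by positivity))
    (Set.mem_Ici.2 hy) (show 0 ≤ 2*α by linarith) (show 0 ≤ 1-2*α by linarith) (by ring)
  simp only [smul_eq_mul] at h
  rw [show 2 * α * ((x+y)/2) + (1-2*α) * y = α * x + (1-α) * y by ring] at h
  have hm : (x+y)/2 * Real.log ((x+y)/2) = (x+y)/2 * (Real.log (x+y) - Real.log 2) := by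
    rcases (add_nonneg hx hy).eq_or_lt with h0 | h0
    · rw [← h0]; simp
    · rw [Real.log_div h0.ne' (by norm_num)]
  rw [hm] at h
  have k := mul_le_mul_of_nonneg_left (aux_key x y hx hy) hα
  have s : (√x - √y)^2 = x + y - 2 * (√x * √y) := by
    rw [sub_sq, Real.sq_sqrt hx, Real.sq_sqrt hy]; ring
  rw [s]
  linarith

lemma aux_pt (α γ x y : ℝ) (hα : 0 ≤ α) (hγ : 0 ≤ γ) (hs : α + γ = 1) (hx : 0 ≤ x) (hy : 0 ≤ y) :
    min α γ * Real.log 2 * (√x - √y)^2 ≤ α * (x * Real.log x) + γ * (y * Real.log y)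
      - (α * x + γ * y) * Real.log (α * x + γ * y) := by
  rcases le_total α γ with h | h
  · rw [min_eq_left h]
    obtain rfl : γ = 1 - α := by linarith
    exact aux_half α x y hα (by linarith) hx hy
  · rw [min_eq_right h]
    obtain rfl : α = 1 - γ := by linarith
    have := aux_half γ y x hγ (by linarith) hy hx
    rw [show (√x - √y)^2 = (√y - √x)^2 by ring, add_comm ((1-γ) * x)]
    linarith

lemma aux_sum {β : Type*} [Fintype β] (P Q : β → ℝ) (α γ : ℝ) (hα : 0 < α) (hγ : 0 < γ)
    (hs : α + γ = 1) (hP : ∀ b, 0 ≤ P b) (hQ : ∀ b, 0 ≤ Q b)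
    (sP : ∑ b, P b = α) (sQ : ∑ b, Q b = γ) :
    (min α γ * Real.log 2) * ∑ b, (√(P b / α) - √(Q b / γ))^2 ≤
      ∑ b, P b * Real.log (P b) + ∑ b, Q b * Real.log (Q b)
        - ∑ b, (P b + Q b) * Real.log (P b + Q b)
        - α * Real.log α - γ * Real.log γ := by
  have key : ∀ b, (min α γ * Real.log 2) * (√(P b / α) - √(Q b / γ))^2 ≤
      P b * Real.log (P b) + Q b * Real.log (Q b) - (P b + Q b) * Real.log (P b + Q b)
       - P b * Real.log α - Q b * Real.log γ := by
    intro b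
    have h := aux_pt α γ (P b / α) (Q b / γ) hα.le hγ.le hs
      (div_nonneg (hP b) hα.le) (div_nonneg (hQ b) hγ.le)
    have aux : ∀ c t : ℝ, 0 < c → c * (t / c * Real.log (t / c)) =
        t * Real.log t - t * Real.log c := by
      intro c t hc
      rcases eq_or_ne t 0 with rfl | ht
      · simp
      · rw [Real.log_div ht hc.ne']; field_simp
    rw [aux _ _ hα, aux _ _ hγ, mul_div_cancel₀ _ hα.ne', mul_div_cancel₀ _ hγ.ne'] at h
    linarith
  rw [Finset.mul_sum]
  refine (Finset.sum_le_sum fun b _ => key b).trans (le_of_eq ?_)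
  simp only [Finset.sum_sub_distrib, Finset.sum_add_distrib, ← Finset.sum_mul, sP, sQ]

/-- for a `{−1,1}`-valued random variable `A` with `0 < Pr[A=1] < 1` and a
finitely-valued random variable `B`,
`H²(P_{B|A=−1}, P_{B|A=1}) ≤ I(A;B)/(2·min(Pr[A=−1], Pr[A=1]))`. -/
theorem statement9 (S : Type) [Fintype S] (p : S → ℝ)
    (hp : (∀ s, 0 ≤ p s) ∧ ∑ s, p s = 1)
    (β : Type) [Fintype β]
    (A : S → ℝ) (hA : ∀ s, A s = 1 ∨ A s = -1) (B : S → β)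
    (h0 : 0 < ∑ s, if A s = 1 then p s else 0)
    (h1 : (∑ s, if A s = 1 then p s else 0) < 1) :
    hellSq
      (fun b => (∑ s, if A s = -1 ∧ B s = b then p s else 0) /
        (∑ s, if A s = -1 then p s else 0))
      (fun b => (∑ s, if A s = 1 ∧ B s = b then p s else 0) /
        (∑ s, if A s = 1 then p s else 0))
    ≤ mutInfo (fun q : ↥({-1, 1} : Finset ℝ) × β =>
          ∑ s, if A s = q.1.1 ∧ B s = q.2 then p s else 0)
      / (2 * min (∑ s, if A s = -1 then p s else 0)
          (∑ s, if A s = 1 then p s else 0)) := by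
  set P : β → ℝ := fun b => ∑ s, if A s = -1 ∧ B s = b then p s else 0 with hPdef
  set Q : β → ℝ := fun b => ∑ s, if A s = 1 ∧ B s = b then p s else 0 with hQdef
  set α : ℝ := ∑ s, if A s = -1 then p s else 0 with hαdef
  set γ : ℝ := ∑ s, if A s = 1 then p s else 0 with hγdef
  have marg : ∀ a : ℝ, (∑ b, ∑ s, if A s = a ∧ B s = b then p s else 0) =
      ∑ s, if A s = a then p s else 0 := by
    intro a
    rw [Finset.sum_comm]
    refine Finset.sum_congr rfl fun s _ => ?_
    by_cases h : A s = a <;> simp [h]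
  have hs : α + γ = 1 := by
    rw [hαdef, hγdef, ← Finset.sum_add_distrib]
    refine Eq.trans ?_ hp.2
    refine Finset.sum_congr rfl fun s _ => ?_
    rcases hA s with h | h <;> rw [h] <;> norm_num
  have hα : 0 < α := by linarith
  have hP : ∀ b, 0 ≤ P b := fun b => Finset.sum_nonneg fun s _ => by
    split_ifs
    · exact hp.1 s
    · exact le_rfl
  have hQ : ∀ b, 0 ≤ Q b := fun b => Finset.sum_nonneg fun s _ => by
    split_ifs
    · exact hp.1 s
    · exact le_rfl
  have main := aux_sum P Q α γ hα h0 hs hP hQ (marg (-1)) (marg 1)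
  have hl2 : 0 < Real.log 2 := Real.log_pos (by norm_num)
  have two : ∀ f : ℝ → ℝ, ∑ a : ↥({-1, 1} : Finset ℝ), f a.1 = f (-1) + f 1 := by
    intro f
    rw [Finset.sum_coe_sort ({-1, 1} : Finset ℝ) f, Finset.sum_pair (by norm_num)]
  have hI : mutInfo (fun q : ↥({-1, 1} : Finset ℝ) × β =>
      ∑ s, if A s = q.1.1 ∧ B s = q.2 then p s else 0) =
      (∑ b, P b * Real.log (P b) + ∑ b, Q b * Real.log (Q b)
        - ∑ b, (P b + Q b) * Real.log (P b + Q b)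
        - α * Real.log α - γ * Real.log γ) / Real.log 2 := by
    unfold mutInfo ent
    simp only [Fintype.sum_prod_type]
    rw [two (fun a => (∑ b, ∑ s, if A s = a ∧ B s = b then p s else 0) *
      Real.logb 2 (∑ b, ∑ s, if A s = a ∧ B s = b then p s else 0)),
      two (fun a => ∑ b, (∑ s, if A s = a ∧ B s = b then p s else 0) *
      Real.logb 2 (∑ s, if A s = a ∧ B s = b then p s else 0))]
    have t3 : ∀ b, (∑ a : ↥({-1, 1} : Finset ℝ), ∑ s, if A s = a.1 ∧ B s = b then p s else 0)
        = P b + Q b := fun b => two (fun a => ∑ s, if A s = a ∧ B s = b then p s else 0)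
    simp only [t3, marg, Real.logb, mul_div_assoc', ← Finset.sum_div]
    simp only [hPdef, hQdef, hαdef, hγdef]
    ring
  have hmin : 0 < min α γ := lt_min hα h0
  rw [hI, le_div_iff₀ (by positivity), le_div_iff₀ hl2]
  unfold hellSq
  refine le_trans (le_of_eq ?_) main
  ring
end
end

section
/- Let b = 5, let d ≥ 3 and 0 < σ < 1 satisfy 4b²σ/(1−σ²) ≤ 1/2, let 2 ≤ r ≤ b, and let I_1,…,I_r be distinct two-element subsets of [d]. Then ∫_{ℝ^d} η_0(x)·∏_{i=1}^r (η_{I_i,σ}(x)/η_0(x)) dx = √( det(Σ_{I_1,…,I_r}) / (1−σ²)^r ), where Σ_{I_1,…,I_r} is the inverse of the matrix I_d + ∑_{i=1}^r (Σ_{I_i,σ}^{−1} − I_d). -/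
open Finset Matrix MeasureTheory

noncomputable section

/-- The `d×d` matrix with unit diagonal, entries `σ` in positions `(i,j)` and `(j,i)`
for `I = {i,j}`, and `0` elsewhere. -/
def SigmaM (d : ℕ) (σ : ℝ) (I : Finset (Fin d)) : Matrix (Fin d) (Fin d) ℝ :=
  Matrix.of fun a b => if a = b then 1 else if ({a, b} : Finset (Fin d)) = I then σ else 0

/-- Density of the centered Gaussian on `ℝ^d` with covariance matrix `Sm`. -/
def gdens (d : ℕ) (Sm : Matrix (Fin d) (Fin d) ℝ) (x : Fin d → ℝ) : ℝ :=
  (2 * Real.pi) ^ (-(d : ℝ)/2) * Sm.det ^ (-(1 : ℝ)/2) *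
    Real.exp (-(x ⬝ᵥ Sm⁻¹.mulVec x) / 2)

/-- Density of the standard Gaussian on `ℝ^d`. -/
def g0dens (d : ℕ) (x : Fin d → ℝ) : ℝ :=
  (2 * Real.pi) ^ (-(d : ℝ)/2) * Real.exp (-(∑ i, x i ^ 2) / 2)

open scoped MatrixOrder in
lemma gauss_integral (d : ℕ) (M : Matrix (Fin d) (Fin d) ℝ) (hM : M.PosDef) :
    ∫ x : Fin d → ℝ, Real.exp (-(x ⬝ᵥ M.mulVec x) / 2)
      = (Real.sqrt (2 * Real.pi)) ^ d / Real.sqrt M.det := by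
  have hdet := hM.det_pos
  obtain ⟨B, hB⟩ := CStarAlgebra.nonneg_iff_eq_star_mul_self.mp hM.posSemidef.nonneg
  have hBt : M = Bᵀ * B := by
    rw [hB, Matrix.star_eq_conjTranspose, Matrix.conjTranspose_eq_transpose_of_trivial]
  have hdM : M.det = B.det ^ 2 := by
    rw [hBt, Matrix.det_mul, Matrix.det_transpose, sq]
  have hBdet : B.det ≠ 0 := by
    intro h
    rw [hdM, h] at hdet
    norm_num at hdet
  set f : (Fin d → ℝ) → ℝ := fun y => ∏ i, Real.exp (-(1/2) * (y i) ^ 2) with hf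
  have hfc : Continuous f := by
    rw [hf]; fun_prop
  have hint : ∫ y, f y = (Real.sqrt (2 * Real.pi)) ^ d := by
    rw [hf, integral_fintype_prod_volume_eq_pow (fun t : ℝ => Real.exp (-(1/2) * t ^ 2)),
      integral_gaussian]
    simp [mul_comm]
  have h1 : ∀ x : Fin d → ℝ, Real.exp (-(x ⬝ᵥ M.mulVec x) / 2) = f (Matrix.toLin' B x) := by
    intro x
    rw [hf]
    simp only [Matrix.toLin'_apply]
    rw [← Real.exp_sum, hBt, ← Matrix.mulVec_mulVec, Matrix.dotProduct_mulVec,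
      Matrix.vecMul_transpose, ← Finset.mul_sum]
    congr 1
    simp only [dotProduct, ← sq]
    ring
  simp_rw [h1]
  have hmeas : AEMeasurable (Matrix.toLin' B) (volume : Measure (Fin d → ℝ)) :=
    (LinearMap.continuous_of_finiteDimensional _).measurable.aemeasurable
  rw [← integral_map hmeas hfc.aestronglyMeasurable,
    Real.map_matrix_volume_pi_eq_smul_volume_pi hBdet, integral_smul_measure, hint,
    ENNReal.toReal_ofReal (abs_nonneg _), hdM, Real.sqrt_sq_eq_abs, abs_inv, smul_eq_mul]
  ring

lemma sigma_eq (d : ℕ) (σ : ℝ) (i j : Fin d) (hij : i ≠ j) :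
    SigmaM d σ {i, j} = 1 + σ • (single i j 1 + single j i 1) := by
  ext a b
  have hp : (({a, b} : Finset (Fin d)) = {i, j}) ↔ (a = i ∧ b = j) ∨ (a = j ∧ b = i) := by
    rw [← Finset.coe_inj]
    push_cast
    exact Set.pair_eq_pair_iff
  simp only [SigmaM, Matrix.of_apply, hp, Matrix.add_apply, Matrix.smul_apply, Matrix.single_apply,
    Matrix.one_apply, smul_eq_mul]
  grind

lemma sigma_det (d : ℕ) (σ : ℝ) (i j : Fin d) (hij : i ≠ j) :
    (SigmaM d σ {i, j}).det = 1 - σ ^ 2 := by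
  have h : SigmaM d σ {i, j} = 1 +
      (Matrix.of fun a (k : Fin 2) => if a = ![i, j] k then (1:ℝ) else 0) *
      (Matrix.of fun (k : Fin 2) b => if b = ![j, i] k then σ else 0) := by
    rw [sigma_eq d σ i j hij]
    congr 1
    ext a b
    simp only [Matrix.mul_apply, Fin.sum_univ_two, Matrix.add_apply, Matrix.smul_apply,
      Matrix.single_apply, smul_eq_mul, Matrix.of_apply, Matrix.cons_val_zero, Matrix.cons_val_one]
    grind
  rw [h, Matrix.det_one_add_mul_comm, Matrix.det_fin_two]
  simp [Matrix.mul_apply, hij.symm]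
  rw [Finset.sum_eq_zero]
  · ring
  · intro x _
    by_cases hx : x = j
    · subst hx
      simp [hij.symm]
    · simp [hx]

lemma sigma_inv (d : ℕ) (σ : ℝ) (hσ : 1 - σ ^ 2 ≠ 0) (i j : Fin d) (hij : i ≠ j) :
    (SigmaM d σ {i, j})⁻¹ = 1 + (1 - σ ^ 2)⁻¹ • (σ ^ 2 • (single i i 1 + single j j 1)
      - σ • (single i j 1 + single j i 1)) := by
  apply Matrix.inv_eq_right_inv
  rw [sigma_eq d σ i j hij]
  set E : Matrix (Fin d) (Fin d) ℝ := single i j 1 + single j i 1 with hE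
  set P : Matrix (Fin d) (Fin d) ℝ := single i i 1 + single j j 1 with hP
  have hEE : E * E = P := by
    simp [hE, hP, add_mul, mul_add, hij, hij.symm, add_comm]
  have hEP : E * P = E := by
    simp [hE, hP, add_mul, mul_add, hij, hij.symm, add_comm]
  simp only [add_mul, mul_add, mul_one, one_mul, Matrix.smul_mul, Matrix.mul_smul, mul_sub, hEE, hEP]
  ext a b
  simp only [Matrix.add_apply, Matrix.sub_apply, Matrix.smul_apply, smul_eq_mul]
  field_simp
  ring

lemma sigma_quad (d : ℕ) (σ : ℝ) (hσ0 : 0 < σ) (hσ1 : σ < 1)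
    (hσb : 4 * 5^2 * σ / (1 - σ^2) ≤ 1/2) (I : Finset (Fin d)) (hI : I.card = 2)
    (x : Fin d → ℝ) :
    -(1/200) * (x ⬝ᵥ x) ≤ x ⬝ᵥ ((SigmaM d σ I)⁻¹ - 1).mulVec x := by
  obtain ⟨i, j, hij, rfl⟩ := Finset.card_eq_two.mp hI
  have hpos : 0 < 1 - σ ^ 2 := by nlinarith
  rw [sigma_inv d σ hpos.ne' i j hij, add_sub_cancel_left]
  have hq : x ⬝ᵥ ((1 - σ ^ 2)⁻¹ • (σ ^ 2 • (single i i 1 + single j j 1)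
      - σ • (single i j 1 + single j i (1:ℝ)))).mulVec x
      = (1 - σ ^ 2)⁻¹ * (σ ^ 2 * (x i ^ 2 + x j ^ 2) - 2 * σ * (x i * x j)) := by
    simp [Matrix.smul_mulVec, Matrix.sub_mulVec, Matrix.add_mulVec, dotProduct_add, dotProduct_sub,
      Matrix.single_mulVec, Function.update_apply]
    simp [dotProduct, Function.update_apply]
    left
    ring
  rw [hq]
  have hle : x i ^ 2 + x j ^ 2 ≤ x ⬝ᵥ x := by
    have := Finset.sum_le_sum_of_subset_of_nonneg (Finset.subset_univ ({i, j} : Finset (Fin d)))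
      (f := fun k => x k ^ 2) (fun k _ _ => sq_nonneg _)
    rw [Finset.sum_pair hij] at this
    simpa [dotProduct, sq] using this
  rw [div_le_iff₀ hpos] at hσb
  rw [← div_eq_inv_mul, le_div_iff₀ hpos]
  have h0 : 0 ≤ x i ^ 2 + x j ^ 2 := by positivity
  have h2 : σ * (x i ^ 2 + x j ^ 2) ≤ (1 - σ ^ 2) / 200 * (x ⬝ᵥ x) :=
    mul_le_mul (by linarith) hle h0 (by linarith)
  have h3 : 0 ≤ σ ^ 2 * (x i ^ 2 + x j ^ 2) := by positivity
  have h4 : 0 ≤ σ * (x i - x j) ^ 2 := by positivity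
  nlinarith

lemma sigma_symm (d : ℕ) (σ : ℝ) (I : Finset (Fin d)) : (SigmaM d σ I)ᵀ = SigmaM d σ I := by
  ext a b
  simp [SigmaM, Finset.pair_comm, eq_comm]

lemma M_posDef (d : ℕ) (σ : ℝ) (hσ0 : 0 < σ) (hσ1 : σ < 1)
    (hσb : 4 * 5^2 * σ / (1 - σ^2) ≤ 1/2) (r : ℕ) (hrb : r ≤ 5)
    (I : Fin r → Finset (Fin d)) (hcard : ∀ i, (I i).card = 2) :
    (1 + ∑ i, ((SigmaM d σ (I i))⁻¹ - 1) : Matrix (Fin d) (Fin d) ℝ).PosDef := by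
  apply Matrix.PosDef.of_dotProduct_mulVec_pos
  · rw [Matrix.IsHermitian, Matrix.conjTranspose_eq_transpose_of_trivial]
    simp [Matrix.transpose_sum, Matrix.transpose_nonsing_inv, sigma_symm]
  · intro x hx
    have hxx : 0 < x ⬝ᵥ x := by
      have := Matrix.dotProduct_star_self_pos_iff.mpr hx
      simpa using this
    rw [star_trivial, Matrix.add_mulVec, Matrix.one_mulVec, Matrix.sum_mulVec, dotProduct_add,
      dotProduct_sum]
    have h := Finset.sum_le_sum (s := Finset.univ)
      (fun k _ => sigma_quad d σ hσ0 hσ1 hσb (I k) (hcard k) x)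
    simp only [Finset.sum_const, Finset.card_univ, Fintype.card_fin, nsmul_eq_mul] at h
    have hr : (r : ℝ) ≤ 5 := by exact_mod_cast hrb
    nlinarith

/-- with `b = 5`: for distinct two-element subsets `I_1,…,I_r` of `[d]`,
`∫ η₀(x) ∏_i (η_{I_i,σ}(x)/η₀(x)) dx = √(det(Σ_{I_1,…,I_r})/(1−σ²)^r)` where
`Σ_{I_1,…,I_r}` is the inverse of `I_d + ∑_i (Σ_{I_i,σ}^{−1} − I_d)`. -/
theorem statement16 (d : ℕ) (hd : 3 ≤ d) (σ : ℝ) (hσ0 : 0 < σ) (hσ1 : σ < 1)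
    (hσb : 4 * 5^2 * σ / (1 - σ^2) ≤ 1/2)
    (r : ℕ) (hr2 : 2 ≤ r) (hrb : r ≤ 5)
    (I : Fin r → Finset (Fin d)) (hcard : ∀ i, (I i).card = 2)
    (hinj : Function.Injective I) :
    (∫ x : Fin d → ℝ, g0dens d x * ∏ i, (gdens d (SigmaM d σ (I i)) x / g0dens d x))
      = Real.sqrt
          (((1 + ∑ i, ((SigmaM d σ (I i))⁻¹ - 1) : Matrix (Fin d) (Fin d) ℝ)⁻¹).det
            / (1 - σ^2)^r) := by
  have hpos : 0 < 1 - σ ^ 2 := by nlinarith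
  set M : Matrix (Fin d) (Fin d) ℝ := 1 + ∑ i, ((SigmaM d σ (I i))⁻¹ - 1) with hMdef
  have hM : M.PosDef := M_posDef d σ hσ0 hσ1 hσb r hrb I hcard
  have hdet : ∀ i, (SigmaM d σ (I i)).det = 1 - σ ^ 2 := by
    intro i
    obtain ⟨a, b, hab, h⟩ := Finset.card_eq_two.mp (hcard i)
    rw [h, sigma_det d σ a b hab]
  have hc : (0:ℝ) < (2 * Real.pi) ^ (-(d : ℝ)/2) := by positivity
  have key : ∀ x : Fin d → ℝ,
      g0dens d x * ∏ i, (gdens d (SigmaM d σ (I i)) x / g0dens d x)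
      = ((2 * Real.pi) ^ (-(d : ℝ)/2) * ((1 - σ ^ 2) ^ (-(1 : ℝ)/2)) ^ r) *
        Real.exp (-(x ⬝ᵥ M.mulVec x) / 2) := by
    intro x
    have hxx : ∑ i, x i ^ 2 = x ⬝ᵥ x := by simp [dotProduct, sq]
    have hq : ∀ i, gdens d (SigmaM d σ (I i)) x / g0dens d x
        = (1 - σ ^ 2) ^ (-(1 : ℝ)/2) *
          Real.exp (-(x ⬝ᵥ ((SigmaM d σ (I i))⁻¹ - 1).mulVec x) / 2) := by
      intro i
      have he : Real.exp (-(x ⬝ᵥ (SigmaM d σ (I i))⁻¹.mulVec x) / 2)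
          = Real.exp (-(x ⬝ᵥ ((SigmaM d σ (I i))⁻¹ - 1).mulVec x) / 2)
            * Real.exp (-(x ⬝ᵥ x) / 2) := by
        rw [← Real.exp_add, Matrix.sub_mulVec, Matrix.one_mulVec, dotProduct_sub]
        congr 1
        ring
      rw [gdens, g0dens, hdet, hxx, he, div_eq_iff (by positivity)]
      ring
    simp_rw [hq]
    rw [Finset.prod_mul_distrib, Finset.prod_const, Finset.card_univ, Fintype.card_fin,
      ← Real.exp_sum, g0dens, hxx]
    have he : Real.exp (-(x ⬝ᵥ M.mulVec x) / 2) = Real.exp (-(x ⬝ᵥ x) / 2) *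
        Real.exp (∑ i, -(x ⬝ᵥ ((SigmaM d σ (I i))⁻¹ - 1).mulVec x) / 2) := by
      rw [← Real.exp_add, hMdef, Matrix.add_mulVec, Matrix.one_mulVec, Matrix.sum_mulVec,
        dotProduct_add, dotProduct_sum, ← Finset.sum_div, Finset.sum_neg_distrib]
      congr 1
      ring
    rw [he]
    ring
  simp_rw [key]
  rw [integral_const_mul, gauss_integral d M hM, Matrix.det_nonsing_inv, Ring.inverse_eq_inv',
    Real.sqrt_div (inv_nonneg.mpr hM.det_pos.le), Real.sqrt_inv]
  have h1 : (2 * Real.pi) ^ (-(d : ℝ)/2) * (Real.sqrt (2 * Real.pi)) ^ d = 1 := by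
    rw [Real.sqrt_eq_rpow, ← Real.rpow_natCast, ← Real.rpow_mul (by positivity),
      ← Real.rpow_add (by positivity)]
    ring_nf
    simp
  have h2 : ((1 - σ ^ 2) ^ (-(1 : ℝ)/2)) ^ r = (Real.sqrt ((1 - σ ^ 2) ^ r))⁻¹ := by
    generalize 1 - σ ^ 2 = t at hpos
    rw [Real.sqrt_eq_rpow, ← Real.rpow_natCast, ← Real.rpow_natCast, ← Real.rpow_mul hpos.le,
      ← Real.rpow_mul hpos.le, ← Real.rpow_neg hpos.le]
    congr 1
    ring
  rw [h2]
  calc _ = ((2 * Real.pi) ^ (-(d : ℝ)/2) * (Real.sqrt (2 * Real.pi)) ^ d) *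
        ((Real.sqrt M.det)⁻¹ / Real.sqrt ((1 - σ ^ 2) ^ r)) := by ring
    _ = _ := by rw [h1, one_mul]
end
end

section
/- Let d ≥ 3, 0 < σ ≤ 1/2, and let R ≥ 1 satisfy σR²/(1−σ²) ≤ 1 and d·e^{−R²/2} ≤ σ. Then for every two-element subset I ⊆ [d] and every x ∈ [−R,R]^d, | η_{I,σ,R}(x) / η_{0,R}(x) − 1 | ≤ 2σ²/(1−σ²) + 4σR²/(1−σ²)² + 2σ, where for a density η on ℝ^d, its truncation to [−R,R]^d is η_R(x) = η(x)/η([−R,R]^d) for x ∈ [−R,R]^d and 0 otherwise, with η([−R,R]^d) = ∫_{[−R,R]^d} η(y) dy. -/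
open Finset Matrix MeasureTheory

noncomputable section

/-- The mass a density `f` on `ℝ^d` assigns to the box `[−R,R]^d`. -/
def boxMass (d : ℕ) (R : ℝ) (f : (Fin d → ℝ) → ℝ) : ℝ :=
  ∫ y in (Set.univ.pi fun _ : Fin d => Set.Icc (-R) R), f y


def Efun (d : ℕ) (σ : ℝ) (i j : Fin d) (x : Fin d → ℝ) : ℝ :=
  (σ * (x i * x j) - σ^2 * (x i ^ 2 + x j ^ 2) / 2) / (1 - σ^2)

lemma SigmaM_eq (d : ℕ) (σ : ℝ) (i j : Fin d) (hij : i ≠ j) :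
    SigmaM d σ {i, j} = 1 + Matrix.single i j σ + Matrix.single j i σ := by
  ext a b
  have key : (({a, b} : Finset (Fin d)) = {i, j}) ↔ ((a = i ∧ b = j) ∨ (a = j ∧ b = i)) := by
    rw [← Finset.coe_inj]
    push_cast
    exact Set.pair_eq_pair_iff
  simp only [SigmaM, Matrix.of_apply, Matrix.add_apply, Matrix.one_apply, Matrix.single_apply, key]
  by_cases hab : a = b
  · subst hab
    have h1 : ¬ (i = a ∧ j = a) := by rintro ⟨rfl, h⟩; exact hij h.symm
    have h2 : ¬ (j = a ∧ i = a) := by rintro ⟨rfl, h⟩; exact hij h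
    simp [h1, h2]
  · by_cases h1 : a = i ∧ b = j
    · obtain ⟨rfl, rfl⟩ := h1
      simp [hij, hij.symm]
    · by_cases h2 : a = j ∧ b = i
      · obtain ⟨rfl, rfl⟩ := h2
        simp [hij, hij.symm]
      · have h3 : ¬ (i = a ∧ j = b) := fun h => h1 ⟨h.1.symm, h.2.symm⟩
        have h4 : ¬ (j = a ∧ i = b) := fun h => h2 ⟨h.1.symm, h.2.symm⟩
        simp [hab, h1, h2, h3, h4]

lemma pair_le_sum {d : ℕ} (i j : Fin d) (hij : i ≠ j) (x : Fin d → ℝ) :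
    x i ^ 2 + x j ^ 2 ≤ ∑ a, x a ^ 2 := by
  rw [← Finset.sum_pair (f := fun a => x a ^ 2) hij]
  exact Finset.sum_le_sum_of_subset_of_nonneg (Finset.subset_univ _) (fun _ _ _ => sq_nonneg _)

lemma SigmaM_mulVec (d : ℕ) (σ : ℝ) (i j : Fin d) (hij : i ≠ j) (x : Fin d → ℝ) :
    (SigmaM d σ {i, j}).mulVec x = x + Pi.single i (σ * x j) + Pi.single j (σ * x i) := by
  rw [SigmaM_eq d σ i j hij, Matrix.add_mulVec, Matrix.add_mulVec, Matrix.one_mulVec]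
  simp [Matrix.single_mulVec, Pi.single, Function.update]
  try rfl

lemma SigmaM_det_pos (d : ℕ) (σ : ℝ) (hσ0 : 0 < σ) (hσ : σ ≤ 1/2) (i j : Fin d) (hij : i ≠ j) :
    0 < (SigmaM d σ {i, j}).det := by
  apply Matrix.PosDef.det_pos
  apply Matrix.PosDef.of_dotProduct_mulVec_pos
  · rw [SigmaM_eq d σ i j hij]
    ext a b
    simp [Matrix.one_apply, Matrix.single_apply, and_comm, eq_comm]
    ring
  · intro x hx
    rw [SigmaM_mulVec d σ i j hij]
    simp only [star_trivial, dotProduct_add, dotProduct_single]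
    have h := pair_le_sum i j hij x
    have e : x ⬝ᵥ x = ∑ a, x a ^ 2 := by simp [dotProduct, pow_two]
    have p : 0 < x ⬝ᵥ x := by
      have := dotProduct_self_star_pos_iff.mpr hx
      simpa using this
    rw [e] at *
    nlinarith [sq_nonneg (x i + x j)]

lemma quad_eq (d : ℕ) (σ : ℝ) (hσ0 : 0 < σ) (hσ : σ ≤ 1/2) (i j : Fin d) (hij : i ≠ j)
    (x : Fin d → ℝ) :
    -(x ⬝ᵥ (SigmaM d σ {i, j})⁻¹.mulVec x) / 2 = Efun d σ i j x + -(∑ a, x a ^ 2) / 2 := by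
  have hdet := SigmaM_det_pos d σ hσ0 hσ i j hij
  have hs : (1 - σ^2) ≠ 0 := by nlinarith
  set y : Fin d → ℝ := x + (Pi.single i ((σ^2 * x i - σ * x j) / (1 - σ^2) : ℝ) : Fin d → ℝ)
    + (Pi.single j ((σ^2 * x j - σ * x i) / (1 - σ^2) : ℝ) : Fin d → ℝ) with hy
  have hx : (SigmaM d σ {i, j}).mulVec y = x := by
    rw [SigmaM_mulVec d σ i j hij]
    ext a
    by_cases h1 : a = i
    · subst h1
      simp [hy, hij, hij.symm]
      field_simp
      ring
    · by_cases h2 : a = j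
      · subst h2
        simp [hy, hij, hij.symm]
        field_simp
        ring
      · simp [hy, h1, h2]
  have hinv : (SigmaM d σ {i, j})⁻¹.mulVec x = y := by
    conv_lhs => rw [← hx]
    rw [Matrix.mulVec_mulVec, Matrix.nonsing_inv_mul _ (isUnit_iff_ne_zero.mpr hdet.ne'),
      Matrix.one_mulVec]
  rw [hinv, hy]
  simp only [dotProduct_add, dotProduct_single]
  have e : x ⬝ᵥ x = ∑ a, x a ^ 2 := by simp [dotProduct, pow_two]
  rw [e, Efun]
  field_simp
  ring

lemma gdens_eq (d : ℕ) (σ : ℝ) (hσ0 : 0 < σ) (hσ : σ ≤ 1/2) (i j : Fin d) (hij : i ≠ j)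
    (x : Fin d → ℝ) :
    gdens d (SigmaM d σ {i, j}) x = (SigmaM d σ {i, j}).det ^ (-(1 : ℝ)/2) *
      (Real.exp (Efun d σ i j x) * g0dens d x) := by
  rw [gdens, quad_eq d σ hσ0 hσ i j hij, Real.exp_add, g0dens]
  ring

lemma flip_zero (d : ℕ) (R : ℝ) (i j : Fin d) (hij : i ≠ j) :
    ∫ y in (Set.univ.pi fun _ : Fin d => Set.Icc (-R) R), y i * y j * g0dens d y = 0 := by
  let e : (Fin d → ℝ) ≃ᵐ (Fin d → ℝ) := MeasurableEquiv.piCongrRight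
    (fun a : Fin d => if a = i then MeasurableEquiv.neg ℝ else MeasurableEquiv.refl ℝ)
  have he : ∀ y a, e y a = if a = i then - y a else y a := by
    intro y a
    by_cases h : a = i
    · simp [e, MeasurableEquiv.piCongrRight, h]
    · simp [e, MeasurableEquiv.piCongrRight, h]
  have hm : MeasurePreserving e volume volume := by
    apply volume_preserving_pi
    intro a
    by_cases h : a = i
    · simp only [h, if_true]
      exact Measure.measurePreserving_neg volume
    · simp only [h, if_false]
      exact MeasurePreserving.id volume
  have hpre : e ⁻¹' (Set.univ.pi fun _ : Fin d => Set.Icc (-R) R)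
      = (Set.univ.pi fun _ : Fin d => Set.Icc (-R) R) := by
    ext y
    simp only [Set.mem_preimage, Set.mem_univ_pi, he]
    refine forall_congr' fun a => ?_
    by_cases h : a = i
    · simp only [h, if_true, Set.mem_Icc]
      constructor <;> rintro ⟨h1, h2⟩ <;> constructor <;> linarith
    · simp [h]
  have key := hm.setIntegral_preimage_emb e.measurableEmbedding
    (fun y => y i * y j * g0dens d y) (Set.univ.pi fun _ : Fin d => Set.Icc (-R) R)
  rw [hpre] at key
  have hf : ∀ y, e y i * e y j * g0dens d (e y) = -(y i * y j * g0dens d y) := by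
    intro y
    have h0 : g0dens d (e y) = g0dens d y := by
      unfold g0dens
      congr 4
      refine Finset.sum_congr rfl fun a _ => ?_
      rw [he]
      split_ifs <;> ring
    rw [h0, he, he]
    simp [hij.symm]
  simp only [hf] at key
  rw [integral_neg] at key
  linarith

lemma core_s19 (σ t E A B U : ℝ) (hσ0 : 0 < σ) (hσ : σ ≤ 1/2) (ht0 : 0 ≤ t) (ht : t ≤ 1)
    (hA : 0 < A) (hE1 : E ≤ t * (1 - σ)) (hE2 : -(t * (1 + σ)) ≤ E)
    (hB1 : (1 - σ * t) * A ≤ B) (hB2 : B ≤ Real.exp (t * (1 - σ)) * A) (hU : 4 * t ≤ U) :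
    |Real.exp E * A / B - 1| ≤ U := by
  have hB : 0 < B := lt_of_lt_of_le (mul_pos (by nlinarith) hA) hB1
  have hexp : Real.exp E ≤ 1 + 2 * (t * (1 - σ)) := by
    refine (Real.exp_le_exp.mpr hE1).trans ?_
    have hs0 : 0 ≤ t * (1 - σ) := by nlinarith
    have hs1 : t * (1 - σ) ≤ 1 := by nlinarith
    have := Real.abs_exp_sub_one_le (x := t * (1 - σ)) (by rw [abs_of_nonneg hs0]; exact hs1)
    rw [abs_of_nonneg hs0] at this
    linarith [le_abs_self (Real.exp (t * (1 - σ)) - 1)]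
  rw [abs_le]
  constructor
  · have h : Real.exp (-(2 * t)) ≤ Real.exp E * A / B := by
      rw [le_div_iff₀ hB]
      calc Real.exp (-(2 * t)) * B
          ≤ Real.exp (-(2 * t)) * (Real.exp (t * (1 - σ)) * A) := by gcongr
        _ = Real.exp (-(t * (1 + σ))) * A := by
            rw [← mul_assoc, ← Real.exp_add]; congr 2; ring
        _ ≤ Real.exp E * A := by gcongr
    have := Real.add_one_le_exp (-(2 * t))
    linarith
  · have h : Real.exp E * A / B ≤ 1 + 4 * t := by
      rw [div_le_iff₀ hB]
      calc Real.exp E * A ≤ (1 + 2 * (t * (1 - σ))) * A := by gcongr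
        _ ≤ ((1 + 4 * t) * (1 - σ * t)) * A := by
            gcongr
            have : σ * t ≤ 1/2 := by nlinarith
            nlinarith
        _ = (1 + 4 * t) * ((1 - σ * t) * A) := by ring
        _ ≤ (1 + 4 * t) * B := by gcongr
    linarith

lemma E_bounds (d : ℕ) (σ R : ℝ) (hσ0 : 0 < σ) (hσ : σ ≤ 1/2) (i j : Fin d)
    (x : Fin d → ℝ) (hx : ∀ a, x a ∈ Set.Icc (-R) R) :
    Efun d σ i j x ≤ σ * R^2 / (1 - σ^2) * (1 - σ) ∧
    -(σ * R^2 / (1 - σ^2) * (1 + σ)) ≤ Efun d σ i j x ∧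
    σ / (1 - σ^2) * (x i * x j) - σ * (σ * R^2 / (1 - σ^2)) ≤ Efun d σ i j x := by
  have hs : 0 < 1 - σ^2 := by nlinarith
  have hi : x i ^ 2 ≤ R ^ 2 := by
    obtain ⟨h1, h2⟩ := hx i
    nlinarith
  have hj : x j ^ 2 ≤ R ^ 2 := by
    obtain ⟨h1, h2⟩ := hx j
    nlinarith
  have hp1 : x i * x j ≤ (x i ^ 2 + x j ^ 2) / 2 := by nlinarith [sq_nonneg (x i - x j)]
  have hp2 : -R^2 ≤ x i * x j := by nlinarith [sq_nonneg (x i + x j)]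
  have hσ2 : 0 < σ ^ 2 := by positivity
  have hσ3 : 0 < σ - σ ^ 2 := by nlinarith
  have a1 := mul_le_mul_of_nonneg_left hp1 hσ0.le
  have a2 := mul_le_mul_of_nonneg_left hp2 hσ0.le
  have a3 : σ^2 * ((x i ^ 2 + x j ^ 2) / 2) ≤ σ^2 * R^2 := by
    apply mul_le_mul_of_nonneg_left _ hσ2.le; linarith
  have a4 : (σ - σ^2) * ((x i ^ 2 + x j ^ 2) / 2) ≤ (σ - σ^2) * R^2 := by
    apply mul_le_mul_of_nonneg_left _ hσ3.le; linarith
  unfold Efun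
  refine ⟨?_, ?_, ?_⟩
  · rw [div_mul_eq_mul_div, div_le_div_iff_of_pos_right hs]
    linarith
  · rw [div_mul_eq_mul_div, ← neg_div, div_le_div_iff_of_pos_right hs]
    linarith
  · rw [div_mul_eq_mul_div, ← mul_div_assoc, ← sub_div, div_le_div_iff_of_pos_right hs]
    linarith

/-- for the truncations to `[−R,R]^d` of the correlated Gaussian density
`η_{I,σ}` and the standard Gaussian density `η_0`, for every two-element `I ⊆ [d]` and
every `x ∈ [−R,R]^d`,
`|η_{I,σ,R}(x)/η_{0,R}(x) − 1| ≤ 2σ²/(1−σ²) + 4σR²/(1−σ²)² + 2σ`. -/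
theorem statement19 (d : ℕ) (hd : 3 ≤ d) (σ : ℝ) (hσ0 : 0 < σ) (hσ : σ ≤ 1/2)
    (R : ℝ) (hR : 1 ≤ R) (h1 : σ * R^2 / (1 - σ^2) ≤ 1)
    (h2 : (d : ℝ) * Real.exp (-R^2 / 2) ≤ σ)
    (I : Finset (Fin d)) (hI : I.card = 2)
    (x : Fin d → ℝ) (hx : ∀ a, x a ∈ Set.Icc (-R) R) :
    |(gdens d (SigmaM d σ I) x / boxMass d R (gdens d (SigmaM d σ I))) /
        (g0dens d x / boxMass d R (g0dens d)) - 1|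
      ≤ 2*σ^2/(1-σ^2) + 4*σ*R^2/(1-σ^2)^2 + 2*σ := by
  obtain ⟨i, j, hij, rfl⟩ := Finset.card_eq_two.mp hI
  set t := σ * R^2 / (1 - σ^2) with ht
  have hs : 0 < 1 - σ^2 := by nlinarith
  have ht0 : 0 ≤ t := by positivity
  set S : Set (Fin d → ℝ) := Set.univ.pi fun _ : Fin d => Set.Icc (-R) R with hS
  have hSc : IsCompact S := isCompact_univ_pi fun _ => isCompact_Icc
  have hSm : MeasurableSet S := hSc.measurableSet
  have hgc : Continuous (g0dens d) := by unfold g0dens; fun_prop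
  have hEc : Continuous (Efun d σ i j) := by unfold Efun; fun_prop
  have hgpos : ∀ y, 0 < g0dens d y := fun y => by unfold g0dens; positivity
  have hmem : ∀ y ∈ S, ∀ a, y a ∈ Set.Icc (-R) R := fun y hy a => hy a (Set.mem_univ a)
  have hI0 : IntegrableOn (g0dens d) S := hgc.continuousOn.integrableOn_compact hSc
  have hIE : IntegrableOn (fun y => Real.exp (Efun d σ i j y) * g0dens d y) S :=
    (by fun_prop : Continuous fun y => Real.exp (Efun d σ i j y) * g0dens d y).continuousOn.integrableOn_compact hSc
  have hIp : IntegrableOn (fun y => y i * y j * g0dens d y) S :=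
    (by fun_prop : Continuous fun y => y i * y j * g0dens d y).continuousOn.integrableOn_compact hSc
  have hK : 0 < (SigmaM d σ {i, j}).det ^ (-(1 : ℝ)/2) :=
    Real.rpow_pos_of_pos (SigmaM_det_pos d σ hσ0 hσ i j hij) _
  set K := (SigmaM d σ {i, j}).det ^ (-(1 : ℝ)/2) with hKdef
  set A := ∫ y in S, g0dens d y with hAdef
  set B := ∫ y in S, Real.exp (Efun d σ i j y) * g0dens d y with hBdef
  have hA : 0 < A := by
    rw [hAdef, setIntegral_pos_iff_support_of_nonneg_ae
      (Filter.Eventually.of_forall fun y => (hgpos y).le) hI0]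
    have : Function.support (g0dens d) = Set.univ := by
      ext y; simp [(hgpos y).ne']
    rw [this, Set.univ_inter, hS, volume_pi_pi]
    rw [pos_iff_ne_zero, Finset.prod_ne_zero_iff]
    intro a _
    rw [Real.volume_Icc]
    simp
    linarith
  have hB1 : (1 - σ * t) * A ≤ B := by
    have h0 := flip_zero d R i j hij
    rw [← hS] at h0
    have e : (1 - σ * t) * A = ∫ y in S, ((1 - σ * t) * g0dens d y
        + σ / (1 - σ^2) * (y i * y j * g0dens d y)) := by
      rw [integral_add (hI0.const_mul _) (hIp.const_mul _), integral_const_mul,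
        integral_const_mul, h0]
      ring
    rw [e]
    refine setIntegral_mono_on ((hI0.const_mul _).add (hIp.const_mul _)) hIE hSm fun y hy => ?_
    have h3 := (E_bounds d σ R hσ0 hσ i j y (hmem y hy)).2.2
    have h4 := Real.add_one_le_exp (Efun d σ i j y)
    have h5 : 1 - σ * t + σ / (1 - σ^2) * (y i * y j) ≤ Real.exp (Efun d σ i j y) := by
      rw [ht]; linarith
    have h6 := mul_le_mul_of_nonneg_right h5 (hgpos y).le
    linarith
  have hB2 : B ≤ Real.exp (t * (1 - σ)) * A := by
    rw [hAdef, ← integral_const_mul]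
    refine setIntegral_mono_on hIE (hI0.const_mul _) hSm fun y hy => ?_
    exact mul_le_mul_of_nonneg_right
      (Real.exp_le_exp.mpr (E_bounds d σ R hσ0 hσ i j y (hmem y hy)).1) (hgpos y).le
  have hmI : boxMass d R (gdens d (SigmaM d σ {i, j})) = K * B := by
    unfold boxMass
    simp only [gdens_eq d σ hσ0 hσ i j hij]
    rw [integral_const_mul]
  have hm0 : boxMass d R (g0dens d) = A := rfl
  have hB : 0 < B := by
    refine lt_of_lt_of_le (mul_pos ?_ hA) hB1
    nlinarith
  rw [hmI, hm0, gdens_eq d σ hσ0 hσ i j hij]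
  have hr : K * (Real.exp (Efun d σ i j x) * g0dens d x) / (K * B) / (g0dens d x / A)
      = Real.exp (Efun d σ i j x) * A / B := by
    have := (hgpos x).ne'
    have := hK.ne'
    field_simp
  rw [← hKdef, hr]
  obtain ⟨hE1, hE2, _⟩ := E_bounds d σ R hσ0 hσ i j x hx
  refine core_s19 σ t _ A B _ hσ0 hσ ht0 h1 hA hE1 hE2 hB1 hB2 ?_
  have q1 : 0 ≤ 2*σ^2/(1-σ^2) := by positivity
  have q2 : 4 * t ≤ 4*σ*R^2/(1-σ^2)^2 := by
    rw [ht, ← mul_div_assoc, ← mul_assoc]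
    apply div_le_div_of_nonneg_left (by positivity) (by positivity)
    nlinarith
  linarith
end
end
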